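/- arXiv:2302.08033 — 2 statements merged into one kernel-verified Lean document; each statement's English description precedes it below -/
import Mathlib

section
/- Discrete LBB (inf-sup) condition for the MAC scheme: there exists a constant β > 0, independent of N, such that for every integer N ≥ 2 and every q ∈ M_h there exists v = (v¹,v²) ∈ V_h^(1) × V_h^(2) with |v|₁ > 0 and b_h(v, q) ≥ β ‖q‖_{M} |v|₁, where b_h(v,q) = −h² Σ_{i=1}^{N} Σ_{j=1}^{N} q_{i-1/2,j-1/2} ( δ⁻₁ v¹_{i,j-1/2} + δ⁻₂ v²_{i-1/2,j} ). -/
open Finset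

noncomputable section

/-- mesh size `h = 1/N` -/
def gh (N : ℕ) : ℝ := 1 / (N : ℝ)

/-- weights `ρ_0 = ρ_N = 1/2`, `ρ_k = 1` otherwise -/
def rho (N k : ℕ) : ℝ := if k = 0 ∨ k = N then 1/2 else 1

/-- membership in `V_h^(1)`: `v i j` denotes `v_{i, j-1/2}` for `0 ≤ i ≤ N`, `0 ≤ j ≤ N+1`
(index `j` corresponds to the half-integer ordinate `j - 1/2`). -/
def inV1 (N : ℕ) (v : ℕ → ℕ → ℝ) : Prop :=
  (∀ j, v 0 j = 0) ∧ (∀ j, v N j = 0) ∧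
  (∀ i, v i 0 = - v i 1) ∧ (∀ i, v i (N+1) = - v i N)

/-- membership in `V_h^(2)`: `v i j` denotes `v_{i-1/2, j}` for `0 ≤ i ≤ N+1`, `0 ≤ j ≤ N`. -/
def inV2 (N : ℕ) (v : ℕ → ℕ → ℝ) : Prop :=
  (∀ i, v i 0 = 0) ∧ (∀ i, v i N = 0) ∧
  (∀ j, v 0 j = - v 1 j) ∧ (∀ j, v (N+1) j = - v N j)

/-- membership in `M_h`: `q i j` denotes `q_{i-1/2, j-1/2}` for `1 ≤ i, j ≤ N`, discrete mean zero. -/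
def inM (N : ℕ) (q : ℕ → ℕ → ℝ) : Prop :=
  ∑ i ∈ Icc 1 N, ∑ j ∈ Icc 1 N, q i j = 0

/-- `(·,·)_{M_h}` inner product (cell centers `1 ≤ i, j ≤ N`). -/
def innerM (N : ℕ) (q r : ℕ → ℕ → ℝ) : ℝ :=
  gh N ^ 2 * ∑ i ∈ Icc 1 N, ∑ j ∈ Icc 1 N, q i j * r i j

/-- `(·,·)_{V_h^(1)}` inner product (nodes `(i, j-1/2)`, `1 ≤ i ≤ N-1`, `1 ≤ j ≤ N`). -/
def innerV1 (N : ℕ) (v w : ℕ → ℕ → ℝ) : ℝ :=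
  gh N ^ 2 * ∑ i ∈ Icc 1 (N-1), ∑ j ∈ Icc 1 N, v i j * w i j

/-- `(·,·)_{V_h^(2)}` inner product (nodes `(i-1/2, j)`, `1 ≤ i ≤ N`, `1 ≤ j ≤ N-1`). -/
def innerV2 (N : ℕ) (v w : ℕ → ℕ → ℝ) : ℝ :=
  gh N ^ 2 * ∑ i ∈ Icc 1 N, ∑ j ∈ Icc 1 (N-1), v i j * w i j

/-- `(·,·)_{W_h^(1)}` inner product (vertices `1 ≤ i ≤ N-1`, `0 ≤ j ≤ N`, weights `ρ_j`). -/
def innerW1 (N : ℕ) (v w : ℕ → ℕ → ℝ) : ℝ :=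
  gh N ^ 2 * ∑ i ∈ Icc 1 (N-1), ∑ j ∈ Icc 0 N, rho N j * (v i j * w i j)

/-- `(·,·)_{W_h^(2)}` inner product (vertices `0 ≤ i ≤ N`, `1 ≤ j ≤ N-1`, weights `ρ_i`). -/
def innerW2 (N : ℕ) (v w : ℕ → ℕ → ℝ) : ℝ :=
  gh N ^ 2 * ∑ i ∈ Icc 0 N, ∑ j ∈ Icc 1 (N-1), rho N i * (v i j * w i j)

/-- `δ⁻₁` of a `V_h^(1)` function, evaluated at the cell center `(i-1/2, j-1/2)`. -/
def d1V1 (N : ℕ) (v : ℕ → ℕ → ℝ) : ℕ → ℕ → ℝ := fun i j => (v i j - v (i-1) j) / gh N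

/-- `δ⁻₂` of a `V_h^(1)` function, evaluated at the vertex `(i, j)`. -/
def d2V1 (N : ℕ) (v : ℕ → ℕ → ℝ) : ℕ → ℕ → ℝ := fun i j => (v i (j+1) - v i j) / gh N

/-- `δ⁻₁` of a `V_h^(2)` function, evaluated at the vertex `(i, j)`. -/
def d1V2 (N : ℕ) (v : ℕ → ℕ → ℝ) : ℕ → ℕ → ℝ := fun i j => (v (i+1) j - v i j) / gh N

/-- `δ⁻₂` of a `V_h^(2)` function, evaluated at the cell center `(i-1/2, j-1/2)`. -/
def d2V2 (N : ℕ) (v : ℕ → ℕ → ℝ) : ℕ → ℕ → ℝ := fun i j => (v i j - v i (j-1)) / gh N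

/-- `δ⁺₁` of a cell-centered function, evaluated at the node `(i, j-1/2)`. -/
def d1pM (N : ℕ) (q : ℕ → ℕ → ℝ) : ℕ → ℕ → ℝ := fun i j => (q (i+1) j - q i j) / gh N

/-- `δ⁺₂` of a cell-centered function, evaluated at the node `(i-1/2, j)`. -/
def d2pM (N : ℕ) (q : ℕ → ℕ → ℝ) : ℕ → ℕ → ℝ := fun i j => (q i (j+1) - q i j) / gh N

/-- the five-point discrete Laplacian `Δ_h = δ⁺₁δ⁻₁ + δ⁺₂δ⁻₂`. -/
def lap (N : ℕ) (v : ℕ → ℕ → ℝ) : ℕ → ℕ → ℝ := fun i j =>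
  (v (i+1) j - 2 * v i j + v (i-1) j) / gh N ^ 2
    + (v i (j+1) - 2 * v i j + v i (j-1)) / gh N ^ 2

/-- squared discrete `H¹` seminorm
`|v|₁² = ‖δ⁻₁v¹‖²_M + ‖δ⁻₂v¹‖²_{W¹} + ‖δ⁻₁v²‖²_{W²} + ‖δ⁻₂v²‖²_M`. -/
def H1semisq (N : ℕ) (v1 v2 : ℕ → ℕ → ℝ) : ℝ :=
  innerM N (d1V1 N v1) (d1V1 N v1) + innerW1 N (d2V1 N v1) (d2V1 N v1)
    + innerW2 N (d1V2 N v2) (d1V2 N v2) + innerM N (d2V2 N v2) (d2V2 N v2)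

/-- discrete `H¹` seminorm `|v|₁`. -/
def H1semi (N : ℕ) (v1 v2 : ℕ → ℕ → ℝ) : ℝ := Real.sqrt (H1semisq N v1 v2)

/-- `(e¹, e², e_p)` satisfies the discrete MAC Stokes system with residuals `(R¹, R², R)`. -/
def StokesSys (N : ℕ) (e1 e2 ep R1 R2 R : ℕ → ℕ → ℝ) : Prop :=
  (∀ i ∈ Icc 1 (N-1), ∀ j ∈ Icc 1 N, -lap N e1 i j + d1pM N ep i j = R1 i j) ∧
  (∀ i ∈ Icc 1 N, ∀ j ∈ Icc 1 (N-1), -lap N e2 i j + d2pM N ep i j = R2 i j) ∧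
  (∀ i ∈ Icc 1 N, ∀ j ∈ Icc 1 N, d1V1 N e1 i j + d2V2 N e2 i j = R i j)

/-- the bilinear form `b_h(v, q) = −h² Σ_{i,j} q_{i-1/2,j-1/2} (δ⁻₁ v¹ + δ⁻₂ v²)_{i,j}`. -/
def bh (N : ℕ) (v1 v2 q : ℕ → ℕ → ℝ) : ℝ :=
  -(gh N ^ 2 * ∑ i ∈ Icc 1 N, ∑ j ∈ Icc 1 N,
      q i j * (d1V1 N v1 i j + d2V2 N v2 i j))


def dth (n s c : ℕ) : ℝ := max 0 (1 - (s:ℝ)*((c:ℝ)+1)/((n:ℝ)+1))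
def dS (n s : ℕ) (r : ℕ → ℝ) (c : ℕ) : ℝ :=
  dth n s c * ((1/(s:ℝ)) * ∑ t ∈ range s, r (s*c+t))
def dJ (n : ℕ) (r : ℕ → ℝ) (c : ℕ) : ℝ := r (n-c)
def dE (n c : ℕ) : ℝ := 6*((c:ℝ)+1)*((n:ℝ)+1-c)/(((n:ℝ)+2)*((n:ℝ)+3))
def dSS (n s : ℕ) (r : ℕ → ℝ) (c : ℕ) : ℝ := dS n s r c + dS n s (dJ n r) (n-c)
def dm (n s : ℕ) (r : ℕ → ℝ) : ℝ := (1/((n:ℝ)+1)) * ∑ c ∈ range (n+1), dSS n s r c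
def dB (n s : ℕ) (r : ℕ → ℝ) (c : ℕ) : ℝ := r c - dSS n s r c + dE n c * dm n s r
def dD (z : ℕ → ℝ) (k : ℕ) : ℝ := z (k+1) - z k
def dA (n s : ℕ) (z : ℕ → ℝ) (j : ℕ) : ℝ := ∑ k ∈ range j, dB n s (dD z) k
def dmk (M : ℕ) (f : ℕ → ℝ) (k : ℕ) : ℝ := if k < M then f k else 0

lemma dmk_nonneg (M : ℕ) (f : ℕ → ℝ) (hf : ∀ k, 0 ≤ f k) (k : ℕ) : 0 ≤ dmk M f k := by
  unfold dmk; split_ifs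
  · exact hf k
  · exact le_rfl

lemma sum_mk_le (M L : ℕ) (f : ℕ → ℝ) (hf : ∀ k, 0 ≤ f k) :
    ∑ k ∈ range L, dmk M f k ≤ ∑ k ∈ range M, f k := by
  calc ∑ k ∈ range L, dmk M f k ≤ ∑ k ∈ range (L+M), dmk M f k := by
        apply sum_le_sum_of_subset_of_nonneg
        · intro x hx; simp at *; omega
        · intro i _ _; exact dmk_nonneg M f hf i
    _ = ∑ k ∈ range M, dmk M f k := by
        symm
        apply sum_subset
        · intro x hx; simp at *; omega
        · intro x _ hx; simp at hx; simp [dmk, hx]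
    _ = ∑ k ∈ range M, f k := by
        apply sum_congr rfl; intro x hx; simp at hx; simp [dmk, hx]

lemma sum_blocks (f : ℕ → ℝ) (s m : ℕ) :
    ∑ c ∈ range m, ∑ t ∈ range s, f (s*c+t) = ∑ k ∈ range (s*m), f k := by
  induction m with
  | zero => simp
  | succ m ih => rw [sum_range_succ, ih, Nat.mul_succ, sum_range_add]

lemma block_bound (M s m u : ℕ) (f : ℕ → ℝ) (hf : ∀ k, 0 ≤ f k) :
    ∑ c ∈ range m, ∑ t ∈ range s, dmk M f (s*c+t+u) ≤ ∑ k ∈ range M, f k := by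
  rw [sum_blocks (fun k => dmk M f (k+u))]
  calc ∑ k ∈ range (s*m), dmk M f (k+u) ≤ ∑ k ∈ range (u + s*m), dmk M f k := by
        rw [sum_range_add]
        have : 0 ≤ ∑ x ∈ range u, dmk M f x := sum_nonneg (fun i _ => dmk_nonneg M f hf i)
        have h2 : ∑ k ∈ range (s*m), dmk M f (k+u) = ∑ x ∈ range (s*m), dmk M f (u+x) :=
          sum_congr rfl (fun x _ => by rw [add_comm])
        linarith
    _ ≤ _ := sum_mk_le _ _ _ hf

lemma dth_nonneg (n s c : ℕ) : 0 ≤ dth n s c := le_max_left _ _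
lemma dth_le_one (n s c : ℕ) : dth n s c ≤ 1 := by
  unfold dth
  apply max_le zero_le_one
  have : 0 ≤ (s:ℝ)*((c:ℝ)+1)/((n:ℝ)+1) := by positivity
  linarith
lemma dth_zero (n s c : ℕ) (h : n + 1 ≤ s*(c+1)) : dth n s c = 0 := by
  unfold dth
  apply max_eq_left
  have h' : ((n:ℝ)+1) ≤ (s:ℝ)*((c:ℝ)+1) := by exact_mod_cast h
  have : 1 ≤ (s:ℝ)*((c:ℝ)+1)/((n:ℝ)+1) := by
    rw [le_div_iff₀ (by positivity)]; linarith
  linarith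
lemma dth_sub (n s c : ℕ) : 0 ≤ dth n s c - dth n s (c+1) ∧
    dth n s c - dth n s (c+1) ≤ (s:ℝ)/((n:ℝ)+1) := by
  have e : (s:ℝ)*(((c+1:ℕ):ℝ)+1)/((n:ℝ)+1) = (s:ℝ)*((c:ℝ)+1)/((n:ℝ)+1) + (s:ℝ)/((n:ℝ)+1) := by
    push_cast; field_simp
  have h0 : 0 ≤ (s:ℝ)/((n:ℝ)+1) := by positivity
  unfold dth
  rw [e]
  constructor
  · have := max_le_max (le_refl (0:ℝ)) (show 1 - ((s:ℝ)*((c:ℝ)+1)/((n:ℝ)+1) + (s:ℝ)/((n:ℝ)+1)) ≤ 1 - (s:ℝ)*((c:ℝ)+1)/((n:ℝ)+1) by linarith)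
    linarith
  · rw [sub_le_iff_le_add]
    apply max_le
    · have := le_max_left 0 (1 - ((s:ℝ)*((c:ℝ)+1)/((n:ℝ)+1) + (s:ℝ)/((n:ℝ)+1)))
      linarith
    · have := le_max_right 0 (1 - ((s:ℝ)*((c:ℝ)+1)/((n:ℝ)+1) + (s:ℝ)/((n:ℝ)+1)))
      linarith
lemma dth_first (n s : ℕ) : 1 - dth n s 0 ≤ (s:ℝ)/((n:ℝ)+1) := by
  unfold dth
  have := le_max_right 0 (1 - (s:ℝ)*(((0:ℕ):ℝ)+1)/((n:ℝ)+1))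
  have e : (s:ℝ)*(((0:ℕ):ℝ)+1)/((n:ℝ)+1) = (s:ℝ)/((n:ℝ)+1) := by simp
  linarith

lemma avg_sq (s : ℕ) (hs : 1 ≤ s) (f : ℕ → ℝ) :
    ((1/(s:ℝ)) * ∑ t ∈ range s, f t)^2 ≤ (1/(s:ℝ)) * ∑ t ∈ range s, f t ^ 2 := by
  have h := sq_sum_le_card_mul_sum_sq (s := range s) (f := f)
  rw [card_range] at h
  have hs' : (0:ℝ) < s := by exact_mod_cast hs
  rw [mul_pow]
  calc (1/(s:ℝ))^2 * (∑ t ∈ range s, f t)^2 ≤ (1/(s:ℝ))^2 * (s * ∑ t ∈ range s, f t ^ 2) := by gcongr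
    _ = _ := by field_simp

lemma dS_sq (n s : ℕ) (hs : 1 ≤ s) (r : ℕ → ℝ) (c : ℕ) :
    (dS n s r c)^2 ≤ (1/(s:ℝ)) * ∑ t ∈ range s, dmk (n+1) (fun k => r k ^ 2) (s*c+t) := by
  by_cases h : n + 1 ≤ s*(c+1)
  · rw [dS, dth_zero n s c h]
    have : 0 ≤ ∑ t ∈ range s, dmk (n+1) (fun k => r k ^ 2) (s*c+t) :=
      sum_nonneg (fun i _ => dmk_nonneg _ _ (fun k => sq_nonneg _) _)
    have h2 : (0:ℝ) ≤ 1/(s:ℝ) := by positivity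
    simpa using mul_nonneg h2 this
  · have e : ∑ t ∈ range s, dmk (n+1) (fun k => r k ^ 2) (s*c+t) = ∑ t ∈ range s, r (s*c+t)^2 := by
      apply sum_congr rfl; intro t ht; simp at ht
      have : s*c+t < n+1 := by rw [Nat.mul_succ] at h; omega
      simp only [dmk, this, if_true]
    rw [e, dS, mul_pow]
    have h1 := avg_sq s hs (fun t => r (s*c+t))
    have h2 : dth n s c ^ 2 ≤ 1 := by
      have := dth_nonneg n s c; have := dth_le_one n s c; nlinarith
    have h3 := sq_nonneg ((1/(s:ℝ)) * ∑ t ∈ range s, r (s*c+t))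
    nlinarith

lemma dS_norm (n s : ℕ) (hs : 1 ≤ s) (r : ℕ → ℝ) :
    ∑ c ∈ range (n+1), (dS n s r c)^2 ≤ (1/(s:ℝ)) * ∑ k ∈ range (n+1), r k ^ 2 := by
  calc _ ≤ ∑ c ∈ range (n+1), (1/(s:ℝ)) * ∑ t ∈ range s, dmk (n+1) (fun k => r k ^ 2) (s*c+t) :=
        sum_le_sum (fun c _ => dS_sq n s hs r c)
    _ = (1/(s:ℝ)) * ∑ c ∈ range (n+1), ∑ t ∈ range s, dmk (n+1) (fun k => r k ^ 2) (s*c+t+0) := by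
        rw [mul_sum]; rfl
    _ ≤ _ := by
        exact mul_le_mul_of_nonneg_left (block_bound _ _ _ _ _ (fun k => sq_nonneg _)) (by positivity)

lemma flip_sum (n : ℕ) (f : ℕ → ℝ) :
    ∑ c ∈ range (n+1), f (n-c) = ∑ c ∈ range (n+1), f c := sum_flip f

lemma dJ_norm (n : ℕ) (r : ℕ → ℝ) :
    ∑ k ∈ range (n+1), (dJ n r k)^2 = ∑ k ∈ range (n+1), r k ^ 2 :=
  flip_sum n (fun k => r k ^ 2)

lemma dSS_norm (n s : ℕ) (hs : 1 ≤ s) (r : ℕ → ℝ) :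
    ∑ c ∈ range (n+1), (dSS n s r c)^2 ≤ (4/(s:ℝ)) * ∑ k ∈ range (n+1), r k ^ 2 := by
  have h1 := dS_norm n s hs r
  have h2 := dS_norm n s hs (dJ n r)
  rw [dJ_norm, ← flip_sum n (fun c => (dS n s (dJ n r) c)^2)] at h2
  calc _ ≤ ∑ c ∈ range (n+1), (2 * (dS n s r c)^2 + 2 * (dS n s (dJ n r) (n-c))^2) := by
        apply sum_le_sum; intro c _; unfold dSS
        nlinarith [sq_nonneg (dS n s r c - dS n s (dJ n r) (n-c))]
    _ = 2 * ∑ c ∈ range (n+1), (dS n s r c)^2 + 2 * ∑ c ∈ range (n+1), (dS n s (dJ n r) (n-c))^2 := by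
        rw [sum_add_distrib, mul_sum, mul_sum]
    _ ≤ 2 * ((1/(s:ℝ)) * ∑ k ∈ range (n+1), r k ^ 2) + 2 * ((1/(s:ℝ)) * ∑ k ∈ range (n+1), r k ^ 2) := by
        gcongr
    _ = _ := by ring

lemma dm_sq (n s : ℕ) (r : ℕ → ℝ) :
    ((n:ℝ)+1) * (dm n s r)^2 ≤ ∑ c ∈ range (n+1), (dSS n s r c)^2 := by
  have h := avg_sq (n+1) (by omega) (dSS n s r)
  push_cast at h
  unfold dm
  calc _ ≤ ((n:ℝ)+1) * ((1/((n:ℝ)+1)) * ∑ c ∈ range (n+1), (dSS n s r c)^2) := by gcongr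
    _ = _ := by field_simp

lemma dE_bd (n c : ℕ) (hc : c ≤ n) : 0 ≤ dE n c ∧ dE n c ≤ 3/2 := by
  have hc' : (c:ℝ) ≤ n := by exact_mod_cast hc
  have h0 : (0:ℝ) ≤ c := by positivity
  have h1 : (0:ℝ) ≤ n := by positivity
  unfold dE
  constructor
  · apply div_nonneg
    · apply mul_nonneg (by positivity); linarith
    · positivity
  · rw [div_le_iff₀ (by positivity)]
    nlinarith [sq_nonneg ((n:ℝ) - 2*c)]

lemma dE_zero (n : ℕ) : dE n 0 ≤ 6/((n:ℝ)+1) := by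
  unfold dE
  rw [div_le_div_iff₀ (by positivity) (by positivity)]
  have h1 : (0:ℝ) ≤ n := by positivity
  push_cast
  nlinarith

lemma dE_diff (n c : ℕ) (hc : c < n) : |dE n (c+1) - dE n c| ≤ 6/((n:ℝ)+1) := by
  have hc' : (c:ℝ)+1 ≤ n := by exact_mod_cast hc
  have h0 : (0:ℝ) ≤ c := by positivity
  have h1 : (0:ℝ) ≤ n := by positivity
  have : dE n (c+1) - dE n c = 6*((n:ℝ)-2*c-1)/(((n:ℝ)+2)*((n:ℝ)+3)) := by
    unfold dE; push_cast; rw [← sub_div]; congr 1; ring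
  rw [this, abs_div, abs_of_pos (show (0:ℝ) < ((n:ℝ)+2)*((n:ℝ)+3) by positivity), abs_mul]
  have h3 : |(n:ℝ)-2*c-1| ≤ n + 1 := by rw [abs_le]; constructor <;> linarith
  rw [div_le_div_iff₀ (by positivity) (by positivity)]
  rw [abs_of_pos (by norm_num : (0:ℝ)<6)]
  nlinarith

lemma dE_symm (n c : ℕ) (hc : c ≤ n) : dE n (n-c) = dE n c := by
  unfold dE; rw [Nat.cast_sub hc]; congr 1; ring

lemma dE_sum (n : ℕ) : ∑ c ∈ range (n+1), dE n c = (n:ℝ)+1 := by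
  have key : ∀ m : ℕ, ∑ c ∈ range m, 6*((c:ℝ)+1)*((n:ℝ)+1-c) = m*(m+1)*(3*n+5-2*m) := by
    intro m
    induction m with
    | zero => simp
    | succ m ih => rw [sum_range_succ, ih]; push_cast; ring
  unfold dE
  rw [← sum_div, key, div_eq_iff (by positivity)]
  push_cast; ring

/-- P2 -/
lemma dB_near (n s : ℕ) (hs : 1 ≤ s) (r : ℕ → ℝ) :
    ∑ c ∈ range (n+1), (r c - dB n s r c)^2 ≤ (26/(s:ℝ)) * ∑ k ∈ range (n+1), r k ^ 2 := by
  have h1 := dSS_norm n s hs r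
  have h2 := dm_sq n s r
  calc _ ≤ ∑ c ∈ range (n+1), (2 * (dSS n s r c)^2 + (9/2) * (dm n s r)^2) := by
        apply sum_le_sum; intro c hc
        simp at hc
        obtain ⟨a, b⟩ := dE_bd n c (by omega)
        have h3 : dE n c ^ 2 ≤ 9/4 := by nlinarith
        have h4 : (dE n c * dm n s r)^2 ≤ 9/4 * (dm n s r)^2 := by
          rw [mul_pow]; exact mul_le_mul_of_nonneg_right h3 (sq_nonneg _)
        unfold dB
        nlinarith [sq_nonneg (dSS n s r c + dE n c * dm n s r)]
    _ = 2 * ∑ c ∈ range (n+1), (dSS n s r c)^2 + (9/2) * (((n:ℝ)+1) * (dm n s r)^2) := by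
        rw [sum_add_distrib, ← mul_sum, sum_const, card_range, nsmul_eq_mul]; push_cast; ring
    _ ≤ 2 * ((4/(s:ℝ)) * ∑ k ∈ range (n+1), r k ^ 2) + (9/2) * ((4/(s:ℝ)) * ∑ k ∈ range (n+1), r k ^ 2) := by
        linarith
    _ = _ := by ring

lemma dB_sum (n s : ℕ) (r : ℕ → ℝ) :
    ∑ c ∈ range (n+1), dB n s r c = ∑ c ∈ range (n+1), r c := by
  unfold dB
  rw [sum_add_distrib, sum_sub_distrib, ← sum_mul, dE_sum]
  unfold dm
  field_simp
  ring

lemma dS_add (n s : ℕ) (r r' : ℕ → ℝ) (c : ℕ) :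
    dS n s (fun k => r k + r' k) c = dS n s r c + dS n s r' c := by
  unfold dS; rw [sum_add_distrib]; ring
lemma dS_sub (n s : ℕ) (r r' : ℕ → ℝ) (c : ℕ) :
    dS n s (fun k => r k - r' k) c = dS n s r c - dS n s r' c := by
  unfold dS; rw [sum_sub_distrib]; ring
lemma dSS_add (n s : ℕ) (r r' : ℕ → ℝ) (c : ℕ) :
    dSS n s (fun k => r k + r' k) c = dSS n s r c + dSS n s r' c := by
  have := dS_add n s (dJ n r) (dJ n r') (n-c)
  have e : dJ n (fun k => r k + r' k) = fun k => dJ n r k + dJ n r' k := rfl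
  unfold dSS; rw [dS_add, e, this]; ring
lemma dSS_sub (n s : ℕ) (r r' : ℕ → ℝ) (c : ℕ) :
    dSS n s (fun k => r k - r' k) c = dSS n s r c - dSS n s r' c := by
  have := dS_sub n s (dJ n r) (dJ n r') (n-c)
  have e : dJ n (fun k => r k - r' k) = fun k => dJ n r k - dJ n r' k := rfl
  unfold dSS; rw [dS_sub, e, this]; ring
lemma dB_add (n s : ℕ) (r r' : ℕ → ℝ) (c : ℕ) :
    dB n s (fun k => r k + r' k) c = dB n s r c + dB n s r' c := by
  unfold dB dm; simp only [dSS_add, sum_add_distrib]; ring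
lemma dB_sub (n s : ℕ) (r r' : ℕ → ℝ) (c : ℕ) :
    dB n s (fun k => r k - r' k) c = dB n s r c - dB n s r' c := by
  unfold dB dm; simp only [dSS_sub, sum_sub_distrib]; ring
lemma dA_sub (n s : ℕ) (z z' : ℕ → ℝ) (j : ℕ) :
    dA n s (fun k => z k - z' k) j = dA n s z j - dA n s z' j := by
  unfold dA
  rw [← sum_sub_distrib]
  apply sum_congr rfl; intro k _
  rw [← dB_sub]; congr 1; funext x; simp only [dD]; ring

lemma dS_congr (n s : ℕ) (r r' : ℕ → ℝ) (h : ∀ k ≤ n, r k = r' k) (c : ℕ) :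
    dS n s r c = dS n s r' c := by
  unfold dS
  by_cases hc : n + 1 ≤ s*(c+1)
  · rw [dth_zero n s c hc]; simp
  · congr 2; apply sum_congr rfl; intro t ht; simp at ht; apply h
    rw [Nat.mul_succ] at hc; omega
lemma dB_congr (n s : ℕ) (r r' : ℕ → ℝ) (h : ∀ k ≤ n, r k = r' k) (c : ℕ) (hc : c ≤ n) :
    dB n s r c = dB n s r' c := by
  have h1 : ∀ c, dSS n s r c = dSS n s r' c := by
    intro c; unfold dSS
    rw [dS_congr n s r r' h, dS_congr n s (dJ n r) (dJ n r') (fun k _ => h _ (by omega))]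
  unfold dB dm; simp only [h1]; rw [h c hc]

lemma dA_zero (n s : ℕ) (z : ℕ → ℝ) : dA n s z 0 = 0 := by simp [dA]
lemma dA_last (n s : ℕ) (z : ℕ → ℝ) (h0 : z 0 = 0) (h1 : z (n+1) = 0) : dA n s z (n+1) = 0 := by
  unfold dA; rw [dB_sum]; unfold dD; rw [sum_range_sub, h0, h1]; ring
lemma dA_succ (n s : ℕ) (z : ℕ → ℝ) (j : ℕ) :
    dA n s z (j+1) - dA n s z j = dB n s (dD z) j := by
  unfold dA; rw [sum_range_succ]; ring

lemma chain_sq (r : ℕ → ℝ) (k p : ℕ) :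
    (r (k+p) - r k)^2 ≤ p * ∑ u ∈ range p, (dD r (k+u))^2 := by
  have h : ∑ u ∈ range p, dD r (k+u) = r (k+p) - r k := by
    have := sum_range_sub (fun u => r (k+u)) p
    simpa [dD, add_assoc] using this
  rw [← h]
  have := sq_sum_le_card_mul_sum_sq (s := range p) (f := fun u => dD r (k+u))
  rwa [card_range] at this

lemma dS_diff (n s : ℕ) (hs : 1 ≤ s) (r : ℕ → ℝ) (c : ℕ) :
    (dS n s r (c+1) - dS n s r c)^2 ≤
      2 * (((s:ℝ)/((n:ℝ)+1))^2 * ((1/(s:ℝ)) * ∑ t ∈ range s, dmk (n+1) (fun k => r k ^ 2) (s*c+t)))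
      + 2 * ∑ u ∈ range s, ∑ t ∈ range s, dmk n (fun k => (dD r k)^2) (s*c+t+u) := by
  have hs' : (0:ℝ) < s := by exact_mod_cast hs
  have n1 : 0 ≤ ∑ t ∈ range s, dmk (n+1) (fun k => r k ^ 2) (s*c+t) :=
    sum_nonneg (fun i _ => dmk_nonneg _ _ (fun k => sq_nonneg _) _)
  have n2 : 0 ≤ ∑ u ∈ range s, ∑ t ∈ range s, dmk n (fun k => (dD r k)^2) (s*c+t+u) :=
    sum_nonneg (fun i _ => sum_nonneg (fun i _ => dmk_nonneg _ _ (fun k => sq_nonneg _) _))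
  by_cases h : n + 1 ≤ s*(c+1)
  · rw [dS, dS, dth_zero n s c h, dth_zero n s (c+1) (by nlinarith)]
    have : 0 ≤ ((s:ℝ)/((n:ℝ)+1))^2 * ((1/(s:ℝ)) * ∑ t ∈ range s, dmk (n+1) (fun k => r k ^ 2) (s*c+t)) := by
      positivity
    simp only [zero_mul, sub_zero]
    linarith
  · have e : ∑ t ∈ range s, dmk (n+1) (fun k => r k ^ 2) (s*c+t) = ∑ t ∈ range s, r (s*c+t)^2 := by
      apply sum_congr rfl; intro t ht; simp at ht
      have : s*c+t < n+1 := by rw [Nat.mul_succ] at h; omega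
      simp only [dmk, this, if_true]
    rw [e]
    set a := (1/(s:ℝ)) * ∑ t ∈ range s, r (s*c+t) with ha
    set b := (1/(s:ℝ)) * ∑ t ∈ range s, r (s*(c+1)+t) with hb
    have hX : ((dth n s c - dth n s (c+1)) * a)^2 ≤
        ((s:ℝ)/((n:ℝ)+1))^2 * ((1/(s:ℝ)) * ∑ t ∈ range s, r (s*c+t)^2) := by
      rw [mul_pow]
      obtain ⟨h1, h2⟩ := dth_sub n s c
      have h3 := avg_sq s hs (fun t => r (s*c+t))
      gcongr
    have hY : (dth n s (c+1) * (b - a))^2 ≤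
        ∑ u ∈ range s, ∑ t ∈ range s, dmk n (fun k => (dD r k)^2) (s*c+t+u) := by
      by_cases h' : n + 1 ≤ s*(c+1+1)
      · rw [dth_zero n s (c+1) h']; simpa using n2
      · have e2 : b - a = (1/(s:ℝ)) * ∑ t ∈ range s, (r (s*c+t+s) - r (s*c+t)) := by
          rw [sum_sub_distrib, mul_sub, ha, hb]; congr 2
          apply sum_congr rfl; intro t _; congr 1; ring
        have h1 := avg_sq s hs (fun t => (r (s*c+t+s) - r (s*c+t)))
        have h2 : (1/(s:ℝ)) * ∑ t ∈ range s, (r (s*c+t+s) - r (s*c+t))^2 ≤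
            (1/(s:ℝ)) * ∑ t ∈ range s, (s * ∑ u ∈ range s, (dD r (s*c+t+u))^2) := by
          apply mul_le_mul_of_nonneg_left _ (by positivity)
          exact sum_le_sum (fun t _ => chain_sq r (s*c+t) s)
        have h3 : (1/(s:ℝ)) * ∑ t ∈ range s, (s * ∑ u ∈ range s, (dD r (s*c+t+u))^2) =
            ∑ u ∈ range s, ∑ t ∈ range s, dmk n (fun k => (dD r k)^2) (s*c+t+u) := by
          rw [← mul_sum, ← mul_assoc, one_div, inv_mul_cancel₀ hs'.ne', one_mul, sum_comm]
          apply sum_congr rfl; intro u hu; apply sum_congr rfl; intro t ht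
          simp at hu ht
          have : s*c+t+u < n := by
            have : s*(c+1+1) = s*c + s + s := by ring
            omega
          simp only [dmk, this, if_true]
        have h4 : dth n s (c+1) ^ 2 ≤ 1 := by
          have := dth_nonneg n s (c+1); have := dth_le_one n s (c+1); nlinarith
        rw [mul_pow, e2]
        calc _ ≤ 1 * ((1/(s:ℝ)) * ∑ t ∈ range s, (r (s*c+t+s) - r (s*c+t)))^2 := by gcongr
          _ ≤ _ := by linarith
    have : dS n s r (c+1) - dS n s r c = dth n s (c+1) * (b - a) - (dth n s c - dth n s (c+1)) * a := by
      rw [dS, dS]; ring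
    rw [this]
    nlinarith [sq_nonneg (dth n s (c+1) * (b - a) + (dth n s c - dth n s (c+1)) * a)]

lemma dS_diff_norm (n s : ℕ) (hs : 1 ≤ s) (r : ℕ → ℝ) :
    ∑ c ∈ range n, (dS n s r (c+1) - dS n s r c)^2 ≤
      2 * s * ((∑ k ∈ range (n+1), r k ^ 2)/((n:ℝ)+1)^2) + 2 * s * ∑ k ∈ range n, (dD r k)^2 := by
  have hs' : (0:ℝ) < s := by exact_mod_cast hs
  have b1 := block_bound (n+1) s n 0 (fun k => r k ^ 2) (fun k => sq_nonneg _)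
  simp only [add_zero] at b1
  have b2 : ∑ c ∈ range n, ∑ u ∈ range s, ∑ t ∈ range s, dmk n (fun k => (dD r k)^2) (s*c+t+u)
      ≤ s * ∑ k ∈ range n, (dD r k)^2 := by
    rw [sum_comm]
    calc _ ≤ ∑ u ∈ range s, ∑ k ∈ range n, (dD r k)^2 :=
          sum_le_sum (fun u _ => block_bound n s n u _ (fun k => sq_nonneg _))
      _ = _ := by simp
  calc _ ≤ ∑ c ∈ range n, (2 * (((s:ℝ)/((n:ℝ)+1))^2 * ((1/(s:ℝ)) * ∑ t ∈ range s, dmk (n+1) (fun k => r k ^ 2) (s*c+t)))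
      + 2 * ∑ u ∈ range s, ∑ t ∈ range s, dmk n (fun k => (dD r k)^2) (s*c+t+u)) :=
        sum_le_sum (fun c _ => dS_diff n s hs r c)
    _ = 2 * (((s:ℝ)/((n:ℝ)+1))^2 * ((1/(s:ℝ)) * ∑ c ∈ range n, ∑ t ∈ range s, dmk (n+1) (fun k => r k ^ 2) (s*c+t)))
      + 2 * ∑ c ∈ range n, ∑ u ∈ range s, ∑ t ∈ range s, dmk n (fun k => (dD r k)^2) (s*c+t+u) := by
        rw [sum_add_distrib, ← mul_sum, ← mul_sum, ← mul_sum, ← mul_sum]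
    _ ≤ 2 * (((s:ℝ)/((n:ℝ)+1))^2 * ((1/(s:ℝ)) * ∑ k ∈ range (n+1), r k ^ 2)) + 2 * (s * ∑ k ∈ range n, (dD r k)^2) := by
        have : ((s:ℝ)/((n:ℝ)+1))^2 * ((1/(s:ℝ)) * ∑ c ∈ range n, ∑ t ∈ range s, dmk (n+1) (fun k => r k ^ 2) (s*c+t))
          ≤ ((s:ℝ)/((n:ℝ)+1))^2 * ((1/(s:ℝ)) * ∑ k ∈ range (n+1), r k ^ 2) :=
          mul_le_mul_of_nonneg_left (mul_le_mul_of_nonneg_left b1 (by positivity)) (by positivity)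
        linarith
    _ = _ := by field_simp

lemma flip_diff (n : ℕ) (g : ℕ → ℝ) :
    ∑ c ∈ range n, (g (n-(c+1)) - g (n-c))^2 = ∑ c ∈ range n, (g (c+1) - g c)^2 := by
  rw [← sum_range_reflect (fun c => (g (c+1) - g c)^2) n]
  apply sum_congr rfl; intro c hc; simp at hc
  have e1 : n - 1 - c + 1 = n - c := by omega
  have e2 : n - 1 - c = n - (c+1) := by omega
  rw [e1, e2]; ring

lemma dJ_diff (n : ℕ) (r : ℕ → ℝ) :
    ∑ c ∈ range n, (dD (dJ n r) c)^2 = ∑ c ∈ range n, (dD r c)^2 := flip_diff n r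

lemma dB_flip (n s : ℕ) (r : ℕ → ℝ) : dB n s r n = dB n s (dJ n r) 0 := by
  have hSS : ∀ c ≤ n, dSS n s (dJ n r) c = dSS n s r (n-c) := by
    intro c hc
    unfold dSS
    rw [dS_congr n s (dJ n (dJ n r)) r, Nat.sub_sub_self hc, add_comm]
    intro k hk; simp [dJ, Nat.sub_sub_self hk]
  have hm : dm n s (dJ n r) = dm n s r := by
    unfold dm; congr 1; rw [← flip_sum n (dSS n s r)]
    apply sum_congr rfl; intro c hc; simp at hc; exact hSS c (by omega)
  unfold dB
  rw [hm, hSS 0 (by omega), ← dE_symm n 0 (by omega)]; simp [dJ]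

lemma dB_zero_sq (n s : ℕ) (hs : 1 ≤ s) (r : ℕ → ℝ) :
    (dB n s r 0)^2 ≤ 3 * s * ∑ k ∈ range n, (dD r k)^2
      + (3*s^2+432) * ((∑ k ∈ range (n+1), r k ^ 2)/((n:ℝ)+1)^2) := by
  have hs' : (1:ℝ) ≤ s := by exact_mod_cast hs
  have hN : (0:ℝ) < (n:ℝ)+1 := by positivity
  set R := ∑ k ∈ range (n+1), r k ^ 2 with hR
  have hRn : 0 ≤ R := sum_nonneg (fun i _ => sq_nonneg _)
  set Dn := ∑ k ∈ range n, (dD r k)^2 with hDn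
  have hDnn : 0 ≤ Dn := sum_nonneg (fun i _ => sq_nonneg _)
  have z : dS n s (dJ n r) (n-0) = 0 := by
    rw [dS, dth_zero n s (n-0) (by simp; nlinarith)]; simp
  set a := (1/(s:ℝ)) * ∑ t ∈ range s, r (s*0+t) with ha
  have e : dB n s r 0 = (1 - dth n s 0) * r 0 + dth n s 0 * (r 0 - a) + dE n 0 * dm n s r := by
    rw [dB, dSS, z, dS, ← ha]; ring
  have h1 : ((1 - dth n s 0) * r 0)^2 ≤ s^2 * (R/((n:ℝ)+1)^2) := by
    have a1 := dth_first n s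
    have a2 := dth_le_one n s 0
    have a3 : r 0 ^ 2 ≤ R := single_le_sum (f := fun k => r k ^ 2) (fun i _ => sq_nonneg _) (by simp)
    have a4 : (1 - dth n s 0)^2 ≤ ((s:ℝ)/((n:ℝ)+1))^2 := pow_le_pow_left₀ (by linarith) a1 2
    calc _ = (1 - dth n s 0)^2 * r 0 ^ 2 := by ring
      _ ≤ ((s:ℝ)/((n:ℝ)+1))^2 * R := by gcongr
      _ = _ := by field_simp
  have h2 : (dth n s 0 * (r 0 - a))^2 ≤ s * Dn := by
    by_cases h : n + 1 ≤ s*(0+1)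
    · rw [dth_zero n s 0 h]; simp; positivity
    · have e2 : r 0 - a = (1/(s:ℝ)) * ∑ t ∈ range s, (r 0 - r t) := by
        rw [sum_sub_distrib, ha]; simp; field_simp
      have b1 := avg_sq s hs (fun t => r 0 - r t)
      have b2 : (1/(s:ℝ)) * ∑ t ∈ range s, (r 0 - r t)^2 ≤ (1/(s:ℝ)) * ∑ t ∈ range s, (s * Dn) := by
        apply mul_le_mul_of_nonneg_left _ (by positivity)
        apply sum_le_sum; intro t ht; simp at ht
        have := chain_sq r 0 t
        simp only [zero_add] at this
        have c1 : ∑ u ∈ range t, (dD r u)^2 ≤ Dn := by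
          apply sum_le_sum_of_subset_of_nonneg
          · intro x hx; simp at *; omega
          · intro i _ _; exact sq_nonneg _
        have c2 : (t:ℝ) ≤ s := by exact_mod_cast ht.le
        have c3 : (t:ℝ) * ∑ u ∈ range t, (dD r u)^2 ≤ s * Dn := by
          apply mul_le_mul c2 c1 (sum_nonneg (fun i _ => sq_nonneg _)) (by positivity)
        linarith [show (r 0 - r t)^2 = (r t - r 0)^2 by ring]
      have b3 : (1/(s:ℝ)) * ∑ t ∈ range s, (s * Dn) = s * Dn := by
        simp; field_simp
      have h4 : dth n s 0 ^ 2 ≤ 1 := by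
        have := dth_nonneg n s 0; have := dth_le_one n s 0; nlinarith
      rw [mul_pow, e2]
      have h5 := sq_nonneg ((1/(s:ℝ)) * ∑ t ∈ range s, (r 0 - r t))
      nlinarith
  have hm : (dm n s r)^2 ≤ 4 * R := by
    have m1 := dm_sq n s r
    have m2 := dSS_norm n s hs r
    have m3 : (4/(s:ℝ)) ≤ 4 := by rw [div_le_iff₀ (by linarith)]; linarith
    have m4 : (4/(s:ℝ)) * R ≤ 4 * R := by gcongr
    have m5 := sq_nonneg (dm n s r)
    have m6 : (0:ℝ) ≤ n := by positivity
    nlinarith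
  have h3 : (dE n 0 * dm n s r)^2 ≤ 144 * (R/((n:ℝ)+1)^2) := by
    have a1 := dE_zero n
    have a2 := (dE_bd n 0 (by omega)).1
    calc _ = (dE n 0)^2 * (dm n s r)^2 := by ring
      _ ≤ (6/((n:ℝ)+1))^2 * (4 * R) := by gcongr
      _ = _ := by field_simp; ring
  rw [e]
  set x := (1 - dth n s 0) * r 0
  set y := dth n s 0 * (r 0 - a)
  set w := dE n 0 * dm n s r
  nlinarith [sq_nonneg (x-y), sq_nonneg (y-w), sq_nonneg (x-w)]

/-- P3 -/
lemma dB_energy (n s : ℕ) (hs : 1 ≤ s) (r : ℕ → ℝ) :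
    ∑ c ∈ range n, (dB n s r (c+1) - dB n s r c)^2 + 2 * (dB n s r 0)^2 + 2 * (dB n s r n)^2 ≤
      (3000*(s:ℝ)^2) * (∑ k ∈ range n, (r (k+1) - r k)^2
        + (∑ k ∈ range (n+1), r k ^ 2)/((n:ℝ)+1)^2) := by
  have hs' : (1:ℝ) ≤ s := by exact_mod_cast hs
  have hN : (0:ℝ) < (n:ℝ)+1 := by positivity
  have z0 := dB_zero_sq n s hs r
  have zn := dB_zero_sq n s hs (dJ n r)
  rw [← dB_flip, dJ_norm, dJ_diff] at zn
  have d1 := dS_diff_norm n s hs r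
  have d2 := dS_diff_norm n s hs (dJ n r)
  rw [dJ_norm, dJ_diff, ← flip_diff] at d2
  change _ ≤ (3000*(s:ℝ)^2) * (∑ k ∈ range n, (dD r k)^2 + _)
  set R := ∑ k ∈ range (n+1), r k ^ 2 with hR
  have hRn : 0 ≤ R := sum_nonneg (fun i _ => sq_nonneg _)
  set Dn := ∑ k ∈ range n, (dD r k)^2 with hDn
  have hDnn : 0 ≤ Dn := sum_nonneg (fun i _ => sq_nonneg _)
  have hm : ((n:ℝ)+1) * (dm n s r)^2 ≤ 4 * R := by
    have m1 := dm_sq n s r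
    have m2 := dSS_norm n s hs r
    have m3 : (4/(s:ℝ)) ≤ 4 := by rw [div_le_iff₀ (by linarith)]; linarith
    have m4 : (4/(s:ℝ)) * R ≤ 4 * R := by gcongr
    linarith
  have d3 : ∑ c ∈ range n, ((dE n (c+1) - dE n c) * dm n s r)^2 ≤ 144 * (R/((n:ℝ)+1)^2) := by
    calc _ ≤ ∑ c ∈ range n, (6/((n:ℝ)+1))^2 * (dm n s r)^2 := by
          apply sum_le_sum; intro c hc; simp at hc
          rw [mul_pow, ← sq_abs (dE n (c+1) - dE n c)]
          have := dE_diff n c hc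
          gcongr
      _ = n * ((6/((n:ℝ)+1))^2 * (dm n s r)^2) := by simp
      _ ≤ (n+1) * ((6/((n:ℝ)+1))^2 * (dm n s r)^2) := by
          apply mul_le_mul_of_nonneg_right (by linarith) (by positivity)
      _ = (6/((n:ℝ)+1))^2 * ((n+1) * (dm n s r)^2) := by ring
      _ ≤ (6/((n:ℝ)+1))^2 * (4 * R) := by gcongr
      _ = _ := by field_simp; ring
  have main : ∑ c ∈ range n, (dB n s r (c+1) - dB n s r c)^2 ≤
      4 * (Dn + ∑ c ∈ range n, (dS n s r (c+1) - dS n s r c)^2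
      + ∑ c ∈ range n, (dS n s (dJ n r) (n-(c+1)) - dS n s (dJ n r) (n-c))^2
      + ∑ c ∈ range n, ((dE n (c+1) - dE n c) * dm n s r)^2) := by
    rw [hDn, ← sum_add_distrib, ← sum_add_distrib, ← sum_add_distrib, mul_sum]
    apply sum_le_sum; intro c _
    have : dB n s r (c+1) - dB n s r c = dD r c - (dS n s r (c+1) - dS n s r c)
      - (dS n s (dJ n r) (n-(c+1)) - dS n s (dJ n r) (n-c)) + (dE n (c+1) - dE n c) * dm n s r := by
      unfold dB dSS dD; ring
    rw [this]
    generalize dD r c = x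
    generalize dS n s r (c+1) - dS n s r c = y
    generalize dS n s (dJ n r) (n-(c+1)) - dS n s (dJ n r) (n-c) = w
    generalize (dE n (c+1) - dE n c) * dm n s r = v
    nlinarith [sq_nonneg (x+y), sq_nonneg (x+w), sq_nonneg (x-v), sq_nonneg (y-w), sq_nonneg (y+v), sq_nonneg (w+v)]
  set R' := R/((n:ℝ)+1)^2 with hR'
  have hR'n : 0 ≤ R' := by positivity
  have t1 : (s:ℝ) ≤ s^2 := by nlinarith
  have t2 : (1:ℝ) ≤ s^2 := by nlinarith
  have u1 : s * Dn ≤ s^2 * Dn := by gcongr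
  have u2 : 1 * Dn ≤ s^2 * Dn := by gcongr
  have u3 : s * R' ≤ s^2 * R' := by gcongr
  have u4 : 1 * R' ≤ s^2 * R' := by gcongr
  nlinarith

def dU (n s : ℕ) (z : ℕ → ℝ) (j : ℕ) : ℝ := ∑ k ∈ range j, dS n s (dD z) k

lemma dU_eq (n s : ℕ) (z : ℕ → ℝ) (h0 : z 0 = 0) (j : ℕ) :
    dU n s z j = (1/(s:ℝ)) * (dth n s j * z (s*j))
      + (1/(s:ℝ)) * ∑ k ∈ range j, (dth n s k - dth n s (k+1)) * z (s*(k+1)) := by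
  have hS : ∀ k, dS n s (dD z) k = dth n s k * ((1/(s:ℝ)) * (z (s*(k+1)) - z (s*k))) := by
    intro k; unfold dS
    have := sum_range_sub (fun u => z (s*k+u)) s
    rw [Nat.mul_succ]
    congr 2
  unfold dU
  induction j with
  | zero => simp [h0]
  | succ j ih => rw [sum_range_succ, ih, sum_range_succ, hS]; ring

lemma sub_bound (M s m u : ℕ) (hs : 1 ≤ s) (f : ℕ → ℝ) (hf : ∀ k, 0 ≤ f k) :
    ∑ c ∈ range m, dmk M f (s*c+u) ≤ ∑ k ∈ range M, f k := by
  refine le_trans ?_ (block_bound M s m u f hf)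
  apply sum_le_sum; intro c _
  have := single_le_sum (f := fun t => dmk M f (s*c+t+u)) (s := range s)
    (fun i _ => dmk_nonneg M f hf _) (a := 0) (by simp; omega)
  simpa using this

lemma dU_sq (n s : ℕ) (hs : 1 ≤ s) (z : ℕ → ℝ) (h0 : z 0 = 0) (j : ℕ) (hj : j ≤ n+1) :
    (dU n s z j)^2 ≤ 2 * dmk (n+1) (fun k => z k ^ 2) (s*j)
      + 2 * ((∑ k ∈ range (n+1), z k ^ 2)/((n:ℝ)+1)) := by
  have hs' : (1:ℝ) ≤ s := by exact_mod_cast hs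
  have hN : (0:ℝ) < (n:ℝ)+1 := by positivity
  rw [dU_eq n s z h0]
  have hs2 : (1/(s:ℝ)) ≤ 1 := by rw [div_le_one (by linarith)]; exact hs'
  have hs3 : 0 ≤ (1/(s:ℝ)) := by positivity
  have h1 : ((1/(s:ℝ)) * (dth n s j * z (s*j)))^2 ≤ dmk (n+1) (fun k => z k ^ 2) (s*j) := by
    by_cases h : n + 1 ≤ s*(j+1)
    · rw [dth_zero n s j h]; simpa using dmk_nonneg _ _ (fun k => sq_nonneg _) _
    · have : s*j < n+1 := by rw [Nat.mul_succ] at h; omega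
      simp only [dmk, this, if_true]
      have a1 := dth_nonneg n s j
      have a2 := dth_le_one n s j
      have a3 : ((1/(s:ℝ)) * dth n s j)^2 ≤ 1 := by
        apply pow_le_one₀ (by positivity)
        nlinarith
      calc _ = ((1/(s:ℝ)) * dth n s j)^2 * z (s*j)^2 := by ring
        _ ≤ 1 * z (s*j)^2 := by gcongr
        _ = _ := one_mul _
  have h2 : ((1/(s:ℝ)) * ∑ k ∈ range j, (dth n s k - dth n s (k+1)) * z (s*(k+1)))^2 ≤
      (∑ k ∈ range (n+1), z k ^ 2)/((n:ℝ)+1) := by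
    have c1 := sq_sum_le_card_mul_sum_sq (s := range j) (f := fun k => (dth n s k - dth n s (k+1)) * z (s*(k+1)))
    rw [card_range] at c1
    have c2 : ∑ k ∈ range j, ((dth n s k - dth n s (k+1)) * z (s*(k+1)))^2 ≤
        ∑ k ∈ range j, ((s:ℝ)/((n:ℝ)+1))^2 * dmk (n+1) (fun k => z k ^ 2) (s*k+s) := by
      apply sum_le_sum; intro k _
      by_cases h : n + 1 ≤ s*(k+1)
      · rw [dth_zero n s k h, dth_zero n s (k+1) (by nlinarith)]
        have := dmk_nonneg (n+1) (fun k => z k ^ 2) (fun k => sq_nonneg _) (s*k+s)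
        simp only [sub_zero, zero_mul]
        rw [zero_pow two_ne_zero]; positivity
      · have : s*k+s < n+1 := by rw [Nat.mul_succ] at h; omega
        simp only [dmk, this, if_true]
        rw [mul_pow, Nat.mul_succ]
        obtain ⟨d1, d2⟩ := dth_sub n s k
        gcongr
    have c3 := sub_bound (n+1) s j s hs (fun k => z k ^ 2) (fun k => sq_nonneg _)
    rw [← mul_sum] at c2
    have c4 : (j:ℝ) ≤ (n:ℝ)+1 := by exact_mod_cast hj
    have hZ : 0 ≤ ∑ k ∈ range (n+1), z k ^ 2 := sum_nonneg (fun i _ => sq_nonneg _)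
    rw [mul_pow]
    calc _ ≤ (1/(s:ℝ))^2 * (((n:ℝ)+1) * (((s:ℝ)/((n:ℝ)+1))^2 * ∑ k ∈ range (n+1), z k ^ 2)) := by
          apply mul_le_mul_of_nonneg_left _ (by positivity)
          refine c1.trans ?_
          apply mul_le_mul c4 _ (sum_nonneg (fun i _ => sq_nonneg _)) hN.le
          exact c2.trans (mul_le_mul_of_nonneg_left c3 (by positivity))
      _ = _ := by field_simp
  set x := (1/(s:ℝ)) * (dth n s j * z (s*j))
  set y := (1/(s:ℝ)) * ∑ k ∈ range j, (dth n s k - dth n s (k+1)) * z (s*(k+1))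
  nlinarith [sq_nonneg (x-y)]

lemma dU_norm (n s : ℕ) (hs : 1 ≤ s) (z : ℕ → ℝ) (h0 : z 0 = 0) :
    ∑ j ∈ range (n+2), (dU n s z j)^2 ≤ 6 * ∑ k ∈ range (n+1), z k ^ 2 := by
  have hN : (0:ℝ) < (n:ℝ)+1 := by positivity
  have b := sub_bound (n+1) s (n+2) 0 hs (fun k => z k ^ 2) (fun k => sq_nonneg _)
  simp only [add_zero] at b
  set Z := ∑ k ∈ range (n+1), z k ^ 2 with hZd
  have hZ : 0 ≤ Z := sum_nonneg (fun i _ => sq_nonneg _)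
  calc _ ≤ ∑ j ∈ range (n+2), (2 * dmk (n+1) (fun k => z k ^ 2) (s*j) + 2 * (Z/((n:ℝ)+1))) := by
        apply sum_le_sum; intro j hj; simp at hj
        exact dU_sq n s hs z h0 j (by omega)
    _ = 2 * ∑ j ∈ range (n+2), dmk (n+1) (fun k => z k ^ 2) (s*j) + ((n:ℝ)+2) * (2 * (Z/((n:ℝ)+1))) := by
        rw [sum_add_distrib, ← mul_sum]; simp
    _ ≤ 2 * Z + 4 * Z := by
        have : ((n:ℝ)+2) * (2 * (Z/((n:ℝ)+1))) ≤ 4 * Z := by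
          rw [← mul_div_assoc, ← mul_div_assoc, div_le_iff₀ hN]
          have : (0:ℝ) ≤ n := by positivity
          nlinarith [mul_nonneg this hZ]
        linarith
    _ = _ := by ring

lemma dU_last (n s : ℕ) (hs : 1 ≤ s) (z : ℕ → ℝ) (h0 : z 0 = 0) :
    (dU n s z (n+1))^2 ≤ 2 * ((∑ k ∈ range (n+1), z k ^ 2)/((n:ℝ)+1)) := by
  have := dU_sq n s hs z h0 (n+1) le_rfl
  have e : dmk (n+1) (fun k => z k ^ 2) (s*(n+1)) = 0 := by
    have : ¬ (s*(n+1) < n+1) := by nlinarith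
    simp only [dmk, this, if_false]
  rw [e] at this; linarith

lemma flip_part (n s : ℕ) (z : ℕ → ℝ) (j : ℕ) (hj : j ≤ n+1) :
    ∑ k ∈ range j, dS n s (dJ n (dD z)) (n-k) =
      dU n s (fun i => z (n+1-i)) (n+1-j) - dU n s (fun i => z (n+1-i)) (n+1) := by
  have h1 : ∀ k, dS n s (dJ n (dD z)) k = - dS n s (dD (fun i => z (n+1-i))) k := by
    intro k
    have := dS_sub n s (fun _ => 0) (dD (fun i => z (n+1-i))) k
    have e0 : dS n s (fun _ => 0) k = 0 := by simp [dS]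
    rw [e0, zero_sub] at this
    rw [← this]
    apply dS_congr; intro i hi
    simp only [dJ, dD]
    have e1 : n - i + 1 = n + 1 - i := by omega
    have e2 : n + 1 - (i+1) = n - i := by omega
    rw [e1, e2]; ring
  induction j with
  | zero => simp
  | succ j ih =>
    rw [sum_range_succ, ih (by omega), h1]
    have e : n + 1 - j = (n - j) + 1 := by omega
    have e' : n + 1 - (j+1) = n - j := by omega
    rw [e, e']
    have : dU n s (fun i => z (n+1-i)) (n-j+1) = dU n s (fun i => z (n+1-i)) (n-j)
      + dS n s (dD (fun i => z (n+1-i))) (n-j) := by unfold dU; rw [sum_range_succ]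
    rw [this]; ring

/-- P4 -/
lemma dA_norm (n s : ℕ) (hs : 1 ≤ s) (z : ℕ → ℝ) (h0 : z 0 = 0) (h1 : z (n+1) = 0) :
    ∑ j ∈ range (n+1), (dA n s z j)^2 ≤ 200 * ∑ j ∈ range (n+1), z j ^ 2 := by
  have hN : (0:ℝ) < (n:ℝ)+1 := by positivity
  set y : ℕ → ℝ := fun i => z (n+1-i) with hy
  have y0 : y 0 = 0 := by simp [hy, h1]
  have hZy : ∑ k ∈ range (n+1), y k ^ 2 = ∑ k ∈ range (n+1), z k ^ 2 := by
    have e1 : ∑ k ∈ range (n+1), y k ^ 2 = ∑ k ∈ range (n+1), z (k+1)^2 := by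
      rw [← flip_sum n (fun k => z (k+1)^2)]
      apply sum_congr rfl; intro k hk; simp at hk
      simp only [hy]; congr 2; omega
    have e2 := sum_range_succ (fun k => z k ^ 2) (n+1)
    have e3 := sum_range_succ' (fun k => z k ^ 2) (n+1)
    rw [e1]
    simp only [h0, h1] at e2 e3
    linarith
  have Un := dU_norm n s hs z h0
  have Uy := dU_norm n s hs y y0
  have Ul := dU_last n s hs z h0
  have Uyl := dU_last n s hs y y0
  rw [hZy] at Uy Uyl
  set Z := ∑ k ∈ range (n+1), z k ^ 2 with hZd
  have hZ : 0 ≤ Z := sum_nonneg (fun i _ => sq_nonneg _)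
  have hm : dm n s (dD z) = (1/((n:ℝ)+1)) * (dU n s z (n+1) - dU n s y (n+1)) := by
    unfold dm dSS
    rw [sum_add_distrib, flip_part n s z (n+1) le_rfl]
    have : dU n s y (n+1-(n+1)) = 0 := by simp [dU]
    rw [this]; unfold dU; ring
  have hA : ∀ j ≤ n+1, dA n s z j = z j - dU n s z j - (dU n s y (n+1-j) - dU n s y (n+1))
      + (∑ k ∈ range j, dE n k) * dm n s (dD z) := by
    intro j hj
    unfold dA dB dSS
    rw [sum_add_distrib, sum_sub_distrib, sum_add_distrib, flip_part n s z j hj, ← sum_mul]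
    have : ∑ k ∈ range j, dD z k = z j := by unfold dD; rw [sum_range_sub, h0, sub_zero]
    rw [this]; unfold dU; ring
  have hE : ∀ j ≤ n+1, ((∑ k ∈ range j, dE n k) * dm n s (dD z))^2 ≤ 8 * (Z/((n:ℝ)+1)) := by
    intro j hj
    have a1 : ∑ k ∈ range j, dE n k ≤ (n:ℝ)+1 := by
      rw [← dE_sum n]
      apply sum_le_sum_of_subset_of_nonneg
      · intro x hx; simp at *; omega
      · intro i hi _; simp at hi; exact (dE_bd n i (by omega)).1
    have a2 : 0 ≤ ∑ k ∈ range j, dE n k :=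
      sum_nonneg (fun i hi => by simp at hi; exact (dE_bd n i (by omega)).1)
    rw [mul_pow, hm, mul_pow]
    calc _ ≤ ((n:ℝ)+1)^2 * ((1/((n:ℝ)+1))^2 * (dU n s z (n+1) - dU n s y (n+1))^2) := by gcongr
      _ = (dU n s z (n+1) - dU n s y (n+1))^2 := by field_simp
      _ ≤ 2 * (dU n s z (n+1))^2 + 2 * (dU n s y (n+1))^2 := by
          nlinarith [sq_nonneg (dU n s z (n+1) + dU n s y (n+1))]
      _ ≤ 8 * (Z/((n:ℝ)+1)) := by linarith
  have p1 : ∑ j ∈ range (n+1), (dU n s z j)^2 ≤ 6 * Z := by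
    refine le_trans ?_ Un
    rw [sum_range_succ _ (n+1)]; linarith [sq_nonneg (dU n s z (n+1))]
  have p2 : ∑ j ∈ range (n+1), (dU n s y (n+1-j))^2 ≤ 6 * Z := by
    refine le_trans ?_ Uy
    rw [sum_range_succ' _ (n+1), ← flip_sum n (fun k => dU n s y (k+1)^2)]
    have : ∑ j ∈ range (n+1), (dU n s y (n+1-j))^2 = ∑ j ∈ range (n+1), (dU n s y (n-j+1))^2 := by
      apply sum_congr rfl; intro k hk; simp at hk
      congr 2; omega
    rw [this]; linarith [sq_nonneg (dU n s y 0)]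
  calc _ ≤ ∑ j ∈ range (n+1), 5 * (z j ^ 2 + (dU n s z j)^2 + (dU n s y (n+1-j))^2 + 2 * (Z/((n:ℝ)+1)) + 8 * (Z/((n:ℝ)+1))) := by
        apply sum_le_sum; intro j hj; simp at hj
        have e := hE j (by omega)
        rw [hA j (by omega)]
        set a := z j
        set b := dU n s z j
        set c := dU n s y (n+1-j)
        set d := dU n s y (n+1)
        set f := (∑ k ∈ range j, dE n k) * dm n s (dD z)
        nlinarith [sq_nonneg (a+b), sq_nonneg (a+c), sq_nonneg (a-d), sq_nonneg (a-f), sq_nonneg (b-c), sq_nonneg (b+d), sq_nonneg (b+f), sq_nonneg (c+d), sq_nonneg (c+f), sq_nonneg (d-f)]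
    _ = 5 * (Z + ∑ j ∈ range (n+1), (dU n s z j)^2 + ∑ j ∈ range (n+1), (dU n s y (n+1-j))^2 + 10 * Z) := by
        rw [← mul_sum, sum_add_distrib, sum_add_distrib, sum_add_distrib, sum_add_distrib, sum_const, sum_const, card_range, nsmul_eq_mul, nsmul_eq_mul]
        push_cast; field_simp; ring
    _ ≤ _ := by linarith

lemma sbp (n : ℕ) (w g : ℕ → ℝ) (h0 : w 0 = 0) (h1 : w (n+1) = 0) :
    ∑ a ∈ range (n+1), (w (a+1) - w a) * g a = - ∑ a ∈ range n, w (a+1) * (g (a+1) - g a) := by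
  have key : ∀ m, ∑ a ∈ range (m+1), (w (a+1) - w a) * g a
      = w (m+1) * g m - w 0 * g 0 - ∑ a ∈ range m, w (a+1) * (g (a+1) - g a) := by
    intro m
    induction m with
    | zero => simp; ring
    | succ m ih => rw [sum_range_succ, ih, sum_range_succ]; ring
  rw [key, h0, h1]; ring

def gx (n : ℕ) (f : ℕ → ℕ → ℝ) (i b : ℕ) : ℝ :=
  if 1 ≤ i ∧ i ≤ n then f i b - f (i-1) b else 0
def gy (n : ℕ) (f : ℕ → ℕ → ℝ) (a j : ℕ) : ℝ :=
  if 1 ≤ j ∧ j ≤ n then f a j - f a (j-1) else 0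
def gl (n : ℕ) (f : ℕ → ℕ → ℝ) (a b : ℕ) : ℝ :=
  gx n f (a+1) b - gx n f a b + (gy n f a (b+1) - gy n f a b)

lemma gx_zero (n : ℕ) (f : ℕ → ℕ → ℝ) (b : ℕ) : gx n f 0 b = 0 := by simp [gx]
lemma gx_last (n : ℕ) (f : ℕ → ℕ → ℝ) (b : ℕ) : gx n f (n+1) b = 0 := by simp [gx]
lemma gy_zero (n : ℕ) (f : ℕ → ℕ → ℝ) (b : ℕ) : gy n f b 0 = 0 := by simp [gy]
lemma gy_last (n : ℕ) (f : ℕ → ℕ → ℝ) (b : ℕ) : gy n f b (n+1) = 0 := by simp [gy]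
lemma gx_succ (n : ℕ) (f : ℕ → ℕ → ℝ) (a b : ℕ) (h : a < n) :
    gx n f (a+1) b = f (a+1) b - f a b := by
  simp [gx]; intro h'; omega
lemma gy_succ (n : ℕ) (f : ℕ → ℕ → ℝ) (a b : ℕ) (h : b < n) :
    gy n f a (b+1) = f a (b+1) - f a b := by
  simp [gy]; intro h'; omega

lemma gl_energy (n : ℕ) (f g : ℕ → ℕ → ℝ) :
    ∑ a ∈ range (n+1), ∑ b ∈ range (n+1), gl n f a b * g a b
     = - (∑ b ∈ range (n+1), ∑ a ∈ range n, (f (a+1) b - f a b) * (g (a+1) b - g a b))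
       - (∑ a ∈ range (n+1), ∑ b ∈ range n, (f a (b+1) - f a b) * (g a (b+1) - g a b)) := by
  have h1 : ∀ b, ∑ a ∈ range (n+1), (gx n f (a+1) b - gx n f a b) * g a b
      = - ∑ a ∈ range n, (f (a+1) b - f a b) * (g (a+1) b - g a b) := by
    intro b
    rw [sbp n (fun a => gx n f a b) (fun a => g a b) (gx_zero n f b) (gx_last n f b)]
    congr 1; apply sum_congr rfl; intro a ha
    rw [gx_succ n f a b (mem_range.mp ha)]
  have h2 : ∀ a, ∑ b ∈ range (n+1), (gy n f a (b+1) - gy n f a b) * g a b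
      = - ∑ b ∈ range n, (f a (b+1) - f a b) * (g a (b+1) - g a b) := by
    intro b
    rw [sbp n (fun a => gy n f b a) (fun a => g b a) (gy_zero n f b) (gy_last n f b)]
    congr 1; apply sum_congr rfl; intro a ha
    rw [gy_succ n f b a (mem_range.mp ha)]
  unfold gl
  simp only [add_mul, sum_add_distrib]
  rw [sum_comm]
  simp only [h1, h2, sum_neg_distrib]; ring

def gext (n : ℕ) (φ : Fin (n+1) → Fin (n+1) → ℝ) (a b : ℕ) : ℝ :=
  if h : a < n+1 ∧ b < n+1 then φ ⟨a, h.1⟩ ⟨b, h.2⟩ else 0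

lemma gext_add (n : ℕ) (φ ψ : Fin (n+1) → Fin (n+1) → ℝ) (a b : ℕ) :
    gext n (φ + ψ) a b = gext n φ a b + gext n ψ a b := by
  unfold gext; split_ifs <;> simp
lemma gext_smul (n : ℕ) (c : ℝ) (φ : Fin (n+1) → Fin (n+1) → ℝ) (a b : ℕ) :
    gext n (c • φ) a b = c * gext n φ a b := by
  unfold gext; split_ifs <;> simp

def gsum (n : ℕ) (f : ℕ → ℕ → ℝ) : ℝ := ∑ a ∈ range (n+1), ∑ b ∈ range (n+1), f a b

def gL (n : ℕ) : (Fin (n+1) → Fin (n+1) → ℝ) →ₗ[ℝ] (Fin (n+1) → Fin (n+1) → ℝ) where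
  toFun φ := fun a b => gl n (gext n φ) a b - gsum n (gext n φ)
  map_add' φ ψ := by
    funext a b
    simp only [Pi.add_apply, gsum, gext_add, sum_add_distrib, gl, gx, gy]
    split_ifs <;> ring
  map_smul' c φ := by
    funext a b
    simp only [Pi.smul_apply, gsum, gext_smul, gl, gx, gy, RingHom.id_apply, smul_eq_mul, ← mul_sum]
    split_ifs <;> ring

lemma gL_inj (n : ℕ) (φ : Fin (n+1) → Fin (n+1) → ℝ) (h : gL n φ = 0) : φ = 0 := by
  set f := gext n φ with hf
  have h1 : ∀ a ∈ range (n+1), ∀ b ∈ range (n+1), gl n f a b = gsum n f := by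
    intro a ha b hb
    have := congrFun (congrFun h ⟨a, mem_range.mp ha⟩) ⟨b, mem_range.mp hb⟩
    simp only [gL, LinearMap.coe_mk, AddHom.coe_mk, Pi.zero_apply] at this
    linarith
  have h2 := gl_energy n f f
  have h3 : ∑ a ∈ range (n+1), ∑ b ∈ range (n+1), gl n f a b * f a b = gsum n f * gsum n f := by
    conv_rhs => rw [gsum]
    rw [sum_mul]
    simp only [sum_mul]
    apply sum_congr rfl; intro a ha
    apply sum_congr rfl; intro b hb
    rw [h1 a ha b hb, gsum]; ring
  rw [h3] at h2
  have p1 : ∀ b ∈ range (n+1), 0 ≤ ∑ a ∈ range n, (f (a+1) b - f a b) * (f (a+1) b - f a b) :=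
    fun b _ => sum_nonneg (fun a _ => mul_self_nonneg _)
  have p2 : ∀ a ∈ range (n+1), 0 ≤ ∑ b ∈ range n, (f a (b+1) - f a b) * (f a (b+1) - f a b) :=
    fun b _ => sum_nonneg (fun a _ => mul_self_nonneg _)
  have q1 := sum_nonneg p1
  have q2 := sum_nonneg p2
  have q3 := mul_self_nonneg (gsum n f)
  have e1 := (sum_eq_zero_iff_of_nonneg p1).mp (by linarith)
  have e2 := (sum_eq_zero_iff_of_nonneg p2).mp (by linarith)
  have e3 : gsum n f = 0 := mul_self_eq_zero.mp (by linarith)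
  have d1 : ∀ b ∈ range (n+1), ∀ a ∈ range n, f (a+1) b = f a b := by
    intro b hb a ha
    have := (sum_eq_zero_iff_of_nonneg (fun a _ => mul_self_nonneg _)).mp (e1 b hb) a ha
    have := mul_self_eq_zero.mp this
    linarith
  have d2 : ∀ a ∈ range (n+1), ∀ b ∈ range n, f a (b+1) = f a b := by
    intro b hb a ha
    have := (sum_eq_zero_iff_of_nonneg (fun a _ => mul_self_nonneg _)).mp (e2 b hb) a ha
    have := mul_self_eq_zero.mp this
    linarith
  have c1 : ∀ b ∈ range (n+1), ∀ a, a < n+1 → f a b = f 0 b := by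
    intro b hb a
    induction a with
    | zero => intro _; rfl
    | succ a ih => intro ha; rw [d1 b hb a (mem_range.mpr (by omega))]; exact ih (by omega)
  have c2 : ∀ b, b < n+1 → f 0 b = f 0 0 := by
    intro b
    induction b with
    | zero => intro _; rfl
    | succ b ih => intro hb; rw [d2 0 (by simp) b (mem_range.mpr (by omega))]; exact ih (by omega)
  have c3 : ∀ a ∈ range (n+1), ∀ b ∈ range (n+1), f a b = f 0 0 := fun a ha b hb => by
    rw [c1 b hb a (mem_range.mp ha), c2 b (mem_range.mp hb)]
  have c4 : gsum n f = ((n:ℝ)+1)*((n:ℝ)+1) * f 0 0 := by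
    unfold gsum
    rw [sum_congr rfl (fun a ha => sum_congr rfl (fun b hb => c3 a ha b hb))]
    simp; ring
  have c5 : f 0 0 = 0 := by
    rw [e3] at c4
    have hN : (0:ℝ) < (n:ℝ)+1 := by positivity
    rcases mul_eq_zero.mp c4.symm with h | h
    · nlinarith
    · exact h
  funext a b
  have := c3 a (mem_range.mpr a.2) b (mem_range.mpr b.2)
  rw [c5, hf] at this
  simp [gext] at this
  exact this (by omega) (by omega)

lemma potential (n : ℕ) (q : ℕ → ℕ → ℝ) (hq : gsum n q = 0) :
    ∃ f : ℕ → ℕ → ℝ, ∀ a ≤ n, ∀ b ≤ n, gl n f a b = q a b := by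
  have inj : Function.Injective (gL n) := by
    rw [← LinearMap.ker_eq_bot, LinearMap.ker_eq_bot']
    exact gL_inj n
  obtain ⟨φ, hφ⟩ := LinearMap.injective_iff_surjective.mp inj (fun a b => q a b)
  have h1 : ∀ a ∈ range (n+1), ∀ b ∈ range (n+1),
      q a b = gl n (gext n φ) a b * 1 - gsum n (gext n φ) := by
    intro a ha b hb
    have := congrFun (congrFun hφ ⟨a, mem_range.mp ha⟩) ⟨b, mem_range.mp hb⟩
    simp only [gL, LinearMap.coe_mk, AddHom.coe_mk] at this
    linarith
  have h2 := gl_energy n (gext n φ) (fun _ _ => 1)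
  simp only [sub_self, mul_zero, sum_const_zero, neg_zero] at h2
  have h3 : gsum n (gext n φ) = 0 := by
    have : gsum n q = - (((n:ℝ)+1)*((n:ℝ)+1) * gsum n (gext n φ)) := by
      rw [gsum, sum_congr rfl (fun a ha => sum_congr rfl (fun b hb => h1 a ha b hb))]
      simp only [sum_sub_distrib, h2]
      simp; ring
    have hN : (0:ℝ) < (n:ℝ)+1 := by positivity
    rw [hq] at this
    rcases mul_eq_zero.mp (neg_eq_zero.mp this.symm) with h | h
    · nlinarith
    · exact h
  refine ⟨gext n φ, fun a ha b hb => ?_⟩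
  rw [h1 a (by simp; omega) b (by simp; omega), h3]; ring

lemma curl_id (n : ℕ) (w1 w2 : ℕ → ℕ → ℝ) (h0 : ∀ b, w1 0 b = 0) (h1 : ∀ b, w1 (n+1) b = 0)
    (h2 : ∀ a, w2 a 0 = 0) (h3 : ∀ a, w2 a (n+1) = 0)
    (hc : ∀ a < n, ∀ b < n, w1 (a+1) (b+1) - w1 (a+1) b = w2 (a+1) (b+1) - w2 a (b+1)) :
    ∑ a ∈ range (n+1), ∑ b ∈ range (n+1), (w1 (a+1) b - w1 a b) * (w2 a (b+1) - w2 a b)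
      = ∑ a ∈ range n, ∑ b ∈ range n, (w1 (a+1) (b+1) - w1 (a+1) b)^2 := by
  rw [sum_comm]
  have e1 : ∀ b, ∑ a ∈ range (n+1), (w1 (a+1) b - w1 a b) * (w2 a (b+1) - w2 a b)
    = - ∑ a ∈ range n, w1 (a+1) b * ((w2 (a+1) (b+1) - w2 (a+1) b) - (w2 a (b+1) - w2 a b)) :=
    fun b => sbp n (fun a => w1 a b) (fun a => w2 a (b+1) - w2 a b) (h0 b) (h1 b)
  simp only [e1, sum_neg_distrib]
  rw [sum_comm, ← sum_neg_distrib]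
  apply sum_congr rfl; intro a ha
  have e2 := sbp n (fun b => w2 (a+1) b - w2 a b) (fun b => w1 (a+1) b) (by simp [h2]) (by simp [h3])
  have e3 : ∑ b ∈ range (n+1), w1 (a+1) b * ((w2 (a+1) (b+1) - w2 (a+1) b) - (w2 a (b+1) - w2 a b))
    = - ∑ b ∈ range n, (w2 (a+1) (b+1) - w2 a (b+1)) * (w1 (a+1) (b+1) - w1 (a+1) b) := by
    rw [← e2]; apply sum_congr rfl; intro b _; ring
  rw [e3, neg_neg]
  apply sum_congr rfl; intro b hb
  rw [← hc a (mem_range.mp ha) b (mem_range.mp hb)]; ring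

lemma slip (n : ℕ) (q : ℕ → ℕ → ℝ) (hq : gsum n q = 0) :
    ∃ w1 w2 : ℕ → ℕ → ℝ, (∀ b, w1 0 b = 0) ∧ (∀ b, w1 (n+1) b = 0) ∧
    (∀ a, w2 a 0 = 0) ∧ (∀ a, w2 a (n+1) = 0) ∧
    (∀ a ≤ n, ∀ b ≤ n, w1 (a+1) b - w1 a b + (w2 a (b+1) - w2 a b) = q a b) ∧
    ∑ a ∈ range (n+1), ∑ b ∈ range (n+1), (w1 (a+1) b - w1 a b)^2 ≤ gsum n (fun a b => q a b ^ 2) ∧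
    ∑ a ∈ range (n+1), ∑ b ∈ range (n+1), (w2 a (b+1) - w2 a b)^2 ≤ gsum n (fun a b => q a b ^ 2) ∧
    ∑ a ∈ range (n+1), ∑ b ∈ range n, (w1 a (b+1) - w1 a b)^2 ≤ gsum n (fun a b => q a b ^ 2) ∧
    ∑ b ∈ range (n+1), ∑ a ∈ range n, (w2 (a+1) b - w2 a b)^2 ≤ gsum n (fun a b => q a b ^ 2) := by
  obtain ⟨f, hf⟩ := potential n q hq
  have hc : ∀ a < n, ∀ b < n, gx n f (a+1) (b+1) - gx n f (a+1) b
      = gy n f (a+1) (b+1) - gy n f a (b+1) := by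
    intro a ha b hb
    rw [gx_succ n f a _ ha, gx_succ n f a _ ha, gy_succ n f _ b hb, gy_succ n f _ b hb]; ring
  have key := curl_id n (gx n f) (gy n f) (gx_zero n f) (gx_last n f) (gy_zero n f) (gy_last n f) hc
  have hQ : gsum n (fun a b => q a b ^ 2) =
      ∑ a ∈ range (n+1), ∑ b ∈ range (n+1), (gx n f (a+1) b - gx n f a b)^2
      + ∑ a ∈ range (n+1), ∑ b ∈ range (n+1), (gy n f a (b+1) - gy n f a b)^2
      + 2 * ∑ a ∈ range n, ∑ b ∈ range n, (gx n f (a+1) (b+1) - gx n f (a+1) b)^2 := by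
    rw [← key, gsum, mul_sum, ← sum_add_distrib, ← sum_add_distrib]
    apply sum_congr rfl; intro a ha
    rw [mul_sum, ← sum_add_distrib, ← sum_add_distrib]
    apply sum_congr rfl; intro b hb
    simp only [mem_range] at ha hb
    rw [← hf a (by omega) b (by omega), gl]; ring
  have n1 : 0 ≤ ∑ a ∈ range (n+1), ∑ b ∈ range (n+1), (gx n f (a+1) b - gx n f a b)^2 :=
    sum_nonneg (fun a _ => sum_nonneg (fun b _ => sq_nonneg _))
  have n2 : 0 ≤ ∑ a ∈ range (n+1), ∑ b ∈ range (n+1), (gy n f a (b+1) - gy n f a b)^2 :=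
    sum_nonneg (fun a _ => sum_nonneg (fun b _ => sq_nonneg _))
  have n3 : 0 ≤ ∑ a ∈ range n, ∑ b ∈ range n, (gx n f (a+1) (b+1) - gx n f (a+1) b)^2 :=
    sum_nonneg (fun a _ => sum_nonneg (fun b _ => sq_nonneg _))
  have e1 : ∑ a ∈ range (n+1), ∑ b ∈ range n, (gx n f a (b+1) - gx n f a b)^2
      = ∑ a ∈ range n, ∑ b ∈ range n, (gx n f (a+1) (b+1) - gx n f (a+1) b)^2 := by
    rw [sum_range_succ']; simp [gx_zero]
  have e2 : ∑ b ∈ range (n+1), ∑ a ∈ range n, (gy n f (a+1) b - gy n f a b)^2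
      = ∑ a ∈ range n, ∑ b ∈ range n, (gx n f (a+1) (b+1) - gx n f (a+1) b)^2 := by
    rw [sum_range_succ']; simp only [gy_zero]
    simp only [sub_self, ne_eq, OfNat.ofNat_ne_zero, not_false_eq_true, zero_pow, sum_const_zero, add_zero]
    rw [sum_comm]
    apply sum_congr rfl; intro a ha
    apply sum_congr rfl; intro b hb
    rw [hc a (mem_range.mp ha) b (mem_range.mp hb)]
  refine ⟨gx n f, gy n f, gx_zero n f, gx_last n f, gy_zero n f, gy_last n f, hf, ?_, ?_, ?_, ?_⟩
  · linarith
  · linarith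
  · rw [e1]; linarith
  · rw [e2]; linarith

lemma poinc (n : ℕ) (z : ℕ → ℝ) (h0 : z 0 = 0) :
    (∑ i ∈ range (n+1), z i ^ 2) / ((n:ℝ)+1)^2 ≤ ∑ k ∈ range (n+1), (z (k+1) - z k)^2 := by
  have hN : (0:ℝ) < (n:ℝ)+1 := by positivity
  set S := ∑ k ∈ range (n+1), (z (k+1) - z k)^2 with hS
  have hS0 : 0 ≤ S := sum_nonneg (fun _ _ => sq_nonneg _)
  have h1 : ∀ i ∈ range (n+1), z i ^ 2 ≤ ((n:ℝ)+1) * S := by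
    intro i hi
    have hi' := mem_range.mp hi
    have c := chain_sq z 0 i
    simp only [zero_add, h0, sub_zero] at c
    have c2 : ∑ u ∈ range i, (dD z u)^2 ≤ S := by
      apply sum_le_sum_of_subset_of_nonneg
      · intro x hx; simp at hx ⊢; omega
      · intro _ _ _; exact sq_nonneg _
    have c3 : (i:ℝ) ≤ (n:ℝ)+1 := by exact_mod_cast hi'.le
    calc z i ^ 2 ≤ _ := c
      _ ≤ ((n:ℝ)+1) * S := mul_le_mul c3 c2 (sum_nonneg (fun _ _ => sq_nonneg _)) hN.le
  have h2 := sum_le_sum h1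
  rw [sum_const, card_range, nsmul_eq_mul] at h2
  push_cast at h2
  rw [div_le_iff₀ (by positivity)]
  nlinarith

lemma dB_bd (n s : ℕ) (hs : 1 ≤ s) (r : ℕ → ℝ) :
    ∑ c ∈ range (n+1), (dB n s r c)^2 ≤ 54 * ∑ k ∈ range (n+1), r k ^ 2 := by
  have h := dB_near n s hs r
  have hs' : (1:ℝ) ≤ s := by exact_mod_cast hs
  have h0 : 0 ≤ ∑ k ∈ range (n+1), r k ^ 2 := sum_nonneg (fun _ _ => sq_nonneg _)
  have h1 : 26/(s:ℝ) ≤ 26 := div_le_self (by norm_num) hs'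
  have h2 : ∑ c ∈ range (n+1), (dB n s r c)^2 ≤
      ∑ c ∈ range (n+1), (2 * (r c - dB n s r c)^2 + 2 * r c ^ 2) := by
    apply sum_le_sum; intro c _; nlinarith [sq_nonneg (2 * r c - dB n s r c)]
  rw [sum_add_distrib, ← mul_sum, ← mul_sum] at h2
  have h3 := mul_le_mul_of_nonneg_right h1 h0
  linarith

lemma dBB_bd (n s : ℕ) (hs : 1 ≤ s) (g : ℕ → ℕ → ℝ) :
    ∑ a ∈ range (n+1), ∑ b ∈ range (n+1), (dB n s (fun a' => dB n s (g a') b) a)^2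
      ≤ 2916 * ∑ a ∈ range (n+1), ∑ b ∈ range (n+1), g a b ^ 2 := by
  rw [sum_comm]
  calc _ ≤ ∑ b ∈ range (n+1), 54 * ∑ a ∈ range (n+1), (dB n s (g a) b)^2 :=
        sum_le_sum (fun b _ => dB_bd n s hs (fun a' => dB n s (g a') b))
    _ = 54 * ∑ a ∈ range (n+1), ∑ b ∈ range (n+1), (dB n s (g a) b)^2 := by
        rw [← mul_sum, sum_comm]
    _ ≤ 54 * ∑ a ∈ range (n+1), 54 * ∑ b ∈ range (n+1), g a b ^ 2 := by
        apply mul_le_mul_of_nonneg_left _ (by norm_num)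
        exact sum_le_sum (fun a _ => dB_bd n s hs (g a))
    _ = _ := by rw [← mul_sum]; ring

lemma coerc (n : ℕ) (q : ℕ → ℕ → ℝ) :
    (3/8) * gsum n (fun a b => q a b ^ 2) ≤
      gsum n (fun a b => q a b * dB n 1040 (fun a' => dB n 1040 (q a') b) a) := by
  have hs : 1 ≤ 1040 := by norm_num
  unfold gsum
  set Q := ∑ a ∈ range (n+1), ∑ b ∈ range (n+1), q a b ^ 2 with hQ
  have hQ0 : 0 ≤ Q := sum_nonneg (fun _ _ => sum_nonneg (fun _ _ => sq_nonneg _))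
  set p : ℕ → ℕ → ℝ := fun a b => dB n 1040 (q a) b with hp
  have h1 : ∑ a ∈ range (n+1), ∑ b ∈ range (n+1), (q a b - p a b)^2 ≤ (1/40) * Q := by
    rw [hQ, mul_sum]
    apply sum_le_sum; intro a _
    have := dB_near n 1040 hs (q a)
    norm_num at this ⊢; linarith
  have h2 : ∑ a ∈ range (n+1), ∑ b ∈ range (n+1), (p a b)^2 ≤ 
     2 * ∑ a ∈ range (n+1), ∑ b ∈ range (n+1), (q a b - p a b)^2 + 2 * Q := by
    rw [hQ, mul_sum, mul_sum, ← sum_add_distrib]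
    apply sum_le_sum; intro a _
    rw [mul_sum, mul_sum, ← sum_add_distrib]
    apply sum_le_sum; intro b _
    nlinarith [sq_nonneg (2 * q a b - p a b)]
  have h3 : ∑ a ∈ range (n+1), ∑ b ∈ range (n+1), (p a b - dB n 1040 (fun a' => p a' b) a)^2
      ≤ (1/40) * ∑ a ∈ range (n+1), ∑ b ∈ range (n+1), (p a b)^2 := by
    rw [sum_comm, sum_comm (f := fun a b => (p a b)^2), mul_sum]
    apply sum_le_sum; intro b _
    have := dB_near n 1040 hs (fun a => p a b)
    norm_num at this ⊢; linarith
  have h4 : (1/2) * Q - ∑ a ∈ range (n+1), ∑ b ∈ range (n+1), (q a b - p a b)^2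
      - ∑ a ∈ range (n+1), ∑ b ∈ range (n+1), (p a b - dB n 1040 (fun a' => p a' b) a)^2
      ≤ ∑ a ∈ range (n+1), ∑ b ∈ range (n+1), q a b * dB n 1040 (fun a' => p a' b) a := by
    rw [hQ, mul_sum, ← sum_sub_distrib, ← sum_sub_distrib]
    apply sum_le_sum; intro a _
    rw [mul_sum, ← sum_sub_distrib, ← sum_sub_distrib]
    apply sum_le_sum; intro b _
    set R := dB n 1040 (fun a' => p a' b) a
    nlinarith [sq_nonneg (q a b - p a b - (p a b - R)), sq_nonneg R]
  linarith

def cE1 (n : ℕ) (v1 : ℕ → ℕ → ℝ) : ℝ :=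
  ∑ i ∈ range (n+1), (∑ b ∈ range n, (v1 i (b+1) - v1 i b)^2 + 2 * v1 i 0 ^ 2 + 2 * v1 i n ^ 2)

lemma en1 (n s : ℕ) (hs : 1 ≤ s) (w1 : ℕ → ℕ → ℝ) (Q : ℝ)
    (h0 : ∀ b, w1 0 b = 0) (h1 : ∀ b, w1 (n+1) b = 0)
    (X1 : ∑ a ∈ range (n+1), ∑ b ∈ range (n+1), (w1 (a+1) b - w1 a b)^2 ≤ Q)
    (X2 : ∑ a ∈ range (n+1), ∑ b ∈ range n, (w1 a (b+1) - w1 a b)^2 ≤ Q) :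
    cE1 n (fun i b => dA n s (fun i' => dB n s (w1 i') b) i) ≤ 200*(3000*(s:ℝ)^2)*2*Q := by
  have z0 : ∀ b, b ≤ n → dB n s (w1 0) b = 0 := by
    intro b hb
    have := dB_sub n s (w1 0) (w1 0) b
    rw [sub_self] at this
    rw [← this]; apply dB_congr _ _ _ _ _ _ hb; intro k _; simp [h0]
  have z1 : ∀ b, b ≤ n → dB n s (w1 (n+1)) b = 0 := by
    intro b hb
    have := dB_sub n s (w1 0) (w1 0) b
    rw [sub_self] at this
    rw [← this]; apply dB_congr _ _ _ _ _ _ hb; intro k _; simp [h1]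
  set y : ℕ → ℕ → ℝ := fun i b => dB n s (w1 i) b with hy
  have P : ∑ i ∈ range (n+1), (∑ b ∈ range (n+1), w1 i b ^ 2)/((n:ℝ)+1)^2 ≤ Q := by
    rw [← sum_div, sum_comm, sum_div]
    refine le_trans (sum_le_sum (fun b _ => poinc n (fun i => w1 i b) (h0 b))) ?_
    rw [sum_comm]; exact X1
  have s1 : ∑ i ∈ range (n+1), ∑ b ∈ range n, (dA n s (fun i' => y i' (b+1)) i - dA n s (fun i' => y i' b) i)^2
      ≤ 200 * ∑ i ∈ range (n+1), ∑ b ∈ range n, (y i (b+1) - y i b)^2 := by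
    rw [sum_comm, sum_comm (s := range (n+1)) (f := fun i b => (y i (b+1) - y i b)^2), mul_sum]
    apply sum_le_sum; intro b hb
    have hb' := mem_range.mp hb
    have := dA_norm n s hs (fun i => y i (b+1) - y i b)
      (by simp only [hy]; rw [z0 _ (by omega), z0 _ (by omega), sub_zero])
      (by simp only [hy]; rw [z1 _ (by omega), z1 _ (by omega), sub_zero])
    simp only [dA_sub] at this
    exact this
  have s2 : ∀ b ≤ n, ∑ i ∈ range (n+1), (dA n s (fun i' => y i' b) i)^2
      ≤ 200 * ∑ i ∈ range (n+1), (y i b)^2 := fun b hb =>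
    dA_norm n s hs (fun i' => y i' b) (z0 b hb) (z1 b hb)
  have s3 : cE1 n y ≤ (3000*(s:ℝ)^2)*(2*Q) := by
    unfold cE1
    refine le_trans (sum_le_sum (fun i _ => dB_energy n s hs (w1 i))) ?_
    rw [← mul_sum, sum_add_distrib]
    apply mul_le_mul_of_nonneg_left _ (by positivity)
    linarith
  unfold cE1 at s3 ⊢
  simp only [sum_add_distrib, ← mul_sum] at s3 ⊢
  have s4 := s2 0 (by omega)
  have s5 := s2 n le_rfl
  linarith

lemma en2 (n s : ℕ) (hs : 1 ≤ s) (w2 : ℕ → ℕ → ℝ) (Q : ℝ)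
    (h0 : ∀ a, w2 a 0 = 0) (h1 : ∀ a, w2 a (n+1) = 0)
    (X1 : ∑ a ∈ range (n+1), ∑ b ∈ range (n+1), (w2 a (b+1) - w2 a b)^2 ≤ Q)
    (X2 : ∑ b ∈ range (n+1), ∑ a ∈ range n, (w2 (a+1) b - w2 a b)^2 ≤ Q) :
    cE1 n (fun j a => dB n s (fun a' => dA n s (w2 a') j) a) ≤ 200*(3000*(s:ℝ)^2)*2*Q := by
  have P : ∑ a ∈ range (n+1), (∑ j ∈ range (n+1), w2 a j ^ 2)/((n:ℝ)+1)^2 ≤ Q :=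
    le_trans (sum_le_sum (fun a _ => poinc n (w2 a) (h0 a))) X1
  unfold cE1
  refine le_trans (sum_le_sum (fun j _ => dB_energy n s hs (fun a' => dA n s (w2 a') j))) ?_
  rw [← mul_sum, sum_add_distrib]
  have s1 : ∑ j ∈ range (n+1), ∑ a ∈ range n, (dA n s (w2 (a+1)) j - dA n s (w2 a) j)^2
      ≤ 200 * Q := by
    rw [sum_comm]
    have : ∀ a ∈ range n, ∑ j ∈ range (n+1), (dA n s (w2 (a+1)) j - dA n s (w2 a) j)^2
        ≤ 200 * ∑ j ∈ range (n+1), (w2 (a+1) j - w2 a j)^2 := by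
      intro a _
      have := dA_norm n s hs (fun j => w2 (a+1) j - w2 a j) (by simp [h0]) (by simp [h1])
      simp only [dA_sub] at this
      exact this
    refine le_trans (sum_le_sum this) ?_
    rw [← mul_sum, sum_comm]; linarith
  have s2 : ∑ j ∈ range (n+1), (∑ a ∈ range (n+1), (dA n s (w2 a) j)^2)/((n:ℝ)+1)^2 ≤ 200 * Q := by
    rw [← sum_div, sum_comm]
    have : ∀ a ∈ range (n+1), ∑ j ∈ range (n+1), (dA n s (w2 a) j)^2
        ≤ 200 * ∑ j ∈ range (n+1), (w2 a j)^2 := fun a _ =>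
      dA_norm n s hs (w2 a) (h0 a) (h1 a)
    refine le_trans (div_le_div_of_nonneg_right (sum_le_sum this) (by positivity)) ?_
    rw [← mul_sum, mul_div_assoc, sum_div]; linarith
  calc _ ≤ (3000*(s:ℝ)^2) * (200*Q + 200*Q) :=
        mul_le_mul_of_nonneg_left (add_le_add s1 s2) (by positivity)
    _ = _ := by ring

def cE (n : ℕ) (v1 v2 : ℕ → ℕ → ℝ) : ℝ :=
  gsum n (fun a b => (v1 (a+1) b - v1 a b)^2) + cE1 n v1 + cE1 n (fun j a => v2 a j)
   + gsum n (fun a b => (v2 a (b+1) - v2 a b)^2)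

lemma core_lbb : ∃ C : ℝ, 0 < C ∧ ∀ (n : ℕ) (q : ℕ → ℕ → ℝ), gsum n q = 0 →
    ∃ v1 v2 : ℕ → ℕ → ℝ, (∀ b ≤ n, v1 0 b = 0) ∧ (∀ b ≤ n, v1 (n+1) b = 0) ∧
    (∀ a ≤ n, v2 a 0 = 0) ∧ (∀ a ≤ n, v2 a (n+1) = 0) ∧
    (3/8) * gsum n (fun a b => q a b ^ 2) ≤
      gsum n (fun a b => q a b * (v1 (a+1) b - v1 a b + (v2 a (b+1) - v2 a b))) ∧
    cE n v1 v2 ≤ C * gsum n (fun a b => q a b ^ 2) := by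
  refine ⟨2916*2 + 2*(200*(3000*(1040:ℝ)^2)*2), by norm_num, fun n q hq => ?_⟩
  obtain ⟨w1, w2, a0, a1, b0, b1, hd, X11, X22, X12, X21⟩ := slip n q hq
  set Q := gsum n (fun a b => q a b ^ 2) with hQ
  set s : ℕ := 1040 with hs'
  have hs : 1 ≤ s := by norm_num [hs']
  have D1 : ∀ a b, dA n s (fun i' => dB n s (w1 i') b) (a+1) - dA n s (fun i' => dB n s (w1 i') b) a
      = dB n s (fun i' => dB n s (fun k => w1 (i'+1) k - w1 i' k) b) a := by
    intro a b
    rw [dA_succ]; congr 1; funext i'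
    rw [dB_sub]; rfl
  have D2 : ∀ a b, dB n s (fun a' => dA n s (w2 a') (b+1)) a - dB n s (fun a' => dA n s (w2 a') b) a
      = dB n s (fun a' => dB n s (fun k => w2 a' (k+1) - w2 a' k) b) a := by
    intro a b
    rw [← dB_sub]; congr 1; funext a'
    rw [dA_succ]; rfl
  have zz : ∀ b, dB n s (fun _ => 0) b = 0 := by
    intro b
    have := dB_sub n s (fun _ => 0) (fun _ => 0) b
    simpa using this
  refine ⟨fun i b => dA n s (fun i' => dB n s (w1 i') b) i,
    fun a j => dB n s (fun a' => dA n s (w2 a') j) a, ?_, ?_, ?_, ?_, ?_, ?_⟩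
  · intro b _; exact dA_zero _ _ _
  · intro b hb
    apply dA_last
    · rw [← zz b]; exact dB_congr _ _ _ _ (fun k _ => a0 k) _ hb
    · rw [← zz b]; exact dB_congr _ _ _ _ (fun k _ => a1 k) _ hb
  · intro a ha
    simp only [dA_zero]; exact zz a
  · intro a ha
    simp only [dA_last n s _ (b0 _) (b1 _)]; exact zz a
  · refine le_of_le_of_eq (coerc n q) ?_
    unfold gsum
    apply sum_congr rfl; intro a ha
    apply sum_congr rfl; intro b hb
    have ha' := mem_range.mp ha
    have hb' := mem_range.mp hb
    simp only [D1, D2]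
    rw [← dB_add]
    congr 1
    apply dB_congr _ _ _ _ _ _ (by omega)
    intro k hk
    rw [← dB_add]
    apply dB_congr _ _ _ _ _ _ (by omega)
    intro k' hk'
    exact (hd k hk k' hk').symm
  · have e1 := en1 n s hs w1 Q a0 a1 X11 X12
    have e2 := en2 n s hs w2 Q b0 b1 X22 X21
    have e3 := dBB_bd n s hs (fun a b => w1 (a+1) b - w1 a b)
    have e4 := dBB_bd n s hs (fun a b => w2 a (b+1) - w2 a b)
    unfold cE
    simp only [D1, D2]
    unfold gsum
    have hsr : (s:ℝ) = 1040 := by norm_num [hs']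
    rw [hsr] at e1 e2
    linarith

lemma sum_Icc_shift (m : ℕ) (f : ℕ → ℝ) : ∑ i ∈ Icc 1 m, f i = ∑ a ∈ range m, f (a+1) := by
  induction m with
  | zero => simp
  | succ m ih => rw [sum_Icc_succ_top (by omega), ih, sum_range_succ]

lemma cE1_nonneg (n : ℕ) (v : ℕ → ℕ → ℝ) : 0 ≤ cE1 n v := by
  unfold cE1; apply sum_nonneg; intro i _
  have : 0 ≤ ∑ b ∈ range n, (v i (b+1) - v i b)^2 := sum_nonneg (fun _ _ => sq_nonneg _)
  positivity
lemma gsum_nonneg (n : ℕ) (f : ℕ → ℕ → ℝ) (h : ∀ a b, 0 ≤ f a b) : 0 ≤ gsum n f :=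
  sum_nonneg (fun a _ => sum_nonneg (fun b _ => h a b))
lemma gsum_congr (n : ℕ) (f g : ℕ → ℕ → ℝ) (h : ∀ a ≤ n, ∀ b ≤ n, f a b = g a b) :
    gsum n f = gsum n g := by
  unfold gsum
  apply sum_congr rfl; intro a ha
  apply sum_congr rfl; intro b hb
  exact h a (by simp at ha; omega) b (by simp at hb; omega)
lemma gsum_le (n : ℕ) (f g : ℕ → ℕ → ℝ) (h : ∀ a ≤ n, ∀ b ≤ n, f a b ≤ g a b) :
    gsum n f ≤ gsum n g := by
  unfold gsum
  apply sum_le_sum; intro a ha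
  apply sum_le_sum; intro b hb
  exact h a (by simp at ha; omega) b (by simp at hb; omega)
lemma gsum_term (n : ℕ) (f : ℕ → ℕ → ℝ) (h : ∀ a b, 0 ≤ f a b) (a b : ℕ) (ha : a ≤ n) (hb : b ≤ n) :
    f a b ≤ gsum n f := by
  unfold gsum
  calc f a b ≤ ∑ b ∈ range (n+1), f a b :=
        single_le_sum (f := fun b => f a b) (fun b _ => h a b) (mem_range.mpr (by omega))
    _ ≤ _ := single_le_sum (f := fun a => ∑ b ∈ range (n+1), f a b)
        (fun a _ => sum_nonneg (fun b _ => h a b)) (mem_range.mpr (by omega))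

lemma cE1_congr (n : ℕ) (v w : ℕ → ℕ → ℝ) (h : ∀ i ≤ n, ∀ b ≤ n, v i b = w i b) :
    cE1 n v = cE1 n w := by
  unfold cE1
  apply sum_congr rfl; intro i hi
  have hi' : i ≤ n := by simp at hi; omega
  rw [h i hi' 0 (by omega), h i hi' n le_rfl]
  congr 2
  apply sum_congr rfl; intro b hb
  have hb' := mem_range.mp hb
  rw [h i hi' _ (by omega), h i hi' _ (by omega)]

lemma core_lbb2 : ∃ β : ℝ, 0 < β ∧ ∀ (n : ℕ), 1 ≤ n → ∀ (q : ℕ → ℕ → ℝ), gsum n q = 0 →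
    ∃ v1 v2 : ℕ → ℕ → ℝ, (∀ b ≤ n, v1 0 b = 0) ∧ (∀ b ≤ n, v1 (n+1) b = 0) ∧
    (∀ a ≤ n, v2 a 0 = 0) ∧ (∀ a ≤ n, v2 a (n+1) = 0) ∧ 0 < cE n v1 v2 ∧
    β * Real.sqrt (gsum n (fun a b => q a b ^ 2)) * Real.sqrt (cE n v1 v2) ≤
      - gsum n (fun a b => q a b * (v1 (a+1) b - v1 a b + (v2 a (b+1) - v2 a b))) := by
  obtain ⟨C, hC, H⟩ := core_lbb
  have hsC : 0 < Real.sqrt C := Real.sqrt_pos.mpr hC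
  refine ⟨(3/8)/Real.sqrt C, by positivity, fun n hn q hq => ?_⟩
  set Q := gsum n (fun a b => q a b ^ 2) with hQ
  have hQ0 : 0 ≤ Q := gsum_nonneg n _ (fun _ _ => sq_nonneg _)
  rcases hQ0.eq_or_lt with h0 | hpos
  · have hq0 : ∀ a ≤ n, ∀ b ≤ n, q a b = 0 := by
      intro a ha b hb
      have := gsum_term n (fun a b => q a b ^ 2) (fun _ _ => sq_nonneg _) a b ha hb
      simp only [← hQ, ← h0] at this
      nlinarith
    refine ⟨fun i _ => if i = 1 then 1 else 0, fun _ _ => 0, by simp, ?_, by simp, by simp, ?_, ?_⟩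
    · intro b _; exact if_neg (by omega)
    · unfold cE
      have t1 := gsum_term n (fun a b => ((if a+1 = 1 then (1:ℝ) else 0) - (if a = 1 then 1 else 0))^2)
        (fun _ _ => sq_nonneg _) 0 0 (by omega) (by omega)
      have t2 := cE1_nonneg n (fun i _ => if i = 1 then 1 else 0)
      have t3 := cE1_nonneg n (fun _ _ => 0)
      have t4 := gsum_nonneg n (fun _ _ => ((0:ℝ)-0)^2) (fun _ _ => sq_nonneg _)
      norm_num at t1 t4 ⊢
      linarith
    · rw [← h0, Real.sqrt_zero, mul_zero, zero_mul]
      rw [gsum_congr n _ (fun _ _ => 0)]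
      · simp [gsum]
      · intro a ha b hb; rw [hq0 a ha b hb, zero_mul]
  · obtain ⟨v1, v2, a0, a1, b0, b1, hG, hE⟩ := H n q hq
    have hneg : cE n (fun a b => - v1 a b) (fun a b => - v2 a b) = cE n v1 v2 := by
      have e : ∀ x y : ℝ, (-x - -y)^2 = (x-y)^2 := fun x y => by ring
      unfold cE cE1
      simp only [e, neg_sq]
    have hlow : Q ≤ 16 * cE n v1 v2 := by
      have e1 := gsum_le n (fun a b => q a b * (v1 (a+1) b - v1 a b + (v2 a (b+1) - v2 a b)))
        (fun a b => (1/8) * q a b ^ 2 + 4 * (v1 (a+1) b - v1 a b)^2 + 4 * (v2 a (b+1) - v2 a b)^2)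
        (fun a _ b _ => by
          nlinarith [sq_nonneg (q a b - 4 * (v1 (a+1) b - v1 a b + (v2 a (b+1) - v2 a b))),
            sq_nonneg ((v1 (a+1) b - v1 a b) - (v2 a (b+1) - v2 a b))])
      have e2 : gsum n (fun a b => (1/8) * q a b ^ 2 + 4 * (v1 (a+1) b - v1 a b)^2 + 4 * (v2 a (b+1) - v2 a b)^2)
        = (1/8) * Q + 4 * gsum n (fun a b => (v1 (a+1) b - v1 a b)^2)
          + 4 * gsum n (fun a b => (v2 a (b+1) - v2 a b)^2) := by
        rw [hQ]; unfold gsum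
        simp only [sum_add_distrib, ← mul_sum]
      have t2 := cE1_nonneg n v1
      have t3 := cE1_nonneg n (fun j a => v2 a j)
      unfold cE
      linarith
    refine ⟨fun a b => - v1 a b, fun a b => - v2 a b, ?_, ?_, ?_, ?_, ?_, ?_⟩
    · intro b hb; simp [a0 b hb]
    · intro b hb; simp [a1 b hb]
    · intro b hb; simp [b0 b hb]
    · intro b hb; simp [b1 b hb]
    · rw [hneg]; linarith
    · rw [hneg]
      have g1 : - gsum n (fun a b => q a b * (-v1 (a+1) b - -v1 a b + (-v2 a (b+1) - -v2 a b)))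
        = gsum n (fun a b => q a b * (v1 (a+1) b - v1 a b + (v2 a (b+1) - v2 a b))) := by
        unfold gsum
        rw [← sum_neg_distrib]; apply sum_congr rfl; intro a _
        rw [← sum_neg_distrib]; apply sum_congr rfl; intro b _
        ring
      rw [g1]
      refine le_trans ?_ hG
      calc (3/8)/Real.sqrt C * Real.sqrt Q * Real.sqrt (cE n v1 v2)
          ≤ (3/8)/Real.sqrt C * Real.sqrt Q * Real.sqrt (C * Q) :=
            mul_le_mul_of_nonneg_left (Real.sqrt_le_sqrt hE) (by positivity)
        _ = (3/8) * (Real.sqrt Q * Real.sqrt Q) := by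
            rw [Real.sqrt_mul hC.le]; field_simp
        _ = (3/8) * Q := by rw [Real.mul_self_sqrt hQ0]

lemma ghost (n : ℕ) (u : ℕ → ℝ) (h0 : u 0 = - u 1) (h1 : u (n+2) = - u (n+1)) :
    ∑ j ∈ Icc 0 (n+1), rho (n+1) j * ((u (j+1) - u j) * (u (j+1) - u j))
      = ∑ b ∈ range n, (u (b+2) - u (b+1))^2 + 2 * u 1 ^ 2 + 2 * u (n+1) ^ 2 := by
  have e : Icc 0 (n+1) = range (n+2) := by ext x; simp; omega
  rw [e, sum_range_succ, sum_range_succ', h1]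
  have r0 : rho (n+1) 0 = 1/2 := by simp [rho]
  have r1 : rho (n+1) (n+1) = 1/2 := by simp [rho]
  rw [r0, r1, h0]
  have : ∑ k ∈ range n, rho (n+1) (k+1) * ((u (k+1+1) - u (k+1)) * (u (k+1+1) - u (k+1)))
      = ∑ b ∈ range n, (u (b+2) - u (b+1))^2 := by
    apply sum_congr rfl; intro k hk
    have hk' := mem_range.mp hk
    have : rho (n+1) (k+1) = 1 := by
      unfold rho; rw [if_neg (by omega)]
    rw [this]; ring
  rw [this]; ring

lemma gh_pos (n : ℕ) : 0 < gh (n+1) := by unfold gh; positivity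

lemma H1_eq (n : ℕ) (V1 V2 : ℕ → ℕ → ℝ) (m1 : inV1 (n+1) V1) (m2 : inV2 (n+1) V2) :
    H1semisq (n+1) V1 V2 = cE n (fun i b => V1 i (b+1)) (fun a j => V2 (a+1) j) := by
  obtain ⟨p0, p1, p2, p3⟩ := m1
  obtain ⟨r0, r1, r2, r3⟩ := m2
  have hh := (gh_pos n).ne'
  set h := gh (n+1) with hhd
  have sq : ∀ x : ℝ, x / h * (x / h) = (x*x) / h^2 := fun x => by field_simp
  have A1 : innerM (n+1) (d1V1 (n+1) V1) (d1V1 (n+1) V1)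
      = gsum n (fun a b => (V1 (a+1) (b+1) - V1 a (b+1))^2) := by
    unfold innerM d1V1 gsum
    simp only [sum_Icc_shift, ← hhd, sq, ← sum_div, Nat.add_sub_cancel]
    rw [mul_div_cancel₀ _ (pow_ne_zero 2 hh)]
    simp only [pow_two]
  have A4 : innerM (n+1) (d2V2 (n+1) V2) (d2V2 (n+1) V2)
      = gsum n (fun a b => (V2 (a+1) (b+1) - V2 (a+1) b)^2) := by
    unfold innerM d2V2 gsum
    simp only [sum_Icc_shift, ← hhd, sq, ← sum_div, Nat.add_sub_cancel]
    rw [mul_div_cancel₀ _ (pow_ne_zero 2 hh)]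
    simp only [pow_two]
  have A2 : innerW1 (n+1) (d2V1 (n+1) V1) (d2V1 (n+1) V1) = cE1 n (fun i b => V1 i (b+1)) := by
    unfold innerW1 d2V1 cE1
    simp only [← hhd, sq, Nat.add_sub_cancel, mul_div_assoc', ← sum_div]
    rw [mul_div_cancel_left₀ _ (pow_ne_zero 2 hh)]
    simp only [ghost n (V1 _) (p2 _) (p3 _), sum_Icc_shift]
    rw [sum_range_succ' _ n]
    simp [p0, add_assoc]
  have A3 : innerW2 (n+1) (d1V2 (n+1) V2) (d1V2 (n+1) V2) = cE1 n (fun j a => V2 (a+1) j) := by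
    unfold innerW2 d1V2 cE1
    simp only [← hhd, sq, Nat.add_sub_cancel, mul_div_assoc', ← sum_div]
    rw [mul_div_cancel_left₀ _ (pow_ne_zero 2 hh), sum_comm]
    have := fun j => ghost n (fun a => V2 a j) (r2 j) (r3 j)
    simp only [this, sum_Icc_shift]
    rw [sum_range_succ' _ n]
    simp [r0, add_assoc]
  unfold H1semisq cE
  rw [A1, A2, A3, A4]

def gwrap (n : ℕ) (v : ℕ → ℕ → ℝ) (i j : ℕ) : ℝ :=
  if i = 0 ∨ i = n+1 then 0 else if j = 0 then - v i 0 else if j = n+2 then - v i n else v i (j-1)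

lemma gwrap_V1 (n : ℕ) (v : ℕ → ℕ → ℝ) : inV1 (n+1) (gwrap n v) := by
  refine ⟨fun j => by simp [gwrap], fun j => by simp [gwrap], fun i => ?_, fun i => ?_⟩
  · unfold gwrap; split_ifs <;> simp_all
  · unfold gwrap; split_ifs <;> simp_all

lemma gwrap_V2 (n : ℕ) (v : ℕ → ℕ → ℝ) : inV2 (n+1) (fun i j => gwrap n v j i) := by
  obtain ⟨a, b, c, d⟩ := gwrap_V1 n v
  exact ⟨a, b, c, d⟩

lemma gwrap_eq (n : ℕ) (v : ℕ → ℕ → ℝ) (h0 : ∀ b ≤ n, v 0 b = 0) (h1 : ∀ b ≤ n, v (n+1) b = 0)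
    (i b : ℕ) (hb : b ≤ n) : gwrap n v i (b+1) = v i b := by
  unfold gwrap
  by_cases h : i = 0 ∨ i = n+1
  · rw [if_pos h]; rcases h with rfl | rfl
    · rw [h0 b hb]
    · rw [h1 b hb]
  · rw [if_neg h, if_neg (by omega), if_neg (by omega), Nat.add_sub_cancel]

lemma discrete_aux :
    ∃ β : ℝ, 0 < β ∧ ∀ N : ℕ, 2 ≤ N → ∀ q : ℕ → ℕ → ℝ, inM N q →
      ∃ v1 v2 : ℕ → ℕ → ℝ, inV1 N v1 ∧ inV2 N v2 ∧ 0 < H1semi N v1 v2 ∧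
        bh N v1 v2 q ≥ β * Real.sqrt (innerM N q q) * H1semi N v1 v2 := by
  obtain ⟨β, hβ, H⟩ := core_lbb2
  refine ⟨β, hβ, fun N hN q hq => ?_⟩
  obtain ⟨n, rfl⟩ : ∃ n, N = n+1 := ⟨N-1, by omega⟩
  have hq' : gsum n (fun a b => q (a+1) (b+1)) = 0 := by
    unfold inM at hq
    simpa only [sum_Icc_shift, gsum] using hq
  obtain ⟨v1, v2, a0, a1, b0, b1, hpos, hmain⟩ := H n (by omega) _ hq'
  have m1 := gwrap_V1 n v1
  have m2 := gwrap_V2 n (fun j a => v2 a j)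
  have g1 := gwrap_eq n v1 a0 a1
  have g2 := gwrap_eq n (fun j a => v2 a j) b0 b1
  have hcE : cE n (fun i b => gwrap n v1 i (b+1)) (fun a j => gwrap n (fun j a => v2 a j) j (a+1))
      = cE n v1 v2 := by
    unfold cE
    congr 1
    · congr 1
      · congr 1
        · apply gsum_congr; intro a ha b hb; simp only [g1 _ b hb]
        · apply cE1_congr; intro i hi b hb; exact g1 i b hb
      · apply cE1_congr; intro i hi b hb; exact g2 i b hb
    · apply gsum_congr; intro a ha b hb; simp only [g2 _ a ha]
  have hH := H1_eq n _ _ m1 m2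
  rw [hcE] at hH
  have hh := gh_pos n
  have hb : bh (n+1) (gwrap n v1) (fun i j => gwrap n (fun j a => v2 a j) j i) q
      = gh (n+1) * - gsum n (fun a b => q (a+1) (b+1) * (v1 (a+1) b - v1 a b + (v2 a (b+1) - v2 a b))) := by
    unfold bh d1V1 d2V2
    rw [mul_neg, sum_Icc_shift]
    simp only [sum_Icc_shift, Nat.add_sub_cancel]
    congr 1
    unfold gsum
    rw [mul_sum, mul_sum]; apply sum_congr rfl; intro a ha
    rw [mul_sum, mul_sum]; apply sum_congr rfl; intro b hb
    have ha' : a ≤ n := by simp at ha; omega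
    have hb' : b ≤ n := by simp at hb; omega
    rw [g1 _ b hb', g1 _ b hb', g2 _ a ha', g2 _ a ha']
    field_simp
  have hi : innerM (n+1) q q = gh (n+1) ^ 2 * gsum n (fun a b => q (a+1) (b+1) ^ 2) := by
    unfold innerM gsum
    simp only [sum_Icc_shift, pow_two]
  refine ⟨_, _, m1, m2, ?_, ?_⟩
  · unfold H1semi; rw [hH]; exact Real.sqrt_pos.mpr hpos
  · rw [hb, hi]; unfold H1semi; rw [hH, Real.sqrt_mul (by positivity), Real.sqrt_sq hh.le]
    have := mul_le_mul_of_nonneg_left hmain hh.le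
    linarith

/-- discrete LBB (inf-sup) condition for the MAC scheme:
there is `β > 0` independent of `N` such that for every `q ∈ M_h` there is
`v = (v¹,v²) ∈ V_h^(1) × V_h^(2)` with `|v|₁ > 0` and `b_h(v,q) ≥ β ‖q‖_M |v|₁`. -/
theorem discrete_LBB :
    ∃ β : ℝ, 0 < β ∧ ∀ N : ℕ, 2 ≤ N → ∀ q : ℕ → ℕ → ℝ, inM N q →
      ∃ v1 v2 : ℕ → ℕ → ℝ, inV1 N v1 ∧ inV2 N v2 ∧ 0 < H1semi N v1 v2 ∧
        bh N v1 v2 q ≥ β * Real.sqrt (innerM N q q) * H1semi N v1 v2 := by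

  exact discrete_aux
end
end

section
/- Discrete pressure stability: there exists a constant C > 0, independent of N, such that for every integer N ≥ 2, if (e¹, e², e_p) ∈ V_h^(1) × V_h^(2) × M_h satisfies the two momentum equations −Δ_h e¹_{i,j-1/2} + δ⁺₁ (e_p)_{i-1/2,j-1/2} = R¹_{i,j-1/2} (1 ≤ i ≤ N−1, 1 ≤ j ≤ N) and −Δ_h e²_{i-1/2,j} + δ⁺₂ (e_p)_{i-1/2,j-1/2} = R²_{i-1/2,j} (1 ≤ i ≤ N, 1 ≤ j ≤ N−1), then ‖e_p‖_{M} ≤ C ( |e|₁ + ‖R¹‖_{V¹} + ‖R²‖_{V²} ), where e = (e¹, e²). -/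
open Finset

noncomputable section

/-- sum over a box with one layer of margin -/
def II (N : ℤ) (f : ℤ → ℤ → ℝ) : ℝ :=
  ∑ i ∈ Icc (-1) (N+1), ∑ j ∈ Icc (-1) (N+1), f i j

/-- supported in `[0,N]²` -/
def Sm (N : ℤ) (f : ℤ → ℤ → ℝ) : Prop :=
  ∀ i j, ¬ (0 ≤ i ∧ i ≤ N ∧ 0 ≤ j ∧ j ≤ N) → f i j = 0

def LL (w : ℤ → ℤ → ℝ) (i j : ℤ) : ℝ :=
  4 * w i j - w (i+1) j - w (i-1) j - w i (j+1) - w i (j-1)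

def EE (N : ℤ) (z : ℤ → ℤ → ℝ) : ℝ :=
  II N (fun i j => (z (i+1) j - z i j)^2 + (z i (j+1) - z i j)^2)

lemma II_add (N : ℤ) (f g : ℤ → ℤ → ℝ) :
    II N (fun i j => f i j + g i j) = II N f + II N g := by
  simp [II, Finset.sum_add_distrib]

lemma II_sub (N : ℤ) (f g : ℤ → ℤ → ℝ) :
    II N (fun i j => f i j - g i j) = II N f - II N g := by
  simp [II, Finset.sum_sub_distrib]

lemma II_smul (N : ℤ) (c : ℝ) (f : ℤ → ℤ → ℝ) :
    II N (fun i j => c * f i j) = c * II N f := by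
  simp [II, Finset.mul_sum]

lemma II_mono (N : ℤ) (f g : ℤ → ℤ → ℝ) (h : ∀ i j, f i j ≤ g i j) : II N f ≤ II N g :=
  Finset.sum_le_sum fun i _ => Finset.sum_le_sum fun j _ => h i j

lemma II_nonneg (N : ℤ) (f : ℤ → ℤ → ℝ) (h : ∀ i j, 0 ≤ f i j) : 0 ≤ II N f :=
  Finset.sum_nonneg fun i _ => Finset.sum_nonneg fun j _ => h i j

lemma shift1d (N : ℤ) (f : ℤ → ℝ) (h : ∀ i, ¬ (0 ≤ i ∧ i ≤ N) → f i = 0) :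
    ∑ i ∈ Icc (-1) (N+1), f (i+1) = ∑ i ∈ Icc (-1) (N+1), f i := by
  refine Finset.sum_bij_ne_zero (fun a _ _ => a + 1) ?_ ?_ ?_ ?_
  · intro a _ ha
    by_contra hc
    exact ha (h _ (by simp at hc; grind))
  · intro a _ _ b _ _ hab
    omega
  · intro b _ hb
    have : 0 ≤ b ∧ b ≤ N := by
      by_contra hc; exact hb (h b hc)
    exact ⟨b - 1, by simp; omega, by simpa using hb, by omega⟩
  · intros; rfl

lemma shift1d' (N : ℤ) (f : ℤ → ℝ) (h : ∀ i, ¬ (0 ≤ i ∧ i ≤ N) → f i = 0) :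
    ∑ i ∈ Icc (-1) (N+1), f (i-1) = ∑ i ∈ Icc (-1) (N+1), f i := by
  refine Finset.sum_bij_ne_zero (fun a _ _ => a - 1) ?_ ?_ ?_ ?_
  · intro a _ ha
    by_contra hc
    exact ha (h _ (by simp at hc; grind))
  · intro a _ _ b _ _ hab
    omega
  · intro b _ hb
    have : 0 ≤ b ∧ b ≤ N := by
      by_contra hc; exact hb (h b hc)
    exact ⟨b + 1, by simp; omega, by simpa using hb, by omega⟩
  · intros; rfl

lemma II_s1 {N : ℤ} {f : ℤ → ℤ → ℝ} (h : Sm N f) : II N (fun i j => f (i+1) j) = II N f := by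
  unfold II
  rw [Finset.sum_comm, Finset.sum_comm (f := fun i j => f i j)]
  exact Finset.sum_congr rfl fun j _ => shift1d N (fun i => f i j) fun i hi => h i j (by tauto)

lemma II_s1' {N : ℤ} {f : ℤ → ℤ → ℝ} (h : Sm N f) : II N (fun i j => f (i-1) j) = II N f := by
  unfold II
  rw [Finset.sum_comm, Finset.sum_comm (f := fun i j => f i j)]
  exact Finset.sum_congr rfl fun j _ => shift1d' N (fun i => f i j) fun i hi => h i j (by tauto)

lemma II_s2 {N : ℤ} {f : ℤ → ℤ → ℝ} (h : Sm N f) : II N (fun i j => f i (j+1)) = II N f := by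
  unfold II
  exact Finset.sum_congr rfl fun i _ => shift1d N (fun j => f i j) fun j hi => h i j (by tauto)

lemma II_s2' {N : ℤ} {f : ℤ → ℤ → ℝ} (h : Sm N f) : II N (fun i j => f i (j-1)) = II N f := by
  unfold II
  exact Finset.sum_congr rfl fun i _ => shift1d' N (fun j => f i j) fun j hi => h i j (by tauto)

lemma Sm.mul_right {N : ℤ} {f : ℤ → ℤ → ℝ} (h : Sm N f) (g : ℤ → ℤ → ℝ) :
    Sm N (fun i j => f i j * g i j) := fun i j hh => by simp [h i j hh]

/-- summation by parts -/
lemma sbp1 {N : ℤ} {z : ℤ → ℤ → ℝ} (h : Sm N z) (f : ℤ → ℤ → ℝ) :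
    II N (fun i j => z i j * (f (i+1) j - f i j)) = II N (fun i j => (z (i-1) j - z i j) * f i j) := by
  have h1 := II_s1' (h.mul_right (fun i j => f (i+1) j))
  simp only [sub_add_cancel] at h1
  simp only [mul_sub, sub_mul, II_sub]
  linarith

lemma sbp2 {N : ℤ} {z : ℤ → ℤ → ℝ} (h : Sm N z) (f : ℤ → ℤ → ℝ) :
    II N (fun i j => z i j * (f i (j+1) - f i j)) = II N (fun i j => (z i (j-1) - z i j) * f i j) := by
  have h1 := II_s2' (h.mul_right (fun i j => f i (j+1)))
  simp only [sub_add_cancel] at h1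
  simp only [mul_sub, sub_mul, II_sub]
  linarith

lemma green {N : ℤ} {z : ℤ → ℤ → ℝ} (h : Sm N z) (w : ℤ → ℤ → ℝ) :
    II N (fun i j => z i j * LL w i j) =
      II N (fun i j => (z (i+1) j - z i j) * (w (i+1) j - w i j)
        + (z i (j+1) - z i j) * (w i (j+1) - w i j)) := by
  have h1 := II_s1 (h.mul_right (fun i j => w i j - w (i-1) j))
  have h2 := II_s2 (h.mul_right (fun i j => w i j - w i (j-1)))
  simp only [add_sub_cancel_right] at h1 h2
  have e1 : (fun i j => z i j * LL w i j) = fun i j => (z i j * (w i j - w (i-1) j)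
      + z i j * (w i j - w i (j-1))) - (z i j * (w (i+1) j - w i j) + z i j * (w i (j+1) - w i j)) := by
    funext i j; simp only [LL]; ring
  have e2 : (fun i j => (z (i+1) j - z i j) * (w (i+1) j - w i j)
        + (z i (j+1) - z i j) * (w i (j+1) - w i j)) = fun i j =>
      (z (i+1) j * (w (i+1) j - w i j) + z i (j+1) * (w i (j+1) - w i j))
       - (z i j * (w (i+1) j - w i j) + z i j * (w i (j+1) - w i j)) := by
    funext i j; ring
  rw [e1, e2, II_sub, II_sub, II_add, II_add, ← h1, ← h2, II_add]

lemma green_self {N : ℤ} {z : ℤ → ℤ → ℝ} (h : Sm N z) :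
    II N (fun i j => z i j * LL z i j) = EE N z := by
  rw [green h]; unfold EE; congr 1; funext i j; ring

/-- weighted energy estimate -/
lemma weighted {N : ℤ} {G D : ℤ → ℤ → ℝ} (hG : Sm N G) (hD : ∀ i j, G i j ≠ 0 → 1 ≤ D i j)
    (hL1 : ∀ i j, |D (i+1) j - D i j| ≤ 2) (hL2 : ∀ i j, |D i (j+1) - D i j| ≤ 2)
    (hh : ∀ i j, G i j = 0 ∨ D i j ≤ 2 ∨ LL G i j = 0) :
    EE N (fun i j => D i j ^ 2 * G i j) ≤ 256 * II N (fun i j => D i j ^ 2 * G i j ^ 2) := by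
  set S : ℤ → ℤ → ℝ := fun i j => D i j ^ 2 * G i j ^ 2 with hS
  have hSm : Sm N S := fun i j hij => by simp [hS, hG i j hij]
  have hz : Sm N (fun i j => (D i j)^4 * G i j) := fun i j hij => by simp [hG i j hij]
  have hGS : ∀ i j, G i j ^ 2 ≤ S i j := by
    intro i j
    by_cases h0 : G i j = 0
    · simp [hS, h0]
    · have := hD i j h0
      simp only [hS]; nlinarith [sq_nonneg (G i j), mul_nonneg (sq_nonneg (G i j)) (by nlinarith : 0 ≤ D i j ^2 - 1)]
  have hS0 : ∀ i j, 0 ≤ S i j := fun i j => by simp only [hS]; positivity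
  have edge : ∀ a b x y : ℝ, (a ≠ 0 → 1 ≤ x) → (b ≠ 0 → 1 ≤ y) → |y - x| ≤ 2 →
      a * b * (y^2 - x^2)^2 ≤ 32 * (x^2 * a^2 + y^2*b^2) := by
    intro a b x y ha hb hxy
    by_cases ha0 : a = 0
    · subst ha0; simp; positivity
    by_cases hb0 : b = 0
    · subst hb0; simp; positivity
    have hx := ha ha0
    have hy := hb hb0
    rw [abs_le] at hxy
    have h1 : (y - x)^2 ≤ 4 := by nlinarith
    have h2 : (y + x)^2 ≤ 16 * (x * y) := by nlinarith
    have h3 : (y^2 - x^2)^2 ≤ 64 * (x*y) := by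
      have : (y^2-x^2)^2 = (y-x)^2 * (y+x)^2 := by ring
      rw [this]
      nlinarith [mul_le_mul h1 h2 (sq_nonneg _) (by norm_num)]
    calc a * b * (y^2 - x^2)^2 ≤ |a * b| * (y^2-x^2)^2 := by
          gcongr; exact le_abs_self _
      _ ≤ |a*b| * (64 * (x*y)) := by gcongr
      _ = 64 * |(x*a)*(y*b)| := by
          rw [abs_mul, abs_mul, abs_mul, abs_mul, abs_of_pos (by linarith : 0 < x), abs_of_pos (by linarith : 0 < y)]; ring
      _ ≤ 32 * (x^2 * a^2 + y^2*b^2) := by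
          have : |(x*a)*(y*b)| ≤ ((x*a)^2 + (y*b)^2)/2 := by
            rw [abs_le]; constructor <;> nlinarith [sq_nonneg (x*a+y*b), sq_nonneg (x*a-y*b)]
          nlinarith
  have node : ∀ i j, (D i j)^4 * G i j * LL G i j ≤
      96 * S i j + 8 * S (i+1) j + 8 * S (i-1) j + 8 * S i (j+1) + 8 * S i (j-1) := by
    intro i j
    have p0 := hS0 i j
    have p1 := hS0 (i+1) j
    have p2 := hS0 (i-1) j
    have p3 := hS0 i (j+1)
    have p4 := hS0 i (j-1)
    by_cases h0 : G i j = 0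
    · rw [h0]; simp; linarith
    rcases hh i j with h | h | h
    · exact absurd h h0
    · have hx := hD i j h0
      have hx2 : D i j ^ 4 ≤ 16 := by
        have : D i j ^4 ≤ 2^4 := by gcongr
        linarith
      have q0 := hGS i j
      have q1 := hGS (i+1) j
      have q2 := hGS (i-1) j
      have q3 := hGS i (j+1)
      have q4 := hGS i (j-1)
      have hb : G i j * LL G i j ≤ 6 * S i j + (S (i+1) j + S (i-1) j + S i (j+1) + S i (j-1))/2 := by
        simp only [LL]
        nlinarith [sq_nonneg (G i j + G (i+1) j), sq_nonneg (G i j + G (i-1) j), sq_nonneg (G i j + G i (j+1)), sq_nonneg (G i j + G i (j-1))]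
      have h4 : 0 ≤ D i j ^ 4 := by positivity
      calc (D i j)^4 * G i j * LL G i j = (D i j)^4 * (G i j * LL G i j) := by ring
        _ ≤ (D i j)^4 * (6 * S i j + (S (i+1) j + S (i-1) j + S i (j+1) + S i (j-1))/2) := by gcongr
        _ ≤ 16 * (6 * S i j + (S (i+1) j + S (i-1) j + S i (j+1) + S i (j-1))/2) := by
            apply mul_le_mul_of_nonneg_right hx2; positivity
        _ = _ := by ring
    · rw [h]; simp; linarith
  have key : EE N (fun i j => D i j ^ 2 * G i j) = II N (fun i j => (D i j)^4 * G i j * LL G i j)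
      + II N (fun i j => G i j * G (i+1) j * (D (i+1) j ^2 - D i j ^2)^2
        + G i j * G i (j+1) * (D i (j+1) ^2 - D i j ^2)^2) := by
    rw [green hz, ← II_add]; unfold EE; congr 1; funext i j; ring
  have b1 := II_mono N _ _ node
  have b2 : II N (fun i j => G i j * G (i+1) j * (D (i+1) j ^2 - D i j ^2)^2
        + G i j * G i (j+1) * (D i (j+1) ^2 - D i j ^2)^2) ≤
        II N (fun i j => 64 * S i j + 32 * S (i+1) j + 32 * S i (j+1)) := by
    apply II_mono; intro i j
    have e1 := edge (G i j) (G (i+1) j) (D i j) (D (i+1) j) (hD _ _) (hD _ _) (hL1 i j)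
    have e2 := edge (G i j) (G i (j+1)) (D i j) (D i (j+1)) (hD _ _) (hD _ _) (hL2 i j)
    simp only [hS]; linarith
  have c1 := II_s1 hSm
  have c2 := II_s2 hSm
  have c3 := II_s1' hSm
  have c4 := II_s2' hSm
  simp only [II_add, II_smul] at b1 b2
  rw [key]
  simp only [II_add] at *
  linarith

/-- solvability of the zero-extension Dirichlet problem -/
lemma solve {N : ℤ} (s : Finset (ℤ × ℤ)) (hs : ∀ i j, (i,j) ∈ s → 1 ≤ i ∧ i ≤ N ∧ 1 ≤ j ∧ j ≤ N)
    (f : ℤ → ℤ → ℝ) :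
    ∃ z : ℤ → ℤ → ℝ, (∀ i j, (i,j) ∉ s → z i j = 0) ∧ ∀ i j, (i,j) ∈ s → LL z i j = f i j := by
  classical
  let ext : (s → ℝ) → ℤ → ℤ → ℝ := fun v i j => if h : (i,j) ∈ s then v ⟨(i,j), h⟩ else 0
  have ext_add : ∀ v w i j, ext (v+w) i j = ext v i j + ext w i j := by
    intro v w i j; simp only [ext]; split_ifs <;> simp
  have ext_smul : ∀ (c : ℝ) v i j, ext (c • v) i j = c * ext v i j := by
    intro v w i j; simp only [ext]; split_ifs <;> simp
  let A : (s → ℝ) →ₗ[ℝ] (s → ℝ) :=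
    { toFun := fun v a => LL (ext v) a.1.1 a.1.2
      map_add' := by intro v w; funext a; simp only [LL, ext_add, Pi.add_apply]; ring
      map_smul' := by intro c v; funext a; simp only [LL, ext_smul, Pi.smul_apply, smul_eq_mul, RingHom.id_apply]; ring }
  have hinj : Function.Injective A := by
    rw [injective_iff_map_eq_zero]
    intro v hv
    have hsupp : ∀ i j, (i,j) ∉ s → ext v i j = 0 := by
      intro i j h; simp [ext, h]
    have hSm : Sm N (ext v) := by
      intro i j h; apply hsupp; intro hc; have := hs i j hc; omega
    have h0 : ∀ i j, ext v i j * LL (ext v) i j = 0 := by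
      intro i j
      by_cases h : (i,j) ∈ s
      · have := congrFun hv ⟨(i,j), h⟩
        have h2 : LL (ext v) i j = 0 := this
        rw [h2, mul_zero]
      · rw [hsupp i j h, zero_mul]
    have hE := green_self hSm
    have hE0 : EE N (ext v) = 0 := by
      rw [← hE]; simp [II, h0]
    unfold EE II at hE0
    have step : ∀ i j, -1 ≤ i → i ≤ N+1 → -1 ≤ j → j ≤ N+1 → ext v (i+1) j = ext v i j := by
      intro i j h1 h2 h3 h4
      rw [Finset.sum_eq_zero_iff_of_nonneg (fun i _ => Finset.sum_nonneg fun j _ => by positivity)] at hE0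
      have := hE0 i (by simp; omega)
      rw [Finset.sum_eq_zero_iff_of_nonneg (fun j _ => by positivity)] at this
      have := this j (by simp; omega)
      nlinarith [sq_nonneg (ext v (i+1) j - ext v i j), sq_nonneg (ext v i (j+1) - ext v i j)]
    have all : ∀ (n : ℕ) j, (n:ℤ) ≤ N+1 → 0 ≤ j → j ≤ N → ext v n j = 0 := by
      intro n j
      induction n with
      | zero => intro _ h1 h2; apply hsupp; intro hc; have := hs _ _ hc; simp at this
      | succ k ih =>
        intro h h1 h2
        push_cast at h ⊢
        rw [step k j (by omega) (by omega) (by omega) (by omega)]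
        exact ih (by omega) h1 h2
    funext ⟨⟨i,j⟩, h⟩
    have hb := hs i j h
    have := all i.toNat j (by omega) (by omega) (by omega)
    rw [Int.toNat_of_nonneg (by omega)] at this
    simpa [ext, h] using this
  have hsurj := LinearMap.injective_iff_surjective.mp hinj
  obtain ⟨v, hv⟩ := hsurj (fun a => f a.1.1 a.1.2)
  refine ⟨ext v, fun i j h => by simp [ext, h], fun i j h => ?_⟩
  exact congrFun hv ⟨(i,j), h⟩

/-- path lemma -/
lemma path1d (f : ℤ → ℝ) (a b i k : ℤ) (hi : a ≤ i) (hi' : i ≤ b) (hk : a ≤ k) (hk' : k ≤ b) :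
    (f i - f k)^2 ≤ (b - a) * ∑ r ∈ Ico a b, (f (r+1) - f r)^2 := by
  wlog h : k ≤ i generalizing i k
  · have := this k i hk hk' hi hi' (by omega)
    calc (f i - f k)^2 = (f k - f i)^2 := by ring
      _ ≤ _ := this
  have tel : ∀ n : ℕ, f (k+n) - f k = ∑ r ∈ Ico k (k+n), (f (r+1) - f r) := by
    intro n
    induction n with
    | zero => simp
    | succ m ih =>
      have : Ico k (k + ((m+1 : ℕ):ℤ)) = insert (k+m) (Ico k (k+m)) := by
        ext x; simp; omega
      rw [this, Finset.sum_insert (by simp), ← ih]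
      push_cast; rw [← add_assoc]; ring
  have t := tel (i-k).toNat
  rw [Int.toNat_of_nonneg (by omega)] at t
  rw [show k + (i-k) = i by ring] at t
  rw [t]
  have cs := sq_sum_le_card_mul_sum_sq (s := Ico k i) (f := fun r => f (r+1) - f r)
  have hc : ((Ico k i).card : ℝ) = (i:ℝ) - k := by
    rw [Int.card_Ico]
    have : (((i-k).toNat : ℤ):ℝ) = ((i - k : ℤ):ℝ) := by rw [Int.toNat_of_nonneg (by omega)]
    push_cast at this; exact_mod_cast this
  rw [hc] at cs
  refine cs.trans ?_
  have hb : (i:ℝ) - k ≤ (b:ℝ) - a := by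
    have : i - k ≤ b - a := by omega
    exact_mod_cast this
  have hk0 : (0:ℝ) ≤ (i:ℝ) - k := by
    have : 0 ≤ i - k := by omega
    exact_mod_cast this
  apply mul_le_mul hb ?_ (Finset.sum_nonneg fun _ _ => sq_nonneg _) (hk0.trans hb)
  exact Finset.sum_le_sum_of_subset_of_nonneg (Finset.Ico_subset_Ico hk hi') fun _ _ _ => sq_nonneg _
lemma II_rect (N a b c d : ℤ) (ha : -1 ≤ a) (hb : b ≤ N+1) (hc : -1 ≤ c) (hd : d ≤ N+1) (f : ℤ → ℤ → ℝ) :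
    II N (fun i j => if (a ≤ i ∧ i ≤ b) ∧ (c ≤ j ∧ j ≤ d) then f i j else 0)
      = ∑ i ∈ Icc a b, ∑ j ∈ Icc c d, f i j := by
  unfold II
  symm
  rw [← Finset.sum_subset (Finset.Icc_subset_Icc ha hb)]
  · apply Finset.sum_congr rfl
    intro i hi
    rw [← Finset.sum_subset (Finset.Icc_subset_Icc hc hd)]
    · apply Finset.sum_congr rfl
      intro j hj
      simp only [Finset.mem_Icc] at hi hj
      beta_reduce
      rw [if_pos ⟨hi, hj⟩]
    · intro j _ hj
      simp only [Finset.mem_Icc] at hj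
      beta_reduce
      rw [if_neg (by tauto)]
  · intro i _ hi
    simp only [Finset.mem_Icc] at hi
    apply Finset.sum_eq_zero
    intro j _
    beta_reduce
    rw [if_neg (by tauto)]

lemma II_sub_le (N : ℤ) (s t : Finset ℤ) (hs : s ⊆ Icc (-1) (N+1)) (ht : t ⊆ Icc (-1) (N+1))
    (f g : ℤ → ℤ → ℝ) (hf : ∀ i j, 0 ≤ f i j) (hg : ∀ i ∈ s, ∀ j ∈ t, g i j ≤ f i j) :
    ∑ i ∈ s, ∑ j ∈ t, g i j ≤ II N f := by
  unfold II
  calc ∑ i ∈ s, ∑ j ∈ t, g i j ≤ ∑ i ∈ s, ∑ j ∈ t, f i j :=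
        Finset.sum_le_sum fun i hi => Finset.sum_le_sum fun j hj => hg i hi j hj
    _ ≤ ∑ i ∈ s, ∑ j ∈ Icc (-1) (N+1), f i j :=
        Finset.sum_le_sum fun i hi => Finset.sum_le_sum_of_subset_of_nonneg ht fun j _ _ => hf i j
    _ ≤ _ := Finset.sum_le_sum_of_subset_of_nonneg hs fun i _ _ => Finset.sum_nonneg fun j _ => hf i j

/-- distance weight at vertical faces (in half mesh units) -/
def D1 (N i j : ℤ) : ℤ := N - max |2*i-N| |2*j-N-1|
/-- distance weight at horizontal faces -/
def D2 (N i j : ℤ) : ℤ := N - max |2*i-N-1| |2*j-N|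

lemma div_bound (N s t : ℤ) :
    (N - max |s+1| |t|) * (s+1) - (N - max |s-1| |t|) * (s-1)
     + (N - max |s| |t+1|) * (t+1) - (N - max |s| |t-1|) * (t-1) ≤ 4*N - 6 * max |s| |t| := by
  have key : ∀ A B A' B' m : ℤ, A = max |s+1| |t| → B = max |s-1| |t| → A' = max |s| |t+1| →
     B' = max |s| |t-1| → m = max |s| |t| →
     6 * m ≤ A * (s+1) - B * (s-1) + A' * (t+1) - B' * (t-1) := by
    intro A B A' B' m hA hB hA' hB' hm
    simp only [abs_eq_max_neg] at *
    have cases : (t < s ∧ -t < s) ∨ (t < -s ∧ -t < -s) ∨ (s < t ∧ -s < t) ∨ (s < -t ∧ -s < -t) ∨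
      (s = t ∧ 0 < s) ∨ (s = t ∧ s < 0) ∨ (s = -t ∧ 0 < s) ∨ (s = -t ∧ s < 0) ∨ (s = 0 ∧ t = 0) := by omega
    rcases cases with h | h | h | h | h | h | h | h | h
    · have e1 : A = s+1 := by omega
      have e2 : B = s-1 := by omega
      have e3 : A' = s := by omega
      have e4 : B' = s := by omega
      have e5 : m = s := by omega
      clear hA hB hA' hB' hm
      rw [e1, e2, e3, e4, e5]
      linarith
    · have e1 : A = -s-1 := by omega
      have e2 : B = -s+1 := by omega
      have e3 : A' = -s := by omega
      have e4 : B' = -s := by omega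
      have e5 : m = -s := by omega
      clear hA hB hA' hB' hm
      rw [e1, e2, e3, e4, e5]
      linarith
    · have e1 : A = t := by omega
      have e2 : B = t := by omega
      have e3 : A' = t+1 := by omega
      have e4 : B' = t-1 := by omega
      have e5 : m = t := by omega
      clear hA hB hA' hB' hm
      rw [e1, e2, e3, e4, e5]
      linarith
    · have e1 : A = -t := by omega
      have e2 : B = -t := by omega
      have e3 : A' = -t-1 := by omega
      have e4 : B' = -t+1 := by omega
      have e5 : m = -t := by omega
      clear hA hB hA' hB' hm
      rw [e1, e2, e3, e4, e5]
      linarith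
    · have e1 : A = t+1 := by omega
      have e2 : B = t := by omega
      have e3 : A' = t+1 := by omega
      have e4 : B' = t := by omega
      have e5 : m = t := by omega
      clear hA hB hA' hB' hm
      obtain ⟨h, h'⟩ := h
      rw [e1, e2, e3, e4, e5, h]
      rw [h] at h'
      ring_nf
      linarith
    · have e1 : A = -t := by omega
      have e2 : B = -t+1 := by omega
      have e3 : A' = -t := by omega
      have e4 : B' = -t+1 := by omega
      have e5 : m = -t := by omega
      clear hA hB hA' hB' hm
      obtain ⟨h, h'⟩ := h
      rw [e1, e2, e3, e4, e5, h]
      rw [h] at h'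
      ring_nf
      linarith
    · have e1 : A = -t+1 := by omega
      have e2 : B = -t := by omega
      have e3 : A' = -t := by omega
      have e4 : B' = -t+1 := by omega
      have e5 : m = -t := by omega
      clear hA hB hA' hB' hm
      obtain ⟨h, h'⟩ := h
      rw [e1, e2, e3, e4, e5, h]
      rw [h] at h'
      ring_nf
      linarith
    · have e1 : A = t := by omega
      have e2 : B = t+1 := by omega
      have e3 : A' = t+1 := by omega
      have e4 : B' = t := by omega
      have e5 : m = t := by omega
      clear hA hB hA' hB' hm
      obtain ⟨h, h'⟩ := h
      rw [e1, e2, e3, e4, e5, h]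
      rw [h] at h'
      ring_nf
      linarith
    · have e1 : A = 1 := by omega
      have e2 : B = 1 := by omega
      have e3 : A' = 1 := by omega
      have e4 : B' = 1 := by omega
      have e5 : m = 0 := by omega
      rw [e1, e2, e3, e4, e5, h.1, h.2]
      norm_num
  have := key _ _ _ _ _ rfl rfl rfl rfl rfl
  linarith

abbrev F1 (N i j : ℤ) : Prop := (1 ≤ i ∧ i ≤ N-1) ∧ (1 ≤ j ∧ j ≤ N)
abbrev F2 (N i j : ℤ) : Prop := (1 ≤ i ∧ i ≤ N) ∧ (1 ≤ j ∧ j ≤ N-1)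
abbrev Cell (N i j : ℤ) : Prop := (1 ≤ i ∧ i ≤ N) ∧ (1 ≤ j ∧ j ≤ N)

def X1 (N i j : ℤ) : ℤ := if F1 N i j then D1 N i j * (2*i-N) else 0
def X2 (N i j : ℤ) : ℤ := if F2 N i j then D2 N i j * (2*j-N) else 0

def G1 (N : ℤ) (P : ℤ → ℤ → ℝ) (i j : ℤ) : ℝ := if F1 N i j then P (i+1) j - P i j else 0
def G2 (N : ℤ) (P : ℤ → ℤ → ℝ) (i j : ℤ) : ℝ := if F2 N i j then P i (j+1) - P i j else 0

/-- weighted gradient energy -/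
def SS (N : ℤ) (P : ℤ → ℤ → ℝ) : ℝ :=
  II N (fun i j => (D1 N i j : ℝ)^2 * G1 N P i j ^2) + II N (fun i j => (D2 N i j : ℝ)^2 * G2 N P i j ^2)

lemma X1_eq {N i j : ℤ} (h0 : 0 ≤ i) (h1 : i ≤ N) (h2 : 1 ≤ j) (h3 : j ≤ N) : X1 N i j = D1 N i j * (2*i-N) := by
  unfold X1
  split_ifs with h
  · rfl
  · have : D1 N i j = 0 := by
      unfold D1; simp only [abs_eq_max_neg]; unfold F1 at h; omega
    rw [this, zero_mul]

lemma X2_eq {N i j : ℤ} (h0 : 1 ≤ i) (h1 : i ≤ N) (h2 : 0 ≤ j) (h3 : j ≤ N) : X2 N i j = D2 N i j * (2*j-N) := by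
  unfold X2
  split_ifs with h
  · rfl
  · have : D2 N i j = 0 := by
      unfold D2; simp only [abs_eq_max_neg]; unfold F2 at h; omega
    rw [this, zero_mul]

lemma divX {N i j : ℤ} (h : Cell N i j) :
    X1 N i j - X1 N (i-1) j + X2 N i j - X2 N i (j-1) ≤ 4*N - 6 * max |2*i-N-1| |2*j-N-1| := by
  obtain ⟨⟨h1, h2⟩, h3, h4⟩ := h
  rw [X1_eq (by omega) (by omega) (by omega) (by omega), X1_eq (by omega) (by omega) (by omega) (by omega),
    X2_eq (by omega) (by omega) (by omega) (by omega), X2_eq (by omega) (by omega) (by omega) (by omega)]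
  have := div_bound N (2*i-N-1) (2*j-N-1)
  unfold D1 D2
  rw [show 2*(i-1)-N = 2*i-N-1-1 by ring, show 2*(j-1)-N = 2*j-N-1-1 by ring]
  rw [show 2*i-N-1+1 = 2*i-N by ring, show 2*j-N-1+1 = 2*j-N by ring] at this
  exact this

lemma D1_pos {N i j : ℤ} (h : F1 N i j) : 1 ≤ D1 N i j := by
  unfold D1; simp only [abs_eq_max_neg]; unfold F1 at h; omega
lemma D2_pos {N i j : ℤ} (h : F2 N i j) : 1 ≤ D2 N i j := by
  unfold D2; simp only [abs_eq_max_neg]; unfold F2 at h; omega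

lemma X1_bound {N i j : ℤ} (hN : 2 ≤ N) (a b : ℝ) :
    (X1 N i j : ℝ) * (a^2 - b^2) ≤ N * ((if F1 N i j then a^2 + b^2 else 0) / 8
      + 4 * ((D1 N i j:ℝ)^2 * (if F1 N i j then a - b else 0)^2)) := by
  unfold X1
  split_ifs with h
  · have hD := D1_pos h
    obtain ⟨⟨h1, h2⟩, h3, h4⟩ := h
    have q1 : |(2*i-N:ℝ)| ≤ N := by
      rw [abs_le]
      have : -N ≤ 2*i-N ∧ 2*i-N ≤ N := by omega
      exact_mod_cast this
    have hN' : (0:ℝ) ≤ N := by exact_mod_cast (by omega : 0 ≤ N)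
    push_cast
    set d : ℝ := (D1 N i j : ℝ)
    calc d * (2*i-N) * (a^2-b^2) = (2*i-N) * (d * (a-b) * (a+b)) := by ring
      _ ≤ |(2*i-N:ℝ)| * |d * (a-b) * (a+b)| := by rw [← abs_mul]; exact le_abs_self _
      _ ≤ N * |d * (a-b) * (a+b)| := by gcongr
      _ ≤ _ := by
        apply mul_le_mul_of_nonneg_left _ hN'
        rw [abs_le]; constructor
        · nlinarith [sq_nonneg (8 * (d * (a-b)) + (a+b)), sq_nonneg (a-b)]
        · nlinarith [sq_nonneg (8 * (d * (a-b)) - (a+b)), sq_nonneg (a-b)]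
  · simp

lemma X2_bound {N i j : ℤ} (hN : 2 ≤ N) (a b : ℝ) :
    (X2 N i j : ℝ) * (a^2 - b^2) ≤ N * ((if F2 N i j then a^2 + b^2 else 0) / 8
      + 4 * ((D2 N i j:ℝ)^2 * (if F2 N i j then a - b else 0)^2)) := by
  unfold X2
  split_ifs with h
  · have hD := D2_pos h
    obtain ⟨⟨h1, h2⟩, h3, h4⟩ := h
    have q1 : |(2*j-N:ℝ)| ≤ N := by
      rw [abs_le]
      have : -N ≤ 2*j-N ∧ 2*j-N ≤ N := by omega
      exact_mod_cast this
    have hN' : (0:ℝ) ≤ N := by exact_mod_cast (by omega : 0 ≤ N)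
    push_cast
    set d : ℝ := (D2 N i j : ℝ)
    calc d * (2*j-N) * (a^2-b^2) = (2*j-N) * (d * (a-b) * (a+b)) := by ring
      _ ≤ |(2*j-N:ℝ)| * |d * (a-b) * (a+b)| := by rw [← abs_mul]; exact le_abs_self _
      _ ≤ N * |d * (a-b) * (a+b)| := by gcongr
      _ ≤ _ := by
        apply mul_le_mul_of_nonneg_left _ hN'
        rw [abs_le]; constructor
        · nlinarith [sq_nonneg (8 * (d * (a-b)) + (a+b)), sq_nonneg (a-b)]
        · nlinarith [sq_nonneg (8 * (d * (a-b)) - (a+b)), sq_nonneg (a-b)]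
  · simp

lemma hardyX {N : ℤ} (hN : 2 ≤ N) (Q : ℤ → ℤ → ℝ) :
    ∑ i ∈ Icc 1 N, ∑ j ∈ Icc 1 N, Q i j ^ 2 ≤ 8 * SS N Q
      + 10 * ∑ i ∈ Icc (N/12+1) (N-N/12), ∑ j ∈ Icc (N/12+1) (N-N/12), Q i j ^ 2 := by
  have hNR : (0:ℝ) < N := by exact_mod_cast (by omega : 0 < N)
  rw [← II_rect N 1 N 1 N (by omega) (by omega) (by omega) (by omega),
    ← II_rect N _ _ _ _ (by omega) (by omega) (by omega) (by omega)]
  set Qc : ℤ → ℤ → ℝ := fun i j => if (1 ≤ i ∧ i ≤ N) ∧ (1 ≤ j ∧ j ≤ N) then Q i j ^2 else 0 with hQc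
  set QK : ℤ → ℤ → ℝ := fun i j => if (N/12+1 ≤ i ∧ i ≤ N-N/12) ∧ (N/12+1 ≤ j ∧ j ≤ N-N/12) then Q i j ^2 else 0 with hQK
  have hQcS : Sm N Qc := fun i j h => by simp only [hQc]; rw [if_neg (by omega)]
  have hQc0 : ∀ i j, 0 ≤ Qc i j := fun i j => by simp only [hQc]; split_ifs <;> positivity
  have hX1S : Sm N (fun i j => (X1 N i j : ℝ)) := fun i j h => by
    simp only [X1]; rw [if_neg (by unfold F1; omega)]; simp
  have hX2S : Sm N (fun i j => (X2 N i j : ℝ)) := fun i j h => by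
    simp only [X2]; rw [if_neg (by unfold F2; omega)]; simp
  have pw : ∀ i j, (N:ℝ) * Qc i j ≤ 5 * N * QK i j + ((X1 N (i-1) j - X1 N i j) * Q i j ^2
      + (X2 N i (j-1) - X2 N i j) * Q i j ^2) := by
    intro i j
    simp only [hQc, hQK]
    have hq := sq_nonneg (Q i j)
    by_cases hc : Cell N i j
    · rw [if_pos hc]
      have hd := divX hc
      by_cases hk : (N/12+1 ≤ i ∧ i ≤ N-N/12) ∧ (N/12+1 ≤ j ∧ j ≤ N-N/12)
      · rw [if_pos hk]
        have : X1 N i j - X1 N (i-1) j + X2 N i j - X2 N i (j-1) ≤ 4*N := by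
          have : 0 ≤ max |2*i-N-1| |2*j-N-1| := le_max_of_le_left (abs_nonneg _)
          omega
        have : (X1 N i j - X1 N (i-1) j + X2 N i j - X2 N i (j-1) : ℝ) ≤ 4*N := by exact_mod_cast this
        nlinarith
      · rw [if_neg hk]
        have : X1 N i j - X1 N (i-1) j + X2 N i j - X2 N i (j-1) ≤ -N := by
          simp only [abs_eq_max_neg] at hd
          unfold Cell at hc
          omega
        have : (X1 N i j - X1 N (i-1) j + X2 N i j - X2 N i (j-1) : ℝ) ≤ -N := by exact_mod_cast this
        nlinarith
    · rw [if_neg hc, if_neg (by unfold Cell at hc; omega)]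
      unfold Cell at hc
      simp only [X1, X2]
      rw [if_neg (by unfold F1; omega), if_neg (by unfold F1; omega), if_neg (by unfold F2; omega), if_neg (by unfold F2; omega)]
      simp
  have m := II_mono N _ _ pw
  rw [II_smul, II_add, II_add, II_smul] at m
  have s1 := sbp1 hX1S (fun i j => Q i j ^2)
  have s2 := sbp2 hX2S (fun i j => Q i j ^2)
  rw [← s1, ← s2] at m
  have b1 : II N (fun i j => (X1 N i j : ℝ) * (Q (i+1) j ^2 - Q i j ^2)) ≤
      II N (fun i j => N * ((1/8) * Qc (i+1) j + (1/8) * Qc i j + 4 * ((D1 N i j:ℝ)^2 * G1 N Q i j ^2))) := by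
    apply II_mono; intro i j
    refine (X1_bound hN _ _).trans ?_
    apply mul_le_mul_of_nonneg_left _ hNR.le
    have : (if F1 N i j then Q (i+1) j ^2 + Q i j ^2 else 0) ≤ Qc (i+1) j + Qc i j := by
      split_ifs with h
      · simp only [hQc]
        rw [if_pos (by unfold F1 at h; omega), if_pos (by unfold F1 at h; omega)]
      · exact add_nonneg (hQc0 _ _) (hQc0 _ _)
    unfold G1
    linarith
  have b2 : II N (fun i j => (X2 N i j : ℝ) * (Q i (j+1) ^2 - Q i j ^2)) ≤
      II N (fun i j => N * ((1/8) * Qc i (j+1) + (1/8) * Qc i j + 4 * ((D2 N i j:ℝ)^2 * G2 N Q i j ^2))) := by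
    apply II_mono; intro i j
    refine (X2_bound hN _ _).trans ?_
    apply mul_le_mul_of_nonneg_left _ hNR.le
    have : (if F2 N i j then Q i (j+1) ^2 + Q i j ^2 else 0) ≤ Qc i (j+1) + Qc i j := by
      split_ifs with h
      · simp only [hQc]
        rw [if_pos (by unfold F2 at h; omega), if_pos (by unfold F2 at h; omega)]
      · exact add_nonneg (hQc0 _ _) (hQc0 _ _)
    unfold G2
    linarith
  simp only [II_smul, II_add] at b1 b2
  rw [II_s1 hQcS] at b1
  rw [II_s2 hQcS] at b2
  have fin : (N:ℝ) * II N Qc ≤ N * (5 * II N QK + 1/2 * II N Qc + 4 * SS N Q) := by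
    unfold SS; linarith
  have := le_of_mul_le_mul_left fin hNR
  linarith

lemma poincareK {N : ℤ} (hN : 2 ≤ N) (P : ℤ → ℤ → ℝ) :
    ∃ c : ℝ, ∑ i ∈ Icc (N/12+1) (N-N/12), ∑ j ∈ Icc (N/12+1) (N-N/12), (P i j - c) ^ 2 ≤ 576 * SS N P := by
  have hNR : (0:ℝ) < N := by exact_mod_cast (by omega : 0 < N)
  obtain ⟨a, ha⟩ : ∃ a, a = N/12+1 := ⟨_, rfl⟩
  obtain ⟨b, hb⟩ : ∃ b, b = N-N/12 := ⟨_, rfl⟩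
  rw [← ha, ← hb]
  have hba : ((b:ℝ) - a) ≤ N := by exact_mod_cast (by omega : b - a ≤ N)
  have hcard : ((Icc a b).card : ℝ) = b - a + 1 := by
    rw [Int.card_Icc]
    have : (((b+1-a).toNat : ℤ):ℝ) = ((b+1-a : ℤ):ℝ) := by rw [Int.toNat_of_nonneg (by omega)]
    push_cast at this; rw [this]; ring
  have hc1 : (b:ℝ) - a + 1 ≤ N := by exact_mod_cast (by omega : b - a + 1 ≤ N)
  have hc2 : (N:ℝ) ≤ 2 * ((b:ℝ) - a + 1) := by exact_mod_cast (by omega : N ≤ 2 * (b - a + 1))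
  set u : ℤ → ℝ := fun j => ∑ r ∈ Ico a b, (P (r+1) j - P r j)^2 with hu
  set w : ℤ → ℝ := fun i => ∑ r ∈ Ico a b, (P i (r+1) - P i r)^2 with hw
  have hIco : Ico a b ⊆ Icc (-1) (N+1) := by intro x; simp; omega
  have hIcc : Icc a b ⊆ Icc (-1) (N+1) := by intro x; simp; omega
  have hu' : (N:ℝ)^2 * ∑ j ∈ Icc a b, u j ≤ 144 * II N (fun i j => (D1 N i j : ℝ)^2 * G1 N P i j ^2) := by
    simp only [hu]
    rw [Finset.sum_comm, Finset.mul_sum, ← II_smul]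
    simp only [Finset.mul_sum]
    apply II_sub_le _ _ _ hIco hIcc
    · intros; positivity
    · intro i hi j hj
      simp only [Finset.mem_Ico, Finset.mem_Icc] at hi hj
      have hD : N ≤ 12 * D1 N i j := by
        have : max |2*i-N| |2*j-N-1| ≤ N - (N+11)/12 :=
          max_le (abs_le.mpr ⟨by omega, by omega⟩) (abs_le.mpr ⟨by omega, by omega⟩)
        unfold D1; omega
      have hD' : (N:ℝ) ≤ 12 * D1 N i j := by exact_mod_cast hD
      unfold G1
      rw [if_pos (by unfold F1; omega)]
      have : (N:ℝ)^2 ≤ (12 * D1 N i j)^2 := by gcongr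
      nlinarith [mul_le_mul_of_nonneg_right this (sq_nonneg (P (i+1) j - P i j))]
  have hw' : (N:ℝ)^2 * ∑ i ∈ Icc a b, w i ≤ 144 * II N (fun i j => (D2 N i j : ℝ)^2 * G2 N P i j ^2) := by
    simp only [hw]
    rw [Finset.mul_sum, ← II_smul]
    simp only [Finset.mul_sum]
    apply II_sub_le _ _ _ hIcc hIco
    · intros; positivity
    · intro i hi j hj
      simp only [Finset.mem_Ico, Finset.mem_Icc] at hi hj
      have hD : N ≤ 12 * D2 N i j := by
        have : max |2*i-N-1| |2*j-N| ≤ N - (N+11)/12 :=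
          max_le (abs_le.mpr ⟨by omega, by omega⟩) (abs_le.mpr ⟨by omega, by omega⟩)
        unfold D2; omega
      have hD' : (N:ℝ) ≤ 12 * D2 N i j := by exact_mod_cast hD
      unfold G2
      rw [if_pos (by unfold F2; omega)]
      have : (N:ℝ)^2 ≤ (12 * D2 N i j)^2 := by gcongr
      nlinarith [mul_le_mul_of_nonneg_right this (sq_nonneg (P i (j+1) - P i j))]
  obtain ⟨k, hk, hkmin⟩ := Finset.exists_min_image (Icc a b) w ⟨a, by simp; omega⟩
  have hwk : ((b:ℝ) - a + 1) * w k ≤ ∑ i ∈ Icc a b, w i := by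
    have := Finset.card_nsmul_le_sum (Icc a b) w (w k) hkmin
    rwa [nsmul_eq_mul, hcard] at this
  have hu0 : ∀ j, 0 ≤ u j := fun j => Finset.sum_nonneg fun _ _ => sq_nonneg _
  have hw0 : ∀ j, 0 ≤ w j := fun j => Finset.sum_nonneg fun _ _ => sq_nonneg _
  refine ⟨P k a, ?_⟩
  simp only [Finset.mem_Icc] at hk
  have pw : ∀ i ∈ Icc a b, ∀ j ∈ Icc a b, (P i j - P k a)^2 ≤ 2 * N * u j + 2 * N * w k := by
    intro i hi j hj
    simp only [Finset.mem_Icc] at hi hj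
    have p1 := path1d (fun r => P r j) a b i k hi.1 hi.2 hk.1 hk.2
    have p2 := path1d (fun r => P k r) a b j a hj.1 hj.2 le_rfl (by omega)
    have p1' : (P i j - P k j)^2 ≤ N * u j := p1.trans (mul_le_mul_of_nonneg_right hba (hu0 j))
    have p2' : (P k j - P k a)^2 ≤ N * w k := p2.trans (mul_le_mul_of_nonneg_right hba (hw0 k))
    nlinarith [sq_nonneg ((P i j - P k j) - (P k j - P k a))]
  have hU : 0 ≤ ∑ j ∈ Icc a b, u j := Finset.sum_nonneg fun j _ => hu0 j
  have hc0 : (0:ℝ) ≤ (b:ℝ) - a + 1 := by linarith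
  calc ∑ i ∈ Icc a b, ∑ j ∈ Icc a b, (P i j - P k a)^2
      ≤ ∑ i ∈ Icc a b, ∑ j ∈ Icc a b, (2 * N * u j + 2 * N * w k) :=
        Finset.sum_le_sum fun i hi => Finset.sum_le_sum fun j hj => pw i hi j hj
    _ = ((b:ℝ)-a+1) * (2 * N * ∑ j ∈ Icc a b, u j + ((b:ℝ)-a+1) * (2 * N * w k)) := by
        simp only [Finset.sum_add_distrib, Finset.sum_const, nsmul_eq_mul, hcard, ← Finset.mul_sum]
        ring
    _ ≤ N * (2 * N * ∑ j ∈ Icc a b, u j + 2 * N * ∑ i ∈ Icc a b, w i) := by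
        have : ((b:ℝ)-a+1) * (2 * N * w k) ≤ 2 * N * ∑ i ∈ Icc a b, w i := by
          have := mul_le_mul_of_nonneg_left hwk hNR.le
          linarith
        have h0 : 0 ≤ ((b:ℝ)-a+1) * (2 * N * w k) := by have := hw0 k; positivity
        apply mul_le_mul hc1 (by linarith) (by positivity) hNR.le
    _ ≤ 576 * SS N P := by
        have n1 : 0 ≤ II N (fun i j => (D1 N i j : ℝ)^2 * G1 N P i j ^2) := II_nonneg _ _ fun i j => by positivity
        have n2 : 0 ≤ II N (fun i j => (D2 N i j : ℝ)^2 * G2 N P i j ^2) := II_nonneg _ _ fun i j => by positivity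
        unfold SS; nlinarith

lemma SS_sub_const (N : ℤ) (P : ℤ → ℤ → ℝ) (c : ℝ) : SS N (fun i j => P i j - c) = SS N P := by
  simp [SS, G1, G2]

lemma hardy {N : ℤ} (hN : 2 ≤ N) (P : ℤ → ℤ → ℝ) :
    ∃ c : ℝ, ∑ i ∈ Icc 1 N, ∑ j ∈ Icc 1 N, (P i j - c) ^ 2 ≤ 5768 * SS N P := by
  obtain ⟨c, hc⟩ := poincareK hN P
  refine ⟨c, ?_⟩
  have := hardyX hN (fun i j => P i j - c)
  rw [SS_sub_const] at this
  linarith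
lemma core {N : ℤ} (hN : 2 ≤ N) (p : ℤ → ℤ → ℝ) (B : ℝ) (hB : 0 ≤ B)
    (hp : ∀ z1 z2 : ℤ → ℤ → ℝ, (∀ i j, ¬ F1 N i j → z1 i j = 0) → (∀ i j, ¬ F2 N i j → z2 i j = 0) →
      (II N (fun i j => z1 i j * (p (i+1) j - p i j)) + II N (fun i j => z2 i j * (p i (j+1) - p i j)))^2
        ≤ B * (EE N z1 + EE N z2)) :
    ∃ c : ℝ, ∑ i ∈ Icc 1 N, ∑ j ∈ Icc 1 N, (p i j - c)^2 ≤ 30000000 * B := by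
  obtain ⟨e1, he1, hL1⟩ := solve (N := N) (Icc 1 (N-1) ×ˢ Icc 1 N) (by intro i j; simp; omega)
    (fun i j => -(p (i+1) j - p i j))
  obtain ⟨e2, he2, hL2⟩ := solve (N := N) (Icc 1 N ×ˢ Icc 1 (N-1)) (by intro i j; simp; omega)
    (fun i j => -(p i (j+1) - p i j))
  simp only [Finset.mem_product, Finset.mem_Icc] at he1 he2 hL1 hL2
  have sm1 : ∀ z : ℤ → ℤ → ℝ, (∀ i j, ¬ F1 N i j → z i j = 0) → Sm N z := by
    intro z hz i j h; exact hz i j (by unfold F1; omega)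
  have sm2 : ∀ z : ℤ → ℤ → ℝ, (∀ i j, ¬ F2 N i j → z i j = 0) → Sm N z := by
    intro z hz i j h; exact hz i j (by unfold F2; omega)
  -- testing with a function supported on faces
  have test1 : ∀ z : ℤ → ℤ → ℝ, (∀ i j, ¬ F1 N i j → z i j = 0) →
      II N (fun i j => z i j * (p (i+1) j - p i j)) = - II N (fun i j => z i j * LL e1 i j) := by
    intro z hz
    rw [← neg_one_mul, ← II_smul]; congr 1; funext i j
    by_cases h : F1 N i j
    · rw [hL1 i j h]; ring
    · rw [hz i j h]; ring
  have test2 : ∀ z : ℤ → ℤ → ℝ, (∀ i j, ¬ F2 N i j → z i j = 0) →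
      II N (fun i j => z i j * (p i (j+1) - p i j)) = - II N (fun i j => z i j * LL e2 i j) := by
    intro z hz
    rw [← neg_one_mul, ← II_smul]; congr 1; funext i j
    by_cases h : F2 N i j
    · rw [hL2 i j h]; ring
    · rw [hz i j h]; ring
  have EEnn : ∀ z, 0 ≤ EE N z := fun z => II_nonneg _ _ fun i j => by positivity
  -- energy bound for e
  have hE : EE N e1 + EE N e2 ≤ B := by
    have h := hp e1 e2 he1 he2
    rw [test1 e1 he1, test2 e2 he2, green_self (sm1 e1 he1), green_self (sm2 e2 he2)] at h
    have h1 := EEnn e1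
    have h2 := EEnn e2
    by_contra hc
    push Not at hc
    have : 0 < EE N e1 + EE N e2 := by linarith
    nlinarith
  -- divergence
  set d : ℤ → ℤ → ℝ := fun i j => e1 i j - e1 (i-1) j + (e2 i j - e2 i (j-1)) with hd
  set P : ℤ → ℤ → ℝ := fun i j => p i j - d i j with hP
  have harm : ∀ i j, 2 ≤ i → i ≤ N-1 → 2 ≤ j → j ≤ N-1 → LL P i j = 0 := by
    intro i j h1 h2 h3 h4
    have a1 := hL1 i j (by omega)
    have a2 := hL1 (i-1) j (by omega)
    have a3 := hL2 i j (by omega)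
    have a4 := hL2 i (j-1) (by omega)
    simp only [LL, hP, hd] at *
    simp only [sub_add_cancel, add_sub_cancel_right] at *
    have r1 : i + 1 - 1 = i := by ring
    have r2 : i - 1 + 1 = i := by ring
    have r3 : j + 1 - 1 = j := by ring
    have r4 : j - 1 + 1 = j := by ring
    linarith
  set z1 : ℤ → ℤ → ℝ := fun i j => (D1 N i j : ℝ)^2 * G1 N P i j with hz1
  set z2 : ℤ → ℤ → ℝ := fun i j => (D2 N i j : ℝ)^2 * G2 N P i j with hz2
  have hG1 : ∀ i j, ¬ F1 N i j → G1 N P i j = 0 := fun i j h => by simp only [G1]; rw [if_neg h]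
  have hG2 : ∀ i j, ¬ F2 N i j → G2 N P i j = 0 := fun i j h => by simp only [G2]; rw [if_neg h]
  have hz1s : ∀ i j, ¬ F1 N i j → z1 i j = 0 := fun i j h => by simp only [hz1]; rw [hG1 i j h, mul_zero]
  have hz2s : ∀ i j, ¬ F2 N i j → z2 i j = 0 := fun i j h => by simp only [hz2]; rw [hG2 i j h, mul_zero]
  have w1 : EE N z1 ≤ 256 * II N (fun i j => (D1 N i j : ℝ)^2 * G1 N P i j ^2) := by
    apply weighted (D := fun i j => (D1 N i j : ℝ)) (sm1 _ hG1)
    · intro i j h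
      have : F1 N i j := by by_contra hc; exact h (hG1 i j hc)
      exact_mod_cast D1_pos this
    · intro i j
      have : |D1 N (i+1) j - D1 N i j| ≤ 2 := by
        rw [abs_le]
        unfold D1; simp only [abs_eq_max_neg]; omega
      exact_mod_cast this
    · intro i j
      have : |D1 N i (j+1) - D1 N i j| ≤ 2 := by
        rw [abs_le]
        unfold D1; simp only [abs_eq_max_neg]; omega
      exact_mod_cast this
    · intro i j
      by_cases h : F1 N i j
      · right
        by_cases hc : D1 N i j ≤ 2
        · left; exact_mod_cast hc
        · right
          have hb : 2 ≤ i ∧ i ≤ N-2 ∧ 2 ≤ j ∧ j ≤ N-1 := by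
            have q1 : max |2*i-N| |2*j-N-1| < N - 2 := by unfold D1 at hc; omega
            rw [max_lt_iff, abs_lt, abs_lt] at q1
            omega
          have k1 := harm i j (by omega) (by omega) (by omega) (by omega)
          have k2 := harm (i+1) j (by omega) (by omega) (by omega) (by omega)
          simp only [LL] at *
          simp only [G1]
          rw [if_pos (by unfold F1; omega), if_pos (by unfold F1; omega), if_pos (by unfold F1; omega),
            if_pos (by unfold F1; omega), if_pos (by unfold F1; omega)]
          rw [show i + 1 - 1 = i by ring] at k2
          rw [show i - 1 + 1 = i by ring]
          linarith
      · left; exact hG1 i j h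
  have w2 : EE N z2 ≤ 256 * II N (fun i j => (D2 N i j : ℝ)^2 * G2 N P i j ^2) := by
    apply weighted (D := fun i j => (D2 N i j : ℝ)) (sm2 _ hG2)
    · intro i j h
      have : F2 N i j := by by_contra hc; exact h (hG2 i j hc)
      exact_mod_cast D2_pos this
    · intro i j
      have : |D2 N (i+1) j - D2 N i j| ≤ 2 := by
        rw [abs_le]
        unfold D2; simp only [abs_eq_max_neg]; omega
      exact_mod_cast this
    · intro i j
      have : |D2 N i (j+1) - D2 N i j| ≤ 2 := by
        rw [abs_le]
        unfold D2; simp only [abs_eq_max_neg]; omega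
      exact_mod_cast this
    · intro i j
      by_cases h : F2 N i j
      · right
        by_cases hc : D2 N i j ≤ 2
        · left; exact_mod_cast hc
        · right
          have hb : 2 ≤ i ∧ i ≤ N-1 ∧ 2 ≤ j ∧ j ≤ N-2 := by
            have q1 : max |2*i-N-1| |2*j-N| < N - 2 := by unfold D2 at hc; omega
            rw [max_lt_iff, abs_lt, abs_lt] at q1
            omega
          have k1 := harm i j (by omega) (by omega) (by omega) (by omega)
          have k2 := harm i (j+1) (by omega) (by omega) (by omega) (by omega)
          simp only [LL] at *
          simp only [G2]
          rw [if_pos (by unfold F2; omega), if_pos (by unfold F2; omega), if_pos (by unfold F2; omega),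
            if_pos (by unfold F2; omega), if_pos (by unfold F2; omega)]
          rw [show j + 1 - 1 = j by ring] at k2
          rw [show j - 1 + 1 = j by ring]
          linarith
      · left; exact hG2 i j h
  have hw : EE N z1 + EE N z2 ≤ 256 * SS N P := by unfold SS; linarith
  -- divergence bound
  have divb : ∀ x y : ℤ → ℤ → ℝ, Sm N x → Sm N y →
      II N (fun i j => (x i j - x (i-1) j + (y i j - y i (j-1)))^2) ≤ 2 * (EE N x + EE N y) := by
    intro x y hx hy
    have t1 : II N (fun i j => (x i j - x (i-1) j)^2) ≤ EE N x := by
      have a1 := II_s1' (hx.mul_right (fun i j => x (i+1) j))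
      have a2 := II_s1' (hx.mul_right x)
      have a3 := II_s1 (hx.mul_right x)
      simp only [sub_add_cancel] at a1
      have : II N (fun i j => (x i j - x (i-1) j)^2) = II N (fun i j => (x (i+1) j - x i j)^2) := by
        have g1 : (fun i j => (x i j - x (i-1) j)^2) = fun i j => x i j * x i j + x (i-1) j * x (i-1) j - 2 * (x (i-1) j * x i j) := by
          funext i j; ring
        have g2 : (fun i j => (x (i+1) j - x i j)^2) = fun i j => x i j * x i j + x (i+1) j * x (i+1) j - 2 * (x i j * x (i+1) j) := by
          funext i j; ring
        rw [g1, g2, II_sub, II_sub, II_add, II_add, II_smul, II_smul, a1, a2, a3]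
      rw [this]
      exact II_mono _ _ _ fun i j => by nlinarith [sq_nonneg (x i (j+1) - x i j)]
    have t2 : II N (fun i j => (y i j - y i (j-1))^2) ≤ EE N y := by
      have a1 := II_s2' (hy.mul_right (fun i j => y i (j+1)))
      have a2 := II_s2' (hy.mul_right y)
      have a3 := II_s2 (hy.mul_right y)
      simp only [sub_add_cancel] at a1
      have : II N (fun i j => (y i j - y i (j-1))^2) = II N (fun i j => (y i (j+1) - y i j)^2) := by
        have g1 : (fun i j => (y i j - y i (j-1))^2) = fun i j => y i j * y i j + y i (j-1) * y i (j-1) - 2 * (y i (j-1) * y i j) := by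
          funext i j; ring
        have g2 : (fun i j => (y i (j+1) - y i j)^2) = fun i j => y i j * y i j + y i (j+1) * y i (j+1) - 2 * (y i j * y i (j+1)) := by
          funext i j; ring
        rw [g1, g2, II_sub, II_sub, II_add, II_add, II_smul, II_smul, a1, a2, a3]
      rw [this]
      exact II_mono _ _ _ fun i j => by nlinarith [sq_nonneg (y (i+1) j - y i j)]
    have : II N (fun i j => (x i j - x (i-1) j + (y i j - y i (j-1)))^2) ≤
        II N (fun i j => 2 * (x i j - x (i-1) j)^2 + 2 * (y i j - y i (j-1))^2) :=
      II_mono _ _ _ fun i j => by nlinarith [sq_nonneg ((x i j - x (i-1) j) - (y i j - y i (j-1)))]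
    rw [II_add, II_smul, II_smul] at this
    linarith
  have dz := divb z1 z2 (sm1 _ hz1s) (sm2 _ hz2s)
  have de := divb e1 e2 (sm1 _ he1) (sm2 _ he2)
  -- the test identity
  have hS1 : II N (fun i j => (D1 N i j : ℝ)^2 * G1 N P i j ^2) =
      II N (fun i j => z1 i j * (p (i+1) j - p i j)) - II N (fun i j => z1 i j * (d (i+1) j - d i j)) := by
    rw [← II_sub]; congr 1; funext i j
    simp only [hz1, G1]
    split_ifs with h
    · simp only [hP]; ring
    · ring
  have hS2 : II N (fun i j => (D2 N i j : ℝ)^2 * G2 N P i j ^2) =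
      II N (fun i j => z2 i j * (p i (j+1) - p i j)) - II N (fun i j => z2 i j * (d i (j+1) - d i j)) := by
    rw [← II_sub]; congr 1; funext i j
    simp only [hz2, G2]
    split_ifs with h
    · simp only [hP]; ring
    · ring
  have hS : SS N P = - II N (fun i j => (z1 (i+1) j - z1 i j) * (e1 (i+1) j - e1 i j)
        + (z1 i (j+1) - z1 i j) * (e1 i (j+1) - e1 i j))
      - II N (fun i j => (z2 (i+1) j - z2 i j) * (e2 (i+1) j - e2 i j)
        + (z2 i (j+1) - z2 i j) * (e2 i (j+1) - e2 i j))
      + II N (fun i j => (z1 i j - z1 (i-1) j + (z2 i j - z2 i (j-1))) * d i j) := by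
    have : II N (fun i j => (z1 i j - z1 (i-1) j + (z2 i j - z2 i (j-1))) * d i j) =
       - (II N (fun i j => (z1 (i-1) j - z1 i j) * d i j) + II N (fun i j => (z2 i (j-1) - z2 i j) * d i j)) := by
      rw [← II_add, ← neg_one_mul, ← II_smul]; congr 1; funext i j; ring
    unfold SS
    rw [hS1, hS2, test1 z1 hz1s, test2 z2 hz2s, green (sm1 _ hz1s), green (sm2 _ hz2s),
      sbp1 (sm1 _ hz1s), sbp2 (sm2 _ hz2s), this]
    ring
  have young : ∀ x y : ℝ, |x * y| ≤ (1/1536) * x^2 + 384 * y^2 := by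
    intro x y
    rw [abs_le]; constructor <;> nlinarith [sq_nonneg (x + 768 * y), sq_nonneg (x - 768*y)]
  have bnd : ∀ z e : ℤ → ℤ → ℝ, - II N (fun i j => (z (i+1) j - z i j) * (e (i+1) j - e i j)
        + (z i (j+1) - z i j) * (e i (j+1) - e i j)) ≤ (1/1536) * EE N z + 384 * EE N e := by
    intro z e
    unfold EE
    rw [← neg_one_mul, ← II_smul, ← II_smul, ← II_smul, ← II_add]
    apply II_mono; intro i j
    have y1 := abs_le.mp (young (z (i+1) j - z i j) (e (i+1) j - e i j))
    have y2 := abs_le.mp (young (z i (j+1) - z i j) (e i (j+1) - e i j))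
    linarith [y1.1, y2.1]
  have bd : II N (fun i j => (z1 i j - z1 (i-1) j + (z2 i j - z2 i (j-1))) * d i j) ≤
      (1/1536) * II N (fun i j => (z1 i j - z1 (i-1) j + (z2 i j - z2 i (j-1)))^2)
        + 384 * II N (fun i j => d i j ^ 2) := by
    rw [← II_smul, ← II_smul, ← II_add]
    apply II_mono; intro i j
    exact (abs_le.mp (young _ _)).2
  have b1 := bnd z1 e1
  have b2 := bnd z2 e2
  have de' : II N (fun i j => d i j ^2) ≤ 2 * (EE N e1 + EE N e2) := de
  have hSB : SS N P ≤ 2304 * B := by linarith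
  obtain ⟨c, hc⟩ := hardy hN P
  refine ⟨c, ?_⟩
  have hdsum : ∑ i ∈ Icc 1 N, ∑ j ∈ Icc 1 N, d i j ^2 ≤ II N (fun i j => d i j ^2) :=
    II_sub_le _ _ _ (Finset.Icc_subset_Icc (by omega) (by omega)) (Finset.Icc_subset_Icc (by omega) (by omega)) _ _
      (fun i j => sq_nonneg _) (fun _ _ _ _ => le_rfl)
  calc ∑ i ∈ Icc 1 N, ∑ j ∈ Icc 1 N, (p i j - c)^2
      ≤ ∑ i ∈ Icc 1 N, ∑ j ∈ Icc 1 N, (2 * (P i j - c)^2 + 2 * d i j ^2) := by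
        refine Finset.sum_le_sum fun i _ => Finset.sum_le_sum fun j _ => ?_
        simp only [hP]
        nlinarith [sq_nonneg ((p i j - d i j - c) - d i j)]
    _ = 2 * ∑ i ∈ Icc 1 N, ∑ j ∈ Icc 1 N, (P i j - c)^2 + 2 * ∑ i ∈ Icc 1 N, ∑ j ∈ Icc 1 N, d i j ^2 := by
        simp only [Finset.sum_add_distrib, Finset.mul_sum]
    _ ≤ _ := by linarith

lemma II_cs (N : ℤ) (x y : ℤ → ℤ → ℝ) :
    (II N (fun i j => x i j * y i j))^2 ≤ II N (fun i j => x i j ^2) * II N (fun i j => y i j ^2) := by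
  unfold II
  simp only [← Finset.sum_product']
  exact Finset.sum_mul_sq_le_sq_mul_sq _ _ _

lemma poinc_s9 {N : ℤ} (hN : 2 ≤ N) (z : ℤ → ℤ → ℝ) (hz : ∀ i j, ¬ F1 N i j → z i j = 0) :
    II N (fun i j => z i j ^2) ≤ (N:ℝ)^2 * EE N z := by
  have e : (fun i j => z i j ^2) = fun i j => if (1 ≤ i ∧ i ≤ N) ∧ (1 ≤ j ∧ j ≤ N) then z i j ^2 else 0 := by
    funext i j
    split_ifs with h
    · rfl
    · rw [hz i j (by unfold F1; omega)]; simp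
  rw [e, II_rect _ _ _ _ _ (by omega) (by omega) (by omega) (by omega)]
  have hNR : (0:ℝ) ≤ N := by exact_mod_cast (by omega : 0 ≤ N)
  have pw : ∀ i ∈ Icc 1 N, ∀ j ∈ Icc 1 N, z i j ^2 ≤ N * ∑ r ∈ Ico 0 N, (z (r+1) j - z r j)^2 := by
    intro i hi j hj
    simp only [Finset.mem_Icc] at hi
    have := path1d (fun r => z r j) 0 N i 0 (by omega) (by omega) (by omega) (by omega)
    rw [hz 0 j (by unfold F1; omega)] at this
    simpa using this
  have hc : ((Icc 1 N).card : ℝ) = N := by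
    rw [Int.card_Icc]
    have : (((N+1-1).toNat : ℤ):ℝ) = ((N:ℤ):ℝ) := by rw [Int.toNat_of_nonneg (by omega)]; simp
    exact_mod_cast this
  calc ∑ i ∈ Icc 1 N, ∑ j ∈ Icc 1 N, z i j ^2
      ≤ ∑ i ∈ Icc 1 N, ∑ j ∈ Icc 1 N, N * ∑ r ∈ Ico 0 N, (z (r+1) j - z r j)^2 :=
        Finset.sum_le_sum fun i hi => Finset.sum_le_sum fun j hj => pw i hi j hj
    _ = (N:ℝ)^2 * ∑ r ∈ Ico 0 N, ∑ j ∈ Icc 1 N, (z (r+1) j - z r j)^2 := by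
        rw [Finset.sum_const, nsmul_eq_mul, hc, ← Finset.mul_sum, Finset.sum_comm]; ring
    _ ≤ (N:ℝ)^2 * EE N z := by
        gcongr
        apply II_sub_le
        · intro x; simp; omega
        · intro x; simp; omega
        · intros; positivity
        · intro i _ j _
          nlinarith [sq_nonneg (z i (j+1) - z i j)]

lemma sum_toNat (a b : ℕ) (f : ℕ → ℝ) :
    ∑ i ∈ Icc (a:ℤ) (b:ℤ), f i.toNat = ∑ i ∈ Icc a b, f i := by
  refine Finset.sum_nbij' (fun i => i.toNat) (fun i => (i:ℤ)) ?_ ?_ ?_ ?_ ?_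
  all_goals intro x; simp only [Finset.mem_Icc]; try omega
  intro _; trivial

set_option maxHeartbeats 2000000 in
lemma comp {n : ℕ} (hn : 2 ≤ n) (e R p : ℕ → ℕ → ℝ)
    (heq : ∀ i ∈ Icc 1 (n-1), ∀ j ∈ Icc 1 n, -lap n e i j + d1pM n p i j = R i j)
    (z : ℤ → ℤ → ℝ) (hz : ∀ i j, ¬ F1 n i j → z i j = 0) :
    (II n (fun i j => z i j * (p (i+1).toNat j.toNat - p i.toNat j.toNat)))^2 ≤
      8 * (n:ℝ)^2 * (innerM n (d1V1 n e) (d1V1 n e) + innerW1 n (d2V1 n e) (d2V1 n e) + innerV1 n R R) * EE n z := by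
  have hnR : (0:ℝ) < n := by exact_mod_cast (by omega : 0 < n)
  have hSm : Sm n z := by
    intro i j h; exact hz i j (by unfold F1; omega)
  set E : ℤ → ℤ → ℝ := fun i j => e i.toNat j.toNat with hEdef
  set r : ℤ → ℤ → ℝ := fun i j => if (1 ≤ i ∧ i ≤ ((n-1:ℕ):ℤ)) ∧ (1 ≤ j ∧ j ≤ (n:ℤ)) then R i.toNat j.toNat else 0 with hr
  set M1 : ℤ → ℤ → ℝ := fun i j => if (0 ≤ i ∧ i ≤ ((n-1:ℕ):ℤ)) ∧ (1 ≤ j ∧ j ≤ (n:ℤ)) then E (i+1) j - E i j else 0 with hM1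
  set M2 : ℤ → ℤ → ℝ := fun i j => if (1 ≤ i ∧ i ≤ ((n-1:ℕ):ℤ)) ∧ (0 ≤ j ∧ j ≤ (n:ℤ)) then E i (j+1) - E i j else 0 with hM2
  have id1 : II n (fun i j => z i j * (p (i+1).toNat j.toNat - p i.toNat j.toNat)) =
      (1/(n:ℝ)) * II n (fun i j => z i j * r i j) + (-(n:ℝ)) * II n (fun i j => z i j * LL E i j) := by
    rw [← II_smul, ← II_smul, ← II_add]
    congr 1; funext i j
    by_cases h : F1 n i j
    · have hh := heq i.toNat (by simp; unfold F1 at h; omega) j.toNat (by simp; unfold F1 at h; omega)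
      simp only [hr, LL, hEdef]
      rw [if_pos (by unfold F1 at h; omega)]
      unfold F1 at h
      rw [show (i+1).toNat = i.toNat + 1 by omega, show (i-1).toNat = i.toNat - 1 by omega,
        show (j+1).toNat = j.toNat + 1 by omega, show (j-1).toNat = j.toNat - 1 by omega, ← hh]
      simp only [lap, d1pM, gh]
      field_simp
      ring
    · rw [hz i j h]; simp
  have id2 : II n (fun i j => z i j * LL E i j) =
      II n (fun i j => (z (i+1) j - z i j) * M1 i j) + II n (fun i j => (z i (j+1) - z i j) * M2 i j) := by
    rw [green hSm, ← II_add]; congr 1; funext i j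
    congr 1
    · simp only [hM1]
      split_ifs with h
      · rfl
      · rw [hz i j (by unfold F1; omega), hz (i+1) j (by unfold F1; omega)]; simp
    · simp only [hM2]
      split_ifs with h
      · rfl
      · rw [hz i j (by unfold F1; omega), hz i (j+1) (by unfold F1; omega)]; simp
  have sr : II n (fun i j => r i j ^2) = (n:ℝ)^2 * innerV1 n R R := by
    have : (fun i j => r i j ^2) = fun i j => if (((1:ℕ):ℤ) ≤ i ∧ i ≤ ((n-1:ℕ):ℤ)) ∧ (((1:ℕ):ℤ) ≤ j ∧ j ≤ (n:ℤ)) then R i.toNat j.toNat ^ 2 else 0 := by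
      funext i j; simp only [hr, Nat.cast_one]; split_ifs <;> simp
    rw [this, II_rect _ _ _ _ _ (by omega) (by omega) (by omega) (by omega)]
    rw [sum_toNat 1 (n-1) (fun i => ∑ j ∈ Icc ((1:ℕ):ℤ) (n:ℤ), R i j.toNat ^2)]
    rw [Finset.sum_congr rfl fun i _ => sum_toNat 1 n (fun j => R i j ^2)]
    unfold innerV1 gh
    simp only [sq]
    field_simp
  have s1 : II n (fun i j => M1 i j ^2) = innerM n (d1V1 n e) (d1V1 n e) := by
    have : (fun i j => M1 i j ^2) = fun i j => if (0 ≤ i ∧ i ≤ ((n-1:ℕ):ℤ)) ∧ (((1:ℕ):ℤ) ≤ j ∧ j ≤ (n:ℤ)) then (e (i+1).toNat j.toNat - e i.toNat j.toNat) ^ 2 else 0 := by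
      funext i j; simp only [hM1, Nat.cast_one]; split_ifs <;> simp [hEdef]
    rw [this, II_rect _ _ _ _ _ (by omega) (by omega) (by omega) (by omega)]
    rw [Finset.sum_congr rfl fun (i:ℤ) _ => sum_toNat 1 n (fun j => (e (i+1).toNat j - e i.toNat j)^2)]
    unfold innerM d1V1 gh
    rw [Finset.mul_sum]
    refine Finset.sum_nbij' (fun i => (i+1).toNat) (fun k => (k:ℤ) - 1) ?_ ?_ ?_ ?_ ?_
    · intro x; simp only [Finset.mem_Icc]; omega
    · intro x; simp only [Finset.mem_Icc]; omega
    · intro x; simp only [Finset.mem_Icc]; omega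
    · intro x; simp only [Finset.mem_Icc]; omega
    · intro x hx
      simp only [Finset.mem_Icc] at hx
      rw [Finset.mul_sum]
      apply Finset.sum_congr rfl; intro j _
      rw [show (x+1).toNat - 1 = x.toNat by omega]
      field_simp
  have s2 : II n (fun i j => M2 i j ^2) ≤ 2 * innerW1 n (d2V1 n e) (d2V1 n e) := by
    have : (fun i j => M2 i j ^2) = fun i j => if (((1:ℕ):ℤ) ≤ i ∧ i ≤ ((n-1:ℕ):ℤ)) ∧ (((0:ℕ):ℤ) ≤ j ∧ j ≤ (n:ℤ)) then (e i.toNat (j.toNat+1) - e i.toNat j.toNat) ^ 2 else 0 := by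
      funext i j; simp only [hM2, Nat.cast_one, Nat.cast_zero]; split_ifs with h
      · simp only [hEdef]; rw [show (j+1).toNat = j.toNat+1 by omega]
      · simp
    rw [this, II_rect _ _ _ _ _ (by omega) (by omega) (by omega) (by omega)]
    rw [sum_toNat 1 (n-1) (fun i => ∑ j ∈ Icc ((0:ℕ):ℤ) (n:ℤ), (e i (j.toNat+1) - e i j.toNat) ^2)]
    rw [Finset.sum_congr rfl fun i _ => sum_toNat 0 n (fun j => (e i (j+1) - e i j)^2)]
    unfold innerW1 d2V1 gh
    rw [Finset.mul_sum, Finset.mul_sum]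
    apply Finset.sum_le_sum; intro i _
    rw [Finset.mul_sum, Finset.mul_sum]
    apply Finset.sum_le_sum; intro j _
    have hrho : 1/2 ≤ rho n j := by unfold rho; split_ifs <;> norm_num
    have : 2 * ((1 / (n:ℝ)) ^ 2 * (rho n j * ((e i (j + 1) - e i j) / (1 / (n:ℝ)) * ((e i (j + 1) - e i j) / (1 / (n:ℝ))))))
      = 2 * rho n j * (e i (j+1) - e i j)^2 := by field_simp
    rw [this]
    nlinarith [sq_nonneg (e i (j+1) - e i j)]
  have EEnn : 0 ≤ EE n z := II_nonneg _ _ fun i j => by positivity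
  have c0 := II_cs n z r
  have c1 := II_cs n (fun i j => z (i+1) j - z i j) M1
  have c2 := II_cs n (fun i j => z i (j+1) - z i j) M2
  have z1 : II n (fun i j => (z (i+1) j - z i j)^2) ≤ EE n z :=
    II_mono _ _ _ fun i j => by nlinarith [sq_nonneg (z i (j+1) - z i j)]
  have z2 : II n (fun i j => (z i (j+1) - z i j)^2) ≤ EE n z :=
    II_mono _ _ _ fun i j => by nlinarith [sq_nonneg (z (i+1) j - z i j)]
  have z0 := poinc_s9 (N := n) (by exact_mod_cast hn) z hz
  have m0 : 0 ≤ II n (fun i j => r i j ^2) := II_nonneg _ _ fun i j => sq_nonneg _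
  have m1 : 0 ≤ II n (fun i j => M1 i j ^2) := II_nonneg _ _ fun i j => sq_nonneg _
  have m2 : 0 ≤ II n (fun i j => M2 i j ^2) := II_nonneg _ _ fun i j => sq_nonneg _
  rw [id1, id2]
  set x0 := II n (fun i j => z i j * r i j)
  set x1 := II n (fun i j => (z (i+1) j - z i j) * M1 i j)
  set x2 := II n (fun i j => (z i (j+1) - z i j) * M2 i j)
  have c0' : x0^2 ≤ ((n:ℝ)^2 * EE n z) * ((n:ℝ)^2 * innerV1 n R R) := by
    rw [← sr]; refine c0.trans (mul_le_mul_of_nonneg_right ?_ m0); simpa using z0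
  have c1' : x1^2 ≤ EE n z * innerM n (d1V1 n e) (d1V1 n e) := by
    rw [← s1]; exact c1.trans (mul_le_mul_of_nonneg_right z1 m1)
  have c2' : x2^2 ≤ EE n z * (2 * innerW1 n (d2V1 n e) (d2V1 n e)) :=
    c2.trans (mul_le_mul z2 s2 m2 EEnn)
  rw [sr] at m0
  rw [s1] at m1
  have hV : 0 ≤ innerV1 n R R := by
    have : (0:ℝ) < (n:ℝ)^2 := by positivity
    nlinarith
  have d0 : (1/(n:ℝ) * x0)^2 ≤ (n:ℝ)^2 * (EE n z * innerV1 n R R) := by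
    rw [mul_pow, div_pow, one_pow, div_mul_eq_mul_div, one_mul, div_le_iff₀ (by positivity)]
    linarith
  have d12 : (-(n:ℝ) * (x1+x2))^2 ≤ (n:ℝ)^2 * (2 * (EE n z * innerM n (d1V1 n e) (d1V1 n e)) + 4 * (EE n z * innerW1 n (d2V1 n e) (d2V1 n e))) := by
    rw [mul_pow, neg_sq]
    gcongr
    nlinarith [sq_nonneg (x1-x2)]
  have e1 : 0 ≤ (n:ℝ)^2 * (EE n z * innerV1 n R R) := by positivity
  have e2 : 0 ≤ (n:ℝ)^2 * (EE n z * innerM n (d1V1 n e) (d1V1 n e)) := by positivity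
  nlinarith [sq_nonneg (1/(n:ℝ) * x0 - (-(n:ℝ) * (x1+x2)))]

lemma II_swap (N : ℤ) (f : ℤ → ℤ → ℝ) : II N (fun i j => f j i) = II N f := by
  unfold II; exact Finset.sum_comm

lemma comp2 {n : ℕ} (hn : 2 ≤ n) (e R p : ℕ → ℕ → ℝ)
    (heq : ∀ i ∈ Icc 1 n, ∀ j ∈ Icc 1 (n-1), -lap n e i j + d2pM n p i j = R i j)
    (z : ℤ → ℤ → ℝ) (hz : ∀ i j, ¬ F2 n i j → z i j = 0) :
    (II n (fun i j => z i j * (p i.toNat (j+1).toNat - p i.toNat j.toNat)))^2 ≤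
      8 * (n:ℝ)^2 * (innerM n (d2V2 n e) (d2V2 n e) + innerW2 n (d1V2 n e) (d1V2 n e) + innerV2 n R R) * EE n z := by
  have h := comp hn (fun i j => e j i) (fun i j => R j i) (fun i j => p j i)
    (by
      intro i hi j hj
      rw [← heq j hj i hi]
      simp only [lap, d1pM, d2pM]
      ring)
    (fun i j => z j i) (by intro i j h; exact hz j i (by unfold F1 at h; unfold F2; omega))
  have a1 : innerM n (d1V1 n (fun i j => e j i)) (d1V1 n (fun i j => e j i)) = innerM n (d2V2 n e) (d2V2 n e) := by
    unfold innerM d1V1 d2V2; rw [Finset.sum_comm]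
  have a2 : innerW1 n (d2V1 n (fun i j => e j i)) (d2V1 n (fun i j => e j i)) = innerW2 n (d1V2 n e) (d1V2 n e) := by
    unfold innerW1 innerW2 d2V1 d1V2; rw [Finset.sum_comm]
  have a3 : innerV1 n (fun i j => R j i) (fun i j => R j i) = innerV2 n R R := by
    unfold innerV1 innerV2; rw [Finset.sum_comm]
  have a4 : EE n (fun i j => z j i) = EE n z := by
    unfold EE; rw [← II_swap]; congr 1; funext i j; ring
  rw [a1, a2, a3, a4, II_swap n (fun i j => z i j * (p i.toNat (j+1).toNat - p i.toNat j.toNat))] at h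
  exact h

/-- discrete pressure stability:
`‖e_p‖_M ≤ C (|e|₁ + ‖R¹‖_{V¹} + ‖R²‖_{V²})` with `C` independent of `N`, assuming only
the two discrete momentum equations. -/
theorem discrete_pressure_stability :
    ∃ C : ℝ, 0 < C ∧ ∀ N : ℕ, 2 ≤ N →
      ∀ e1 e2 ep R1 R2 : ℕ → ℕ → ℝ,
        inV1 N e1 → inV2 N e2 → inM N ep →
        (∀ i ∈ Icc 1 (N-1), ∀ j ∈ Icc 1 N, -lap N e1 i j + d1pM N ep i j = R1 i j) →
        (∀ i ∈ Icc 1 N, ∀ j ∈ Icc 1 (N-1), -lap N e2 i j + d2pM N ep i j = R2 i j) →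
        Real.sqrt (innerM N ep ep)
          ≤ C * (H1semi N e1 e2 + Real.sqrt (innerV1 N R1 R1)
              + Real.sqrt (innerV2 N R2 R2)) := by
  refine ⟨30000, by norm_num, ?_⟩
  intro n hn e1 e2 ep R1 R2 _ _ hM hm1 hm2
  have hnR : (0:ℝ) < n := by exact_mod_cast (by omega : 0 < n)
  have rho0 : ∀ j, 0 ≤ rho n j := fun j => by unfold rho; split_ifs <;> norm_num
  have nM : ∀ q, 0 ≤ innerM n q q := fun q => mul_nonneg (sq_nonneg _)
    (Finset.sum_nonneg fun i _ => Finset.sum_nonneg fun j _ => mul_self_nonneg _)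
  have nV1 : ∀ q, 0 ≤ innerV1 n q q := fun q => mul_nonneg (sq_nonneg _)
    (Finset.sum_nonneg fun i _ => Finset.sum_nonneg fun j _ => mul_self_nonneg _)
  have nV2 : ∀ q, 0 ≤ innerV2 n q q := fun q => mul_nonneg (sq_nonneg _)
    (Finset.sum_nonneg fun i _ => Finset.sum_nonneg fun j _ => mul_self_nonneg _)
  have nW1 : ∀ q, 0 ≤ innerW1 n q q := fun q => mul_nonneg (sq_nonneg _)
    (Finset.sum_nonneg fun i _ => Finset.sum_nonneg fun j _ => mul_nonneg (rho0 _) (mul_self_nonneg _))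
  have nW2 : ∀ q, 0 ≤ innerW2 n q q := fun q => mul_nonneg (sq_nonneg _)
    (Finset.sum_nonneg fun i _ => Finset.sum_nonneg fun j _ => mul_nonneg (rho0 _) (mul_self_nonneg _))
  set T : ℝ := H1semisq n e1 e2 + innerV1 n R1 R1 + innerV2 n R2 R2 with hT
  have hH : 0 ≤ H1semisq n e1 e2 := by
    unfold H1semisq
    linarith [nM (d1V1 n e1), nW1 (d2V1 n e1), nW2 (d1V2 n e2), nM (d2V2 n e2)]
  have hT0 : 0 ≤ T := by linarith [nV1 R1, nV2 R2]
  obtain ⟨c, hc⟩ := core (N := (n:ℤ)) (by exact_mod_cast hn) (fun i j => ep i.toNat j.toNat)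
    (16 * (n:ℝ)^2 * T) (by positivity) (by
      intro z1 z2 hz1 hz2
      have h1 := comp hn e1 R1 ep hm1 z1 hz1
      have h2 := comp2 hn e2 R2 ep hm2 z2 hz2
      have E1 : 0 ≤ EE n z1 := II_nonneg _ _ fun i j => by positivity
      have E2 : 0 ≤ EE n z2 := II_nonneg _ _ fun i j => by positivity
      have t1 : innerM n (d1V1 n e1) (d1V1 n e1) + innerW1 n (d2V1 n e1) (d2V1 n e1) + innerV1 n R1 R1 ≤ T := by
        rw [hT]; unfold H1semisq
        linarith [nW2 (d1V2 n e2), nM (d2V2 n e2), nV2 R2]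
      have t2 : innerM n (d2V2 n e2) (d2V2 n e2) + innerW2 n (d1V2 n e2) (d1V2 n e2) + innerV2 n R2 R2 ≤ T := by
        rw [hT]; unfold H1semisq
        linarith [nW1 (d2V1 n e1), nM (d1V1 n e1), nV1 R1]
      have h1' := h1.trans (mul_le_mul_of_nonneg_right (mul_le_mul_of_nonneg_left t1 (by positivity : 0 ≤ 8 * (n:ℝ)^2)) E1)
      have h2' := h2.trans (mul_le_mul_of_nonneg_right (mul_le_mul_of_nonneg_left t2 (by positivity : 0 ≤ 8 * (n:ℝ)^2)) E2)
      refine (add_sq_le (R := ℝ)).trans ?_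
      linarith)
  have conv : ∀ f : ℕ → ℕ → ℝ, ∑ i ∈ Icc (1:ℤ) n, ∑ j ∈ Icc (1:ℤ) n, f i.toNat j.toNat = ∑ i ∈ Icc 1 n, ∑ j ∈ Icc 1 n, f i j := by
    intro f
    have a := sum_toNat 1 n (fun i => ∑ j ∈ Icc (1:ℤ) n, f i j.toNat)
    simp only [Nat.cast_one] at a
    rw [a]
    apply Finset.sum_congr rfl; intro i _
    have := sum_toNat 1 n (fun j => f i j)
    simpa using this
  rw [conv (fun i j => (ep i j - c)^2)] at hc
  have hmean : ∑ i ∈ Icc 1 n, ∑ j ∈ Icc 1 n, ep i j * ep i j ≤ ∑ i ∈ Icc 1 n, ∑ j ∈ Icc 1 n, (ep i j - c)^2 := by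
    have : ∑ i ∈ Icc 1 n, ∑ j ∈ Icc 1 n, (ep i j - c)^2 = ∑ i ∈ Icc 1 n, ∑ j ∈ Icc 1 n, ep i j * ep i j
        - 2 * c * ∑ i ∈ Icc 1 n, ∑ j ∈ Icc 1 n, ep i j + ∑ i ∈ Icc 1 n, ∑ j ∈ Icc 1 n, c^2 := by
      simp only [Finset.mul_sum, ← Finset.sum_sub_distrib, ← Finset.sum_add_distrib]
      refine Finset.sum_congr rfl fun i _ => Finset.sum_congr rfl fun j _ => ?_
      ring
    rw [this]
    unfold inM at hM
    rw [hM]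
    have : 0 ≤ ∑ i ∈ Icc 1 n, ∑ j ∈ Icc 1 n, c^2 := Finset.sum_nonneg fun i _ => Finset.sum_nonneg fun j _ => sq_nonneg _
    linarith
  have hfin : innerM n ep ep ≤ 480000000 * T := by
    unfold innerM gh
    rw [div_pow, one_pow, div_mul_eq_mul_div, one_mul, div_le_iff₀ (by positivity)]
    linarith
  set x := H1semi n e1 e2 with hx
  set y := Real.sqrt (innerV1 n R1 R1) with hy
  set w := Real.sqrt (innerV2 n R2 R2) with hw
  have x0 : 0 ≤ x := Real.sqrt_nonneg _
  have y0 : 0 ≤ y := Real.sqrt_nonneg _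
  have w0 : 0 ≤ w := Real.sqrt_nonneg _
  have x2 : x^2 = H1semisq n e1 e2 := Real.sq_sqrt hH
  have y2 : y^2 = innerV1 n R1 R1 := Real.sq_sqrt (nV1 _)
  have w2 : w^2 = innerV2 n R2 R2 := Real.sq_sqrt (nV2 _)
  apply Real.sqrt_le_iff.mpr
  refine ⟨by positivity, hfin.trans ?_⟩
  rw [hT, ← x2, ← y2, ← w2]
  nlinarith [mul_nonneg x0 y0, mul_nonneg x0 w0, mul_nonneg y0 w0, sq_nonneg x, sq_nonneg y, sq_nonneg w]
end
end
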